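/- Assume the existence of a strongly inaccessible cardinal is consistent with ZFC. Then it is consistent with ZFC + CH + 2^{ω₁} > ω₂ that there exists a Jech–Kunen tree but there are no Kurepa trees. -/

import Mathlib

open FirstOrder FirstOrder.Language

/-! ### The first-order language and theory of ZFC -/

/-- The language of set theory: one binary relation `∈`. -/
def memLang : FirstOrder.Language where
  Functions := fun _ => Empty
  Relations := fun n => match n with | 2 => PUnit | _ => Empty

/-- The membership relation symbol. -/
abbrev memSym : memLang.Relations 2 := PUnit.unit

/-- `xᵢ ∈ xⱼ` as a bounded formula. -/
def mem' {n : ℕ} (i j : Fin n) : memLang.BoundedFormula Empty n :=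
  memSym.boundedFormula₂ (Term.var (Sum.inr i)) (Term.var (Sum.inr j))

/-- `xᵢ = xⱼ` as a bounded formula. -/
def eq' {n : ℕ} (i j : Fin n) : memLang.BoundedFormula Empty n :=
  Term.bdEqual (Term.var (Sum.inr i)) (Term.var (Sum.inr j))

def extAx : memLang.Sentence :=
  ∀' ∀' ((∀' (mem' 2 0 ⇔ mem' 2 1)) ⟹ eq' 0 1)

def pairAx : memLang.Sentence :=
  ∀' ∀' ∃' ∀' (mem' 3 2 ⇔ (eq' 3 0 ⊔ eq' 3 1))

def unionAx : memLang.Sentence :=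
  ∀' ∃' ∀' (mem' 2 1 ⇔ ∃' (mem' 3 0 ⊓ mem' 2 3))

def powerAx : memLang.Sentence :=
  ∀' ∃' ∀' (mem' 2 1 ⇔ ∀' (mem' 3 2 ⟹ mem' 3 0))

def infAx : memLang.Sentence :=
  ∃' ((∃' (mem' 1 0 ⊓ ∀' ∼(mem' 2 1))) ⊓
    ∀' (mem' 1 0 ⟹ ∃' (mem' 2 0 ⊓ ∀' (mem' 3 2 ⇔ (mem' 3 1 ⊔ eq' 3 1)))))

def foundAx : memLang.Sentence :=
  ∀' ((∃' (mem' 1 0)) ⟹ ∃' (mem' 1 0 ⊓ ∀' (mem' 2 1 ⟹ ∼(mem' 2 0))))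

def choiceAx : memLang.Sentence :=
  ∀' (((∀' (mem' 1 0 ⟹ ∃' (mem' 2 1))) ⊓
        (∀' ∀' (((mem' 1 0 ⊓ mem' 2 0) ⊓ ∃' (mem' 3 1 ⊓ mem' 3 2)) ⟹ eq' 1 2))) ⟹
    ∃' ∀' (mem' 2 0 ⟹ ∃' ((mem' 3 2 ⊓ mem' 3 1) ⊓ ∀' ((mem' 4 2 ⊓ mem' 4 1) ⟹ eq' 4 3))))

/-- The separation schema: for each formula `φ(p₁,…,pₙ,z)`,
`∀ p⃗ ∀ a ∃ b ∀ z (z ∈ b ↔ z ∈ a ∧ φ(p⃗, z))`. -/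
def sepAx (n : ℕ) (φ : memLang.BoundedFormula Empty (n + 1)) : memLang.Sentence :=
  (∀' ∃' ∀' (mem' ⟨n + 2, by omega⟩ ⟨n + 1, by omega⟩ ⇔
      (mem' ⟨n + 2, by omega⟩ ⟨n, by omega⟩ ⊓ φ.liftAt 2 n))).alls

/-- The collection (replacement) schema: for each formula `φ(p₁,…,pₙ,x,y)`,
`∀ p⃗ ∀ a ∃ b ∀ x ∈ a ((∃ y φ) → ∃ y ∈ b φ)`. -/
def collAx (n : ℕ) (φ : memLang.BoundedFormula Empty (n + 2)) : memLang.Sentence :=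
  (∀' ∃' ∀' (mem' ⟨n + 2, by omega⟩ ⟨n, by omega⟩ ⟹
      ((∃' (φ.liftAt 2 n)) ⟹
        ∃' (mem' ⟨n + 3, by omega⟩ ⟨n + 1, by omega⟩ ⊓ φ.liftAt 2 n)))).alls

/-- The first-order theory ZFC (with the collection form of replacement). -/
def ZFCTheory : memLang.Theory :=
  {extAx, pairAx, unionAx, powerAx, infAx, foundAx, choiceAx} ∪
    (⋃ n : ℕ, Set.range (sepAx n)) ∪ (⋃ n : ℕ, Set.range (collAx n))

/-- The membership relation of a `memLang`-structure. -/
def memE (V : Type) (str : memLang.Structure V) : V → V → Prop :=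
  fun x y => str.RelMap memSym ![x, y]
/-! ### Set-theoretic notions, interpreted in a model `(V, E)` of ZFC.
All of the following are first-order expressible, so for a model of (first-order)
ZFC they are exactly the relativized notions. -/

section Semantics

variable {V : Type} (E : V → V → Prop)

/-- `x ⊆ y` in `V`. -/
def SubV (x y : V) : Prop := ∀ z, E z x → E z y

def IsEmptyV (e : V) : Prop := ∀ z, ¬ E z e

def IsSingletonOf (s a : V) : Prop := ∀ z, E z s ↔ z = a

def IsUPairOf (u a b : V) : Prop := ∀ z, E z u ↔ (z = a ∨ z = b)

/-- `p` is the Kuratowski ordered pair `⟨a, b⟩`. -/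
def IsOPairOf (p a b : V) : Prop :=
  ∃ s u, IsSingletonOf E s a ∧ IsUPairOf E u a b ∧ IsUPairOf E p s u

/-- `f(x) = y`, for `f` a set of ordered pairs. -/
def FunVal (f x y : V) : Prop := ∃ p, E p f ∧ IsOPairOf E p x y

/-- `f` is a function with domain `a` (a set of ordered pairs in `V`). -/
def IsFuncOn (f a : V) : Prop :=
  (∀ p, E p f → ∃ x y, IsOPairOf E p x y) ∧
  (∀ x y y', FunVal E f x y → FunVal E f x y' → y = y') ∧
  (∀ x, (∃ y, FunVal E f x y) ↔ E x a)

/-- `f : a → b` in `V`. -/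
def IsFuncInto (f a b : V) : Prop := IsFuncOn E f a ∧ ∀ x y, FunVal E f x y → E y b

def InjFun (f : V) : Prop := ∀ x x' y, FunVal E f x y → FunVal E f x' y → x = x'

/-- `|a| ≤ |b|` in `V`: an injection of `a` into `b` exists in `V`. -/
def InjInto (a b : V) : Prop := ∃ f, IsFuncInto E f a b ∧ InjFun E f

/-- `|a| = |b|` in `V`: a bijection exists in `V`. -/
def EquinumV (a b : V) : Prop :=
  ∃ f, IsFuncInto E f a b ∧ InjFun E f ∧ ∀ y, E y b → ∃ x, FunVal E f x y

def IsTransSet (x : V) : Prop := ∀ y, E y x → SubV E y x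

/-- `x` is an ordinal: a transitive set linearly ordered by `E`. -/
def IsOrdV (x : V) : Prop :=
  IsTransSet E x ∧ ∀ y z, E y x → E z x → (E y z ∨ y = z ∨ E z y)

def IsLimitOrdV (x : V) : Prop :=
  IsOrdV E x ∧ (∃ y, E y x) ∧ ∀ y, E y x → ∃ z, E z x ∧ E y z

/-- `w = ω` in `V`: the least limit ordinal. -/
def IsOmegaV (w : V) : Prop := IsLimitOrdV E w ∧ ∀ x, E x w → ¬ IsLimitOrdV E x

/-- `x` is countable in `V`. -/
def CountableV (x : V) : Prop := ∃ w, IsOmegaV E w ∧ InjInto E x w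

/-- `k = ω₁` in `V`: the least uncountable ordinal. -/
def IsOmega1V (k : V) : Prop :=
  IsOrdV E k ∧ ¬ CountableV E k ∧ ∀ a, E a k → CountableV E a

/-- `k = ω₂` in `V`: the least ordinal of cardinality `> ω₁`. -/
def IsOmega2V (k : V) : Prop :=
  IsOrdV E k ∧ ∀ k₁, IsOmega1V E k₁ → (¬ InjInto E k k₁ ∧ ∀ a, E a k → InjInto E a k₁)

/-- `p = 𝒫(x)` in `V`. -/
def IsPowOf (p x : V) : Prop := ∀ z, E z p ↔ SubV E z x

/-- CH holds in `V`: `𝒫(ω)` is equinumerous with `ω₁`. -/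
def CHV : Prop :=
  ∀ w p k₁, IsOmegaV E w → IsPowOf E p w → IsOmega1V E k₁ → EquinumV E p k₁

/-- `2^{ω₁} > ω₂` holds in `V`: `𝒫(ω₁)` does not inject into `ω₂`. -/
def PowOmega1AboveOmega2V : Prop :=
  ∀ k₁ p k₂, IsOmega1V E k₁ → IsPowOf E p k₁ → IsOmega2V E k₂ → ¬ InjInto E p k₂

/-- `k` is a cardinal in `V`. -/
def IsCardV (k : V) : Prop := IsOrdV E k ∧ ∀ a, E a k → ¬ EquinumV E a k

/-- `k` is regular in `V`: every function from a smaller ordinal into `k` is bounded. -/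
def IsRegularV (k : V) : Prop :=
  IsOrdV E k ∧ ∀ a f, E a k → IsFuncInto E f a k →
    ∃ b, E b k ∧ ∀ x y, FunVal E f x y → E y b

/-- `k` is strongly inaccessible in `V`. -/
def IsInaccessibleV (k : V) : Prop :=
  IsCardV E k ∧ ¬ CountableV E k ∧ IsRegularV E k ∧
    ∀ a p, E a k → IsPowOf E p a → ∃ b, E b k ∧ InjInto E p b

def IsOneV (o : V) : Prop := ∀ z, E z o ↔ IsEmptyV E z

/-- `t = 2 = {0, 1}` in `V`. -/
def IsTwoV (t : V) : Prop := ∀ z, E z t ↔ (IsEmptyV E z ∨ IsOneV E z)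

/-- `x` is a node of `2^{<ω₁}` in `V` (`k₁` standing for ω₁): a function from a
countable ordinal into `2`. -/
def IsNodeV (k₁ x : V) : Prop :=
  ∃ a t, E a k₁ ∧ IsOrdV E a ∧ IsTwoV E t ∧ IsFuncInto E x a t

/-- The node `x` has domain (height) `a`. -/
def HasDomV (x a : V) : Prop := ∀ u, (∃ y, FunVal E x u y) ↔ E u a

/-- `t` is a tree in `V`: a subtree of `2^{<ω₁}`, ordered by inclusion. -/
def IsTreeV (k₁ t : V) : Prop := ∀ x, E x t → IsNodeV E k₁ x

/-- `t` is an ω₁-tree in `V`: cardinality ω₁ and height ω₁. -/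
def IsOmega1TreeV (k₁ t : V) : Prop :=
  IsTreeV E k₁ t ∧ EquinumV E t k₁ ∧ ∀ a, E a k₁ → IsOrdV E a → ∃ x, E x t ∧ HasDomV E x a

/-- `b` is a branch of the tree `t` in `V`: a linearly ordered subset meeting every
nonempty level. -/
def IsBranchV (t b : V) : Prop :=
  SubV E b t ∧ (∀ x y, E x b → E y b → (SubV E x y ∨ SubV E y x)) ∧
    ∀ a, (∃ x, E x t ∧ HasDomV E x a) → ∃ x, E x b ∧ HasDomV E x a

/-- `bs = B(t)`, the set of all branches of `t`, in `V`. -/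
def IsBranchSetOf (t bs : V) : Prop := ∀ z, E z bs ↔ IsBranchV E t z

/-- `l` is the `a`-th level of `t` in `V`. -/
def IsLevelSetOf (t a l : V) : Prop := ∀ x, E x l ↔ (E x t ∧ HasDomV E x a)

/-- `t` is a Kurepa tree in `V`: an ω₁-tree with countable levels and more than
ω₁-many branches. -/
def IsKurepaV (k₁ t : V) : Prop :=
  IsOmega1TreeV E k₁ t ∧
  (∀ a l, E a k₁ → IsLevelSetOf E t a l → CountableV E l) ∧
  ∀ bs, IsBranchSetOf E t bs → ¬ InjInto E bs k₁

/-- `t` is a Jech–Kunen tree in `V`: an ω₁-tree with `ω₁ < |B(t)| < 2^{ω₁}`. -/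
def IsJechKunenV (k₁ t : V) : Prop :=
  IsOmega1TreeV E k₁ t ∧
  ∀ bs p, IsBranchSetOf E t bs → IsPowOf E p k₁ →
    (¬ InjInto E bs k₁ ∧ InjInto E bs p ∧ ¬ EquinumV E bs p)

end Semantics
universe u

section JK1
set_option linter.unusedVariables false


/-! ### Names and the forcing relation for atomic formulas -/

/-- Names over a forcing notion `P`. -/
inductive Nm (P : Type u) [Preorder P] : Type (u + 1)
  | mk (ι : Type u) (x : ι → Nm P) (c : ι → LowerSet P) : Nm P

namespace Nm

variable {P : Type u} [Preorder P]

def idx : Nm P → Type u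
  | mk ι _ _ => ι

def el : (x : Nm P) → x.idx → Nm P
  | mk _ x _ => x

def cond : (x : Nm P) → x.idx → LowerSet P
  | mk _ _ c => c

def eqF : Nm P → Nm P → P → Prop
  | mk ι x c, mk κ y d => fun p =>
    (∀ i, ∀ q ≤ p, q ∈ c i → ∃ r ≤ q, ∃ j, r ∈ d j ∧ eqF (x i) (y j) r) ∧
    (∀ j, ∀ q ≤ p, q ∈ d j → ∃ r ≤ q, ∃ i, r ∈ c i ∧ eqF (x i) (y j) r)

def memF (x y : Nm P) (p : P) : Prop :=
  ∀ q ≤ p, ∃ r ≤ q, ∃ j, r ∈ y.cond j ∧ eqF x (y.el j) r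

theorem eqF_mono : ∀ {x y : Nm P} {p q : P}, eqF x y p → q ≤ p → eqF x y q
  | mk _ _ _, mk _ _ _, _, _, h, hq =>
    ⟨fun i r hr => h.1 i r (hr.trans hq), fun i r hr => h.2 i r (hr.trans hq)⟩

theorem eqF_refl (x : Nm P) : ∀ p, eqF x x p := by
  induction x with
  | mk ι x c ih =>
    intro p
    exact ⟨fun i q _ hc => ⟨q, le_rfl, i, hc, ih i q⟩, fun i q _ hc => ⟨q, le_rfl, i, hc, ih i q⟩⟩

theorem eqF_symm : ∀ {x y : Nm P} {p : P}, eqF x y p → eqF y x p := by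
  intro x
  induction x with
  | mk ι x c ih =>
    intro y p h
    cases y with
    | mk κ y d =>
      refine ⟨fun j q hq hj => ?_, fun i q hq hi => ?_⟩
      · obtain ⟨r, hr, i, hi, h'⟩ := h.2 j q hq hj
        exact ⟨r, hr, i, hi, ih i h'⟩
      · obtain ⟨r, hr, i, hi, h'⟩ := h.1 i q hq hi
        exact ⟨r, hr, i, hi, ih _ h'⟩

theorem eqF_trans : ∀ {x y z : Nm P} {p : P}, eqF x y p → eqF y z p → eqF x z p := by
  intro x
  induction x with
  | mk ι x c ih =>
    intro y z p h h'
    cases y with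
    | mk κ y d =>
      cases z with
      | mk μ z e =>
        refine ⟨fun i q hq hi => ?_, fun k q hq hk => ?_⟩
        · obtain ⟨r, hr, j, hj, h1⟩ := h.1 i q hq hi
          obtain ⟨r', hr', k, hk, h2⟩ := h'.1 j r (hr.trans hq) hj
          exact ⟨r', hr'.trans hr, k, hk, ih i (eqF_mono h1 hr') h2⟩
        · obtain ⟨r, hr, j, hj, h1⟩ := h'.2 k q hq hk
          obtain ⟨r', hr', i, hi, h2⟩ := h.2 j r (hr.trans hq) hj
          exact ⟨r', hr'.trans hr, i, hi, ih i h2 (eqF_mono h1 hr')⟩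

theorem eqF_reg : ∀ {x y : Nm P} {p : P}, (∀ q ≤ p, ∃ r ≤ q, eqF x y r) → eqF x y p
  | mk _ _ c, mk _ _ d, p, h => by
    refine ⟨fun i q hq hi => ?_, fun i q hq hi => ?_⟩
    · obtain ⟨r, hr, h1⟩ := h q hq
      obtain ⟨r', hr', j, hj, h2⟩ := h1.1 i r le_rfl ((c i).lower hr hi)
      exact ⟨r', hr'.trans hr, j, hj, h2⟩
    · obtain ⟨r, hr, h1⟩ := h q hq
      obtain ⟨r', hr', j, hj, h2⟩ := h1.2 i r le_rfl ((d i).lower hr hi)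
      exact ⟨r', hr'.trans hr, j, hj, h2⟩

theorem memF_mono {x y : Nm P} {p q : P} (h : memF x y p) (hq : q ≤ p) : memF x y q :=
  fun r hr => h r (hr.trans hq)

theorem memF_reg {x y : Nm P} {p : P} (h : ∀ q ≤ p, ∃ r ≤ q, memF x y r) : memF x y p := by
  intro q hq
  obtain ⟨r, hr, h1⟩ := h q hq
  obtain ⟨r', hr', j, h2⟩ := h1 r le_rfl
  exact ⟨r', hr'.trans hr, j, h2⟩

theorem memF_el {y : Nm P} (j : y.idx) {p : P} (h : p ∈ y.cond j) : memF (y.el j) y p :=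
  fun q hq => ⟨q, le_rfl, j, (y.cond j).lower hq h, eqF_refl _ _⟩

theorem memF_congr_left {x x' y : Nm P} {p : P} (h : eqF x x' p) (hm : memF x y p) :
    memF x' y p := by
  intro q hq
  obtain ⟨r, hr, j, hj, h1⟩ := hm q hq
  exact ⟨r, hr, j, hj, eqF_trans (eqF_symm (eqF_mono h (hr.trans hq))) h1⟩

theorem memF_congr_right {x y y' : Nm P} {p : P} (h : eqF y y' p) (hm : memF x y p) :
    memF x y' p := by
  intro q hq
  obtain ⟨r, hr, j, hj, h1⟩ := hm q hq
  cases y with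
  | mk κ y d =>
    cases y' with
    | mk κ' y' d' =>
      obtain ⟨r', hr', k, hk, h2⟩ := h.1 j r (hr.trans hq) hj
      exact ⟨r', hr'.trans hr, k, hk, eqF_trans (eqF_mono h1 hr') h2⟩

theorem eqF_ext {x y : Nm P} {p : P} (h : ∀ z, ∀ q ≤ p, memF z x q ↔ memF z y q) :
    eqF x y p := by
  cases x with
  | mk ι x c =>
    cases y with
    | mk κ y d =>
      refine ⟨fun i q hq hi => ?_, fun i q hq hi => ?_⟩
      · exact (h (x i) q hq).1 (memF_el (y := mk ι x c) i hi) q le_rfl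
      · obtain ⟨r, hr, j, hj, h'⟩ := (h (y i) q hq).2 (memF_el (y := mk κ y d) i hi) q le_rfl
        exact ⟨r, hr, j, hj, eqF_symm h'⟩

/-! ### The forcing relation -/

def tval {n : ℕ} (v : Fin n → Nm P) : memLang.Term (Empty ⊕ Fin n) → Nm P
  | .var (.inr i) => v i
  | .var (.inl e) => e.elim
  | .func f _ => Empty.elim f

def relF : (l : ℕ) → memLang.Relations l → (Fin l → Nm P) → P → Prop
  | 0, R, _ => Empty.elim R
  | 1, R, _ => Empty.elim R
  | 2, _, w => memF (w 0) (w 1)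
  | _ + 3, R, _ => Empty.elim R

def Forces : {n : ℕ} → memLang.BoundedFormula Empty n → (Fin n → Nm P) → P → Prop
  | _, .falsum, _, _ => False
  | _, .equal s t, v, p => eqF (tval v s) (tval v t) p
  | _, .rel R ts, v, p => relF _ R (fun i => tval v (ts i)) p
  | _, .imp φ ψ, v, p => ∀ q ≤ p, Forces φ v q → Forces ψ v q
  | _, .all φ, v, p => ∀ x, Forces φ (Fin.snoc v x) p

theorem forces_mono {n : ℕ} (φ : memLang.BoundedFormula Empty n) :
    ∀ {v : Fin n → Nm P} {p q : P}, Forces φ v p → q ≤ p → Forces φ v q := by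
  induction φ with
  | falsum => intro v p q h; exact h.elim
  | equal s t => intro v p q h hq; exact eqF_mono h hq
  | @rel n l R ts =>
    intro v p q h hq
    match l, R with
    | 0, R => exact Empty.elim R
    | 1, R => exact Empty.elim R
    | 2, _ => exact memF_mono h hq
    | _ + 3, R => exact Empty.elim R
  | imp φ ψ _ _ => intro v p q h hq r hr; exact h r (hr.trans hq)
  | all φ ih => intro v p q h hq x; exact ih (h x) hq

theorem forces_reg {n : ℕ} (φ : memLang.BoundedFormula Empty n) :
    ∀ {v : Fin n → Nm P} {p : P}, (∀ q ≤ p, ∃ r ≤ q, Forces φ v r) → Forces φ v p := by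
  induction φ with
  | falsum => intro v p h; obtain ⟨r, _, h⟩ := h p le_rfl; exact h
  | equal s t => intro v p h; exact eqF_reg h
  | @rel n l R ts =>
    intro v p h
    match l, R with
    | 0, R => exact Empty.elim R
    | 1, R => exact Empty.elim R
    | 2, _ => exact memF_reg h
    | _ + 3, R => exact Empty.elim R
  | imp φ ψ _ ih =>
    intro v p h q hq hφ
    refine ih fun r hr => ?_
    obtain ⟨r', hr', h'⟩ := h r (hr.trans hq)
    exact ⟨r', hr', h' r' le_rfl (forces_mono φ hφ (hr'.trans hr))⟩
  | all φ ih =>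
    intro v p h x
    refine ih fun q hq => ?_
    obtain ⟨r, hr, h'⟩ := h q hq
    exact ⟨r, hr, h' x⟩

theorem forces_not_iff {n : ℕ} (φ : memLang.BoundedFormula Empty n) {v : Fin n → Nm P} {p : P} :
    Forces (∼φ) v p ↔ ∀ q ≤ p, ¬ Forces φ v q := Iff.rfl

theorem exists_forces_not {n : ℕ} (φ : memLang.BoundedFormula Empty n) {v : Fin n → Nm P} {p : P}
    (h : ¬ Forces φ v p) : ∃ q ≤ p, Forces (∼φ) v q := by
  by_contra hc
  push Not at hc
  refine h (forces_reg φ fun q hq => ?_)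
  have := hc q hq
  rw [forces_not_iff] at this
  push Not at this
  exact this

/-- Unordered pair name. -/
def upN (a b : Nm P) : Nm P := mk (ULift Bool) (fun i => bif i.down then a else b) (fun _ => ⊤)

def opN (a b : Nm P) : Nm P := upN (upN a a) (upN a b)

open Classical in
noncomputable def decL (x : Nm P) : Nm P := if h : ∃ a b, x = upN a b then h.choose else x

open Classical in
noncomputable def decR (x : Nm P) : Nm P :=
  if h : ∃ a b, x = upN a b then h.choose_spec.choose else x

theorem upN_inj {a b a' b' : Nm P} (h : upN a b = upN a' b') : a = a' ∧ b = b' := by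
  unfold upN at h
  have h2 := (mk.inj h).2.1
  have h3 := eq_of_heq h2
  exact ⟨congrFun h3 ⟨true⟩, congrFun h3 ⟨false⟩⟩

theorem decL_upN (a b : Nm P) : decL (upN a b) = a := by
  have h : ∃ a' b', upN a b = upN a' b' := ⟨a, b, rfl⟩
  unfold decL
  rw [dif_pos h]
  exact (upN_inj h.choose_spec.choose_spec).1.symm

theorem decR_upN (a b : Nm P) : decR (upN a b) = b := by
  have h : ∃ a' b', upN a b = upN a' b' := ⟨a, b, rfl⟩
  unfold decR
  rw [dif_pos h]
  exact (upN_inj h.choose_spec.choose_spec).2.symm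

end Nm

/-! ### Generic countable models -/

/-- Countable closure. -/
def SC (P : Type u) [Preorder P] : Prop :=
  ∀ f : ℕ → P, (∀ n, f (n + 1) ≤ f n) → ∃ q, ∀ n, q ≤ f n

section Tasks

variable {P : Type u} [Preorder P] {A : Type*}

theorem task_step (hP : SC P) (τ : ℕ → List A → P → A → Prop)
    (hm : ∀ k l p q x, τ k l p x → q ≤ p → τ k l q x)
    (hd : ∀ k l p, ∃ q ≤ p, ∃ x, τ k l q x) (p : P) (S : Set A) (hS : S.Countable) :
    ∃ q ≤ p, ∃ S' : Set A, S'.Countable ∧ S ⊆ S' ∧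
      ∀ k (l : List A), (∀ a ∈ l, a ∈ S) → ∃ x ∈ S', τ k l q x := by
  have hcl : {l : List A | ∀ a ∈ l, a ∈ S}.Countable := by
    have := hS.to_subtype
    have h2 : (Set.range (fun l : List S => l.map Subtype.val)).Countable := Set.countable_range _
    refine h2.mono ?_
    intro l hl
    exact ⟨l.attachWith _ hl, by simp⟩
  have hcp : (Set.univ ×ˢ {l : List A | ∀ a ∈ l, a ∈ S} : Set (ℕ × List A)).Countable :=
    Set.countable_univ.prod hcl
  have hne : (Set.univ ×ˢ {l : List A | ∀ a ∈ l, a ∈ S} : Set (ℕ × List A)).Nonempty :=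
    ⟨(0, []), by simp⟩
  obtain ⟨e, he⟩ := hcp.exists_eq_range hne
  choose nx hnx wx hwx using hd
  let f : ℕ → P := fun n => Nat.rec p (fun n r => nx (e n).1 (e n).2 r) n
  have hf : ∀ n, f (n + 1) = nx (e n).1 (e n).2 (f n) := fun n => rfl
  obtain ⟨q, hq⟩ := hP f (fun n => by rw [hf]; exact hnx _ _ _)
  refine ⟨q, hq 0, S ∪ Set.range (fun n => wx (e n).1 (e n).2 (f n)), hS.union
    (Set.countable_range _), Set.subset_union_left, ?_⟩
  intro k l hl
  have : (k, l) ∈ Set.range e := by rw [← he]; exact ⟨trivial, hl⟩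
  obtain ⟨n, hn⟩ := this
  refine ⟨wx (e n).1 (e n).2 (f n), Or.inr ⟨n, rfl⟩, ?_⟩
  have h1 := hwx (e n).1 (e n).2 (f n)
  rw [← hf] at h1
  have h2 := hm _ _ _ _ _ h1 (hq (n + 1))
  rw [hn] at h2 ⊢
  exact h2

theorem task_all (hP : SC P) (τ : ℕ → List A → P → A → Prop)
    (hm : ∀ k l p q x, τ k l p x → q ≤ p → τ k l q x)
    (hd : ∀ k l p, ∃ q ≤ p, ∃ x, τ k l q x) (p : P) (S : Set A) (hS : S.Countable) :
    ∃ q ≤ p, ∃ M : Set A, M.Countable ∧ S ⊆ M ∧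
      ∀ k (l : List A), (∀ a ∈ l, a ∈ M) → ∃ x ∈ M, τ k l q x := by
  have step := task_step hP τ hm hd
  choose nq hnq nS hnS hsub ht using step
  let f : ℕ → (P × {S : Set A // S.Countable}) := fun n => Nat.rec (p, ⟨S, hS⟩)
    (fun _ r => (nq r.1 r.2.1 r.2.2, ⟨nS r.1 r.2.1 r.2.2, hnS _ _ _⟩)) n
  have hf : ∀ n, f (n + 1) = (nq (f n).1 (f n).2.1 (f n).2.2,
    ⟨nS (f n).1 (f n).2.1 (f n).2.2, hnS _ _ _⟩) := fun n => rfl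
  obtain ⟨q, hq⟩ := hP (fun n => (f n).1) (fun n => by simp only [hf]; exact hnq _ _ _)
  have hmono : Monotone (fun n => (f n).2.1) := by
    refine monotone_nat_of_le_succ fun n => ?_
    simp only [hf]
    exact hsub _ _ _
  refine ⟨q, hq 0, ⋃ n, (f n).2.1, Set.countable_iUnion fun n => (f n).2.2,
    Set.subset_iUnion (fun n => (f n).2.1) 0, ?_⟩
  intro k l hl
  have : ∃ n, ∀ a ∈ l, a ∈ (f n).2.1 := by
    clear ht
    induction l with
    | nil => exact ⟨0, by simp⟩
    | cons a l ih =>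
      obtain ⟨n, hn⟩ := ih fun b hb => hl b (by simp [hb])
      obtain ⟨m, hm⟩ := Set.mem_iUnion.1 (hl a (by simp))
      refine ⟨max n m, ?_⟩
      intro b hb
      rcases List.mem_cons.1 hb with rfl | hb
      · exact hmono (le_max_right n m) hm
      · exact hmono (le_max_left n m) (hn b hb)
  obtain ⟨n, hn⟩ := this
  obtain ⟨x, hx, hx'⟩ := ht (f n).1 (f n).2.1 (f n).2.2 k l hn
  refine ⟨x, Set.mem_iUnion.2 ⟨n + 1, ?_⟩, hm _ _ _ _ _ hx' ?_⟩
  · rw [hf]; exact hx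
  · have := hq (n + 1)
    simp only [hf] at this
    exact this

end Tasks

end JK1

section JK2
set_option linter.unusedVariables false

/-- The structure determined by a binary relation. -/
@[reducible] def strOf {N : Type*} (E : N → N → Prop) : memLang.Structure N where
  funMap := fun {n} f _ => Empty.elim f
  RelMap := fun {n} R => match n, R with
    | 0, R => Empty.elim R
    | 1, R => Empty.elim R
    | 2, _ => fun w => E (w 0) (w 1)
    | _ + 3, R => Empty.elim R

theorem memE_strOf {N : Type} (E : N → N → Prop) : memE N (strOf E) = E := rfl

instance memLang_countable : Countable (Σ l, memLang.Functions l) :=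
  ⟨⟨fun x => Empty.elim x.2, fun x => Empty.elim x.2⟩⟩

instance memLang_countable' : Countable (Σ l, memLang.Relations l) := by
  refine ⟨⟨fun x => x.1, ?_⟩⟩
  rintro ⟨a, x⟩ ⟨b, y⟩ h
  obtain rfl : a = b := h
  match a, x, y with
  | 0, x, _ => exact Empty.elim x
  | 1, x, _ => exact Empty.elim x
  | 2, _, _ => rfl
  | _ + 3, x, _ => exact Empty.elim x

instance memLang_countable'' : Countable memLang.Symbols := by
  unfold Language.Symbols; infer_instance

theorem bf_countable : Countable (Σ n, memLang.BoundedFormula Empty n) := inferInstance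

/-- A countable generic model. -/
structure GM (P : Type u) [Preorder P] where
  q : P
  e : ℕ → Nm P
  dec : ∀ {n : ℕ} (φ : memLang.BoundedFormula Empty n) (v : Fin n → Nm P),
    (∀ i, v i ∈ Set.range e) → Nm.Forces φ v q ∨ Nm.Forces (∼φ) v q
  wit : ∀ {n : ℕ} (φ : memLang.BoundedFormula Empty (n + 1)) (v : Fin n → Nm P),
    (∀ i, v i ∈ Set.range e) → Nm.Forces (∀' φ) v q ∨
      ∃ x ∈ Set.range e, Nm.Forces (∼φ) (Fin.snoc v x) q
  child : ∀ x y, x ∈ Set.range e → y ∈ Set.range e → Nm.memF x y q →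
    ∃ j, q ∈ y.cond j ∧ Nm.eqF x (y.el j) q ∧ y.el j ∈ Set.range e
  up : ∀ x y, x ∈ Set.range e → y ∈ Set.range e → Nm.upN x y ∈ Set.range e
  dl : ∀ x, x ∈ Set.range e → Nm.decL x ∈ Set.range e
  dr : ∀ x, x ∈ Set.range e → Nm.decR x ∈ Set.range e

namespace GM
variable {P : Type u} [Preorder P]

def emp : Nm P := Nm.mk PEmpty (fun i => i.elim) (fun i => i.elim)

def lv (l : List (Nm P)) (n : ℕ) : Fin n → Nm P := fun i => l.getD i emp

theorem lv_ofFn {n : ℕ} (v : Fin n → Nm P) : lv (List.ofFn v) n = v := by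
  funext i
  simp [lv]

/-- The index type of the tasks. -/
inductive TK
  | dec (φ : Σ n, memLang.BoundedFormula Empty n)
  | wit (φ : Σ n, memLang.BoundedFormula Empty n)
  | child | up | dl | dr

instance : Countable TK := by
  let f : TK → (Σ n, memLang.BoundedFormula Empty n) ⊕ (Σ n, memLang.BoundedFormula Empty n) ⊕ Fin 4
    | .dec φ => .inl φ
    | .wit φ => .inr (.inl φ)
    | .child => .inr (.inr 0)
    | .up => .inr (.inr 1)
    | .dl => .inr (.inr 2)
    | .dr => .inr (.inr 3)
  refine Function.Injective.countable (f := f) ?_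
  intro a b h
  cases a <;> cases b <;> simp_all [f]

noncomputable def tk : TK → List (Nm P) → P → Nm P → Prop
  | .dec φ, l, p, _ => Nm.Forces φ.2 (lv l φ.1) p ∨ Nm.Forces (∼φ.2) (lv l φ.1) p
  | .wit ⟨0, φ⟩, l, p, _ => True
  | .wit ⟨n + 1, φ⟩, l, p, x =>
    Nm.Forces (∀' φ) (lv l n) p ∨ Nm.Forces (∼φ) (Fin.snoc (lv l n) x) p
  | .child, l, p, z => (∀ r ≤ p, ¬ Nm.memF (lv l 2 0) (lv l 2 1) r) ∨
      ∃ j, p ∈ (lv l 2 1).cond j ∧ Nm.eqF (lv l 2 0) ((lv l 2 1).el j) p ∧ z = (lv l 2 1).el j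
  | .up, l, _, z => z = Nm.upN (lv l 2 0) (lv l 2 1)
  | .dl, l, _, z => z = Nm.decL (lv l 1 0)
  | .dr, l, _, z => z = Nm.decR (lv l 1 0)

theorem tk_mono (k : TK) (l : List (Nm P)) (p q : P) (x : Nm P) (h : tk k l p x) (hq : q ≤ p) :
    tk k l q x := by
  match k with
  | .dec φ => exact h.imp (fun h => Nm.forces_mono _ h hq) (fun h => Nm.forces_mono _ h hq)
  | .wit ⟨0, φ⟩ => trivial
  | .wit ⟨n + 1, φ⟩ => exact h.imp (fun h => Nm.forces_mono _ h hq) (fun h => Nm.forces_mono _ h hq)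
  | .child =>
    rcases h with h | ⟨j, h1, h2, h3⟩
    · exact Or.inl fun r hr => h r (hr.trans hq)
    · exact Or.inr ⟨j, LowerSet.lower _ hq h1, Nm.eqF_mono h2 hq, h3⟩
  | .up => exact h
  | .dl => exact h
  | .dr => exact h

theorem tk_dense (k : TK) (l : List (Nm P)) (p : P) : ∃ q ≤ p, ∃ x, tk k l q x := by
  match k with
  | .dec φ =>
    by_cases h : Nm.Forces φ.2 (lv l φ.1) p
    · exact ⟨p, le_rfl, emp, Or.inl h⟩
    · obtain ⟨q, hq, h⟩ := Nm.exists_forces_not _ h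
      exact ⟨q, hq, emp, Or.inr h⟩
  | .wit ⟨0, φ⟩ => exact ⟨p, le_rfl, emp, trivial⟩
  | .wit ⟨n + 1, φ⟩ =>
    by_cases h : Nm.Forces (∀' φ) (lv l n) p
    · exact ⟨p, le_rfl, emp, Or.inl h⟩
    · have : ∃ x, ¬ Nm.Forces φ (Fin.snoc (lv l n) x) p := by
        by_contra hc; push Not at hc; exact h hc
      obtain ⟨x, hx⟩ := this
      obtain ⟨q, hq, h⟩ := Nm.exists_forces_not _ hx
      exact ⟨q, hq, x, Or.inr h⟩
  | .child =>
    by_cases h : ∀ r ≤ p, ¬ Nm.memF (lv l 2 0) (lv l 2 1) r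
    · exact ⟨p, le_rfl, emp, Or.inl h⟩
    · push Not at h
      obtain ⟨r, hr, h⟩ := h
      obtain ⟨r', hr', j, h1, h2⟩ := h r le_rfl
      exact ⟨r', hr'.trans hr, _, Or.inr ⟨j, h1, h2, rfl⟩⟩
  | .up => exact ⟨p, le_rfl, _, rfl⟩
  | .dl => exact ⟨p, le_rfl, _, rfl⟩
  | .dr => exact ⟨p, le_rfl, _, rfl⟩

theorem exists_gm (hP : SC P) (p : P) (S : Set (Nm P)) (hS : S.Countable) :
    ∃ g : GM P, g.q ≤ p ∧ S ⊆ Set.range g.e := by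
  have : Nonempty TK := ⟨.child⟩
  obtain ⟨ek, hek⟩ := exists_surjective_nat TK
  obtain ⟨q, hq, M, hM, hSM, h⟩ := task_all hP (fun k => tk (P := P) (ek k))
    (fun k => tk_mono _) (fun k => tk_dense _) p S hS
  have hne : M.Nonempty := by
    obtain ⟨x, hx, _⟩ := h 0 [] (by simp)
    exact ⟨x, hx⟩
  have h' : ∀ k (l : List (Nm P)), (∀ a ∈ l, a ∈ M) → ∃ x ∈ M, tk k l q x := by
    intro k l hl
    obtain ⟨n, rfl⟩ := hek k
    exact h n l hl
  obtain ⟨e, rfl⟩ := hM.exists_eq_range hne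
  have hof : ∀ {n : ℕ} (v : Fin n → Nm P), (∀ i, v i ∈ Set.range e) →
      ∀ a ∈ List.ofFn v, a ∈ Set.range e := by
    intro n v hv a ha
    obtain ⟨i, rfl⟩ := (List.mem_ofFn' _ _).1 ha
    exact hv i
  refine ⟨⟨q, e, ?_, ?_, ?_, ?_, ?_, ?_⟩, hq, hSM⟩
  · intro n φ v hv
    obtain ⟨x, _, hx⟩ := h' (.dec ⟨n, φ⟩) (List.ofFn v) (hof v hv)
    simpa [tk, lv_ofFn] using hx
  · intro n φ v hv
    obtain ⟨x, hxM, hx⟩ := h' (.wit ⟨n + 1, φ⟩) (List.ofFn v) (hof v hv)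
    simp only [tk, lv_ofFn] at hx
    exact hx.imp id fun h => ⟨x, hxM, h⟩
  · intro x y hx hy hxy
    obtain ⟨z, hz, h⟩ := h' .child [x, y] (by simp only [List.mem_cons]; rintro a (rfl | rfl | h); exacts [hx, hy, by simp at h])
    rcases h with h | ⟨j, h1, h2, h3⟩
    · exact (h q le_rfl hxy).elim
    · exact ⟨j, h1, h2, h3 ▸ hz⟩
  · intro x y hx hy
    obtain ⟨z, hz, h⟩ := h' .up [x, y] (by simp only [List.mem_cons]; rintro a (rfl | rfl | h); exacts [hx, hy, by simp at h])
    exact h ▸ hz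
  · intro x hx
    obtain ⟨z, hz, h⟩ := h' .dl [x] (by simp only [List.mem_cons]; rintro a (rfl | h); exacts [hx, by simp at h])
    exact h ▸ hz
  · intro x hx
    obtain ⟨z, hz, h⟩ := h' .dr [x] (by simp only [List.mem_cons]; rintro a (rfl | h); exacts [hx, by simp at h])
    exact h ▸ hz

variable (g : GM P)

abbrev M : Set (Nm P) := Set.range g.e

def setd : Setoid ℕ where
  r := fun m n => Nm.eqF (g.e m) (g.e n) g.q
  iseqv := ⟨fun _ => Nm.eqF_refl _ _, fun h => Nm.eqF_symm h, fun h h' => Nm.eqF_trans h h'⟩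

/-- The universe of the model. -/
def N : Type := Quotient g.setd

def E : g.N → g.N → Prop := fun x y =>
  Quotient.liftOn₂ x y (fun m n => Nm.memF (g.e m) (g.e n) g.q) (by
    intro a b a' b' h h'
    refine propext ⟨fun hm => ?_, fun hm => ?_⟩
    · exact Nm.memF_congr_left h (Nm.memF_congr_right h' hm)
    · exact Nm.memF_congr_left (Nm.eqF_symm h) (Nm.memF_congr_right (Nm.eqF_symm h') hm))

def toN (n : ℕ) : g.N := Quotient.mk g.setd n

open Classical in
noncomputable def cl (x : Nm P) : g.N :=
  if h : ∃ n, g.e n = x then g.toN h.choose else g.toN 0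

variable {g}

theorem cl_e (n : ℕ) : g.cl (g.e n) = g.toN n := by
  have h : ∃ m, g.e m = g.e n := ⟨n, rfl⟩
  unfold cl
  rw [dif_pos h]
  refine Quotient.sound (s := g.setd) ?_
  change Nm.eqF _ _ _
  rw [h.choose_spec]
  exact Nm.eqF_refl _ _

theorem cl_surj (a : g.N) : ∃ x ∈ g.M, g.cl x = a := by
  induction a using Quotient.inductionOn with
  | h n => exact ⟨g.e n, ⟨n, rfl⟩, cl_e n⟩

theorem cl_eq {x y : Nm P} (hx : x ∈ g.M) (hy : y ∈ g.M) :
    g.cl x = g.cl y ↔ Nm.eqF x y g.q := by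
  obtain ⟨m, rfl⟩ := hx
  obtain ⟨n, rfl⟩ := hy
  rw [cl_e, cl_e]
  exact ⟨fun h => Quotient.exact h, fun h => Quotient.sound h⟩

theorem cl_mem {x y : Nm P} (hx : x ∈ g.M) (hy : y ∈ g.M) :
    g.E (g.cl x) (g.cl y) ↔ Nm.memF x y g.q := by
  obtain ⟨m, rfl⟩ := hx
  obtain ⟨n, rfl⟩ := hy
  rw [cl_e, cl_e]
  exact Iff.rfl

theorem truth {n : ℕ} (φ : memLang.BoundedFormula Empty n) : ∀ (v : Fin n → Nm P),
    (∀ i, v i ∈ g.M) →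
    (@BoundedFormula.Realize memLang g.N (strOf g.E) _ _ φ default (fun i => g.cl (v i)) ↔
      Nm.Forces φ v g.q) := by
  have ht : ∀ {n : ℕ} (v : Fin n → Nm P), (∀ i, v i ∈ g.M) → ∀ t : memLang.Term (Empty ⊕ Fin n),
      @Term.realize memLang g.N (strOf g.E) _ (Sum.elim default (fun i => g.cl (v i))) t =
        g.cl (Nm.tval v t) ∧ Nm.tval v t ∈ g.M := by
    intro n v hv t
    match t with
    | .var (.inr i) => exact ⟨rfl, hv i⟩
    | .var (.inl e) => exact e.elim
    | .func f _ => exact Empty.elim f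
  induction φ with
  | falsum => intro v hv; exact Iff.rfl
  | equal s t =>
    intro v hv
    change @Term.realize memLang g.N (strOf g.E) _ _ s = @Term.realize memLang g.N (strOf g.E) _ _ t
      ↔ Nm.eqF (Nm.tval v s) (Nm.tval v t) g.q
    rw [(ht v hv s).1, (ht v hv t).1]
    exact cl_eq (ht v hv s).2 (ht v hv t).2
  | @rel n l R ts =>
    intro v hv
    match l, R with
    | 0, R => exact Empty.elim R
    | 1, R => exact Empty.elim R
    | 2, _ =>
      change g.E (@Term.realize memLang g.N (strOf g.E) _ _ (ts 0))
        (@Term.realize memLang g.N (strOf g.E) _ _ (ts 1)) ↔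
        Nm.memF (Nm.tval v (ts 0)) (Nm.tval v (ts 1)) g.q
      rw [(ht v hv _).1, (ht v hv _).1]
      exact cl_mem (ht v hv _).2 (ht v hv _).2
    | _ + 3, R => exact Empty.elim R
  | imp φ ψ ih1 ih2 =>
    intro v hv
    change (_ → _) ↔ _
    rw [ih1 v hv, ih2 v hv]
    refine ⟨fun h q hq hφ => ?_, fun h => h g.q le_rfl⟩
    rcases g.dec φ v hv with h' | h'
    · exact Nm.forces_mono _ (h h') hq
    · exact (h' q hq hφ).elim
  | @all n φ ih =>
    intro v hv
    change (∀ a : g.N, _) ↔ _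
    have key : ∀ x ∈ g.M, (@BoundedFormula.Realize memLang g.N (strOf g.E) _ _ φ default
        (Fin.snoc (fun i => g.cl (v i)) (g.cl x)) ↔ Nm.Forces φ (Fin.snoc v x) g.q) := by
      intro x hx
      rw [← ih (Fin.snoc v x)]
      · have : (fun i => g.cl ((Fin.snoc v x : Fin (n + 1) → Nm P) i)) =
          Fin.snoc (α := fun _ => g.N) (fun i => g.cl (v i)) (g.cl x) := by
          funext i
          refine Fin.lastCases ?_ (fun i => ?_) i <;> simp
        rw [this]
      · intro i
        refine Fin.lastCases ?_ (fun i => ?_) i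
        · simpa using hx
        · simpa using hv i
    constructor
    · intro h
      rcases g.wit φ v hv with h' | ⟨x, hx, h'⟩
      · exact h'
      · exact (h' g.q le_rfl ((key x hx).1 (h (g.cl x)))).elim
    · intro h a
      obtain ⟨x, hx, rfl⟩ := cl_surj a
      exact (key x hx).2 (h x)

end GM

end JK2

section JK3
set_option linter.unusedVariables false

/-- Definable (parametrized) properties of structures. -/
class Dn (n : ℕ) (Φ : ∀ V : Type, (V → V → Prop) → (Fin n → V) → Prop) : Prop where
  ex : ∃ φ : memLang.BoundedFormula Empty n, ∀ (V : Type) (E : V → V → Prop) (v : Fin n → V),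
    @BoundedFormula.Realize memLang V (strOf E) _ _ φ default v ↔ Φ V E v

section DnInst

variable {n : ℕ} {Φ Ψ : ∀ V : Type, (V → V → Prop) → (Fin n → V) → Prop}

instance Dn_mem (i j : Fin n) : Dn n (fun V E v => E (v i) (v j)) :=
  ⟨mem' i j, fun V E v => by
    let _ := strOf E
    unfold mem'
    rw [BoundedFormula.realize_rel₂]
    exact Iff.rfl⟩

instance Dn_eq (i j : Fin n) : Dn n (fun V E v => v i = v j) :=
  ⟨eq' i j, fun V E v => by
    let _ := strOf E
    unfold eq'
    rw [BoundedFormula.realize_bdEqual]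
    exact Iff.rfl⟩

instance Dn_imp [h1 : Dn n Φ] [h2 : Dn n Ψ] : Dn n (fun V E v => Φ V E v → Ψ V E v) := by
  obtain ⟨φ, hφ⟩ := h1
  obtain ⟨ψ, hψ⟩ := h2
  refine ⟨φ.imp ψ, fun V E v => ?_⟩
  rw [← hφ, ← hψ]; exact Iff.rfl

instance Dn_false : Dn n (fun V E v => False) := ⟨⊥, fun V E v => Iff.rfl⟩

instance Dn_not [h1 : Dn n Φ] : Dn n (fun V E v => ¬ Φ V E v) :=
  inferInstanceAs (Dn n (fun V E v => Φ V E v → False))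

instance Dn_and [h1 : Dn n Φ] [h2 : Dn n Ψ] : Dn n (fun V E v => Φ V E v ∧ Ψ V E v) := by
  have : Dn n (fun V E v => ¬ (Φ V E v → ¬ Ψ V E v)) := inferInstance
  simpa only [Classical.not_imp, not_not] using this

instance Dn_or [h1 : Dn n Φ] [h2 : Dn n Ψ] : Dn n (fun V E v => Φ V E v ∨ Ψ V E v) := by
  have : Dn n (fun V E v => ¬ Φ V E v → Ψ V E v) := inferInstance
  simpa only [or_iff_not_imp_left] using this

instance Dn_iff [h1 : Dn n Φ] [h2 : Dn n Ψ] : Dn n (fun V E v => Φ V E v ↔ Ψ V E v) := by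
  have : Dn n (fun V E v => (Φ V E v → Ψ V E v) ∧ (Ψ V E v → Φ V E v)) := inferInstance
  simpa only [iff_def] using this

instance Dn_all {Φ : ∀ V : Type, (V → V → Prop) → (Fin n → V) → V → Prop}
    [h : Dn (n + 1) (fun V E v => Φ V E (fun i => v i.castSucc) (v (Fin.last n)))] :
    Dn n (fun V E v => ∀ x : V, Φ V E v x) := by
  obtain ⟨φ, hφ⟩ := h
  refine ⟨φ.all, fun V E v => ?_⟩
  refine forall_congr' fun x => ?_
  rw [hφ]
  simp

instance Dn_ex {Φ : ∀ V : Type, (V → V → Prop) → (Fin n → V) → V → Prop}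
    [h : Dn (n + 1) (fun V E v => Φ V E (fun i => v i.castSucc) (v (Fin.last n)))] :
    Dn n (fun V E v => ∃ x : V, Φ V E v x) := by
  have : Dn n (fun V E v => ¬ ∀ x : V, ¬ Φ V E v x) := inferInstance
  simpa only [not_forall, not_not] using this

variable (i j k l : Fin n)

instance Dn_sub : Dn n (fun V E v => SubV E (v i) (v j)) := by unfold SubV; infer_instance
instance Dn_empty : Dn n (fun V E v => IsEmptyV E (v i)) := by unfold IsEmptyV; infer_instance
instance Dn_sing : Dn n (fun V E v => IsSingletonOf E (v i) (v j)) := by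
  unfold IsSingletonOf; infer_instance
instance Dn_upair : Dn n (fun V E v => IsUPairOf E (v i) (v j) (v k)) := by
  unfold IsUPairOf; infer_instance
instance Dn_opair : Dn n (fun V E v => IsOPairOf E (v i) (v j) (v k)) := by
  unfold IsOPairOf; infer_instance
instance Dn_funVal : Dn n (fun V E v => FunVal E (v i) (v j) (v k)) := by
  unfold FunVal; infer_instance
instance Dn_funcOn : Dn n (fun V E v => IsFuncOn E (v i) (v j)) := by
  unfold IsFuncOn; infer_instance
instance Dn_funcInto : Dn n (fun V E v => IsFuncInto E (v i) (v j) (v k)) := by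
  unfold IsFuncInto; infer_instance
instance Dn_inj : Dn n (fun V E v => InjFun E (v i)) := by unfold InjFun; infer_instance
instance Dn_injInto : Dn n (fun V E v => InjInto E (v i) (v j)) := by
  unfold InjInto; infer_instance
instance Dn_equi : Dn n (fun V E v => EquinumV E (v i) (v j)) := by
  unfold EquinumV; infer_instance
instance Dn_trans : Dn n (fun V E v => IsTransSet E (v i)) := by unfold IsTransSet; infer_instance
instance Dn_ord : Dn n (fun V E v => IsOrdV E (v i)) := by unfold IsOrdV; infer_instance
instance Dn_lim : Dn n (fun V E v => IsLimitOrdV E (v i)) := by unfold IsLimitOrdV; infer_instance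
instance Dn_omega : Dn n (fun V E v => IsOmegaV E (v i)) := by unfold IsOmegaV; infer_instance
instance Dn_count : Dn n (fun V E v => CountableV E (v i)) := by unfold CountableV; infer_instance
instance Dn_omega1 : Dn n (fun V E v => IsOmega1V E (v i)) := by unfold IsOmega1V; infer_instance
instance Dn_omega2 : Dn n (fun V E v => IsOmega2V E (v i)) := by unfold IsOmega2V; infer_instance
instance Dn_pow : Dn n (fun V E v => IsPowOf E (v i) (v j)) := by unfold IsPowOf; infer_instance
instance Dn_one : Dn n (fun V E v => IsOneV E (v i)) := by unfold IsOneV; infer_instance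
instance Dn_two : Dn n (fun V E v => IsTwoV E (v i)) := by unfold IsTwoV; infer_instance
instance Dn_node : Dn n (fun V E v => IsNodeV E (v i) (v j)) := by unfold IsNodeV; infer_instance
instance Dn_dom : Dn n (fun V E v => HasDomV E (v i) (v j)) := by unfold HasDomV; infer_instance
instance Dn_tree : Dn n (fun V E v => IsTreeV E (v i) (v j)) := by unfold IsTreeV; infer_instance
instance Dn_o1tree : Dn n (fun V E v => IsOmega1TreeV E (v i) (v j)) := by
  unfold IsOmega1TreeV; infer_instance
instance Dn_branch : Dn n (fun V E v => IsBranchV E (v i) (v j)) := by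
  unfold IsBranchV; infer_instance
instance Dn_branchSet : Dn n (fun V E v => IsBranchSetOf E (v i) (v j)) := by
  unfold IsBranchSetOf; infer_instance
instance Dn_level : Dn n (fun V E v => IsLevelSetOf E (v i) (v j) (v k)) := by
  unfold IsLevelSetOf; infer_instance
instance Dn_kurepa : Dn n (fun V E v => IsKurepaV E (v i) (v j)) := by
  unfold IsKurepaV; infer_instance
instance Dn_jk : Dn n (fun V E v => IsJechKunenV E (v i) (v j)) := by
  unfold IsJechKunenV; infer_instance

end DnInst

/-- Countably closed forcing notions. -/
class SCl (P : Type u) [Preorder P] : Prop where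
  sc : SC P

namespace GM
variable {P : Type u} [Preorder P]

/-- `g'` extends `g`. -/
structure Ext (g g' : GM P) : Prop where
  le : g'.q ≤ g.q
  sub : g.M ⊆ g'.M

theorem Ext.refl (g : GM P) : Ext g g := ⟨le_rfl, le_rfl⟩

theorem Ext.trans {g g' g'' : GM P} (h : Ext g g') (h' : Ext g' g'') : Ext g g'' :=
  ⟨h'.le.trans h.le, h.sub.trans h'.sub⟩

theorem M_countable (g : GM P) : g.M.Countable := Set.countable_range _

theorem exi [SCl P] (p : P) {S : Set (Nm P)} (hS : S.Countable) :
    ∃ g : GM P, g.q ≤ p ∧ S ⊆ g.M := exists_gm SCl.sc p S hS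

theorem ext [SCl P] (g : GM P) {p : P} (hp : p ≤ g.q) {S : Set (Nm P)} (hS : S.Countable) :
    ∃ g', Ext g g' ∧ g'.q ≤ p ∧ S ⊆ g'.M := by
  obtain ⟨g', h1, h2⟩ := exi p (g.M_countable.union hS)
  exact ⟨g', ⟨h1.trans hp, Set.subset_union_left.trans h2⟩, h1, Set.subset_union_right.trans h2⟩

theorem tr {n : ℕ} (Φ : ∀ V : Type, (V → V → Prop) → (Fin n → V) → Prop) [h : Dn n Φ] {g g' : GM P}
    (hg : g'.q ≤ g.q) (v : Fin n → Nm P) (hv : ∀ i, v i ∈ g.M) (hv' : ∀ i, v i ∈ g'.M) :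
    Φ g.N g.E (fun i => g.cl (v i)) ↔ Φ g'.N g'.E (fun i => g'.cl (v i)) := by
  obtain ⟨φ, hφ⟩ := h
  rw [← hφ, ← hφ, truth φ v hv, truth φ v hv']
  refine ⟨fun h => Nm.forces_mono _ h hg, fun h => ?_⟩
  rcases g.dec φ v hv with h' | h'
  · exact h'
  · exact (h' _ hg h).elim

theorem tr1 (Φ : ∀ V : Type, (V → V → Prop) → V → Prop) [h : Dn 1 (fun V E v => Φ V E (v 0))]
    {g g' : GM P} (hg : g'.q ≤ g.q) {x : Nm P} (hx : x ∈ g.M) (hx' : x ∈ g'.M) :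
    Φ g.N g.E (g.cl x) ↔ Φ g'.N g'.E (g'.cl x) :=
  tr (n := 1) (fun V E v => Φ V E (v 0)) hg (fun _ => x) (fun _ => hx) (fun _ => hx')

theorem tr2 (Φ : ∀ V : Type, (V → V → Prop) → V → V → Prop)
    [h : Dn 2 (fun V E v => Φ V E (v 0) (v 1))]
    {g g' : GM P} (hg : g'.q ≤ g.q) {x y : Nm P} (hx : x ∈ g.M) (hx' : x ∈ g'.M)
    (hy : y ∈ g.M) (hy' : y ∈ g'.M) :
    Φ g.N g.E (g.cl x) (g.cl y) ↔ Φ g'.N g'.E (g'.cl x) (g'.cl y) :=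
  tr (fun V E v => Φ V E (v 0) (v 1)) hg ![x, y]
    (by intro i; fin_cases i <;> assumption) (by intro i; fin_cases i <;> assumption)

theorem tr3 (Φ : ∀ V : Type, (V → V → Prop) → V → V → V → Prop)
    [h : Dn 3 (fun V E v => Φ V E (v 0) (v 1) (v 2))]
    {g g' : GM P} (hg : g'.q ≤ g.q) {x y z : Nm P} (hx : x ∈ g.M) (hx' : x ∈ g'.M)
    (hy : y ∈ g.M) (hy' : y ∈ g'.M) (hz : z ∈ g.M) (hz' : z ∈ g'.M) :
    Φ g.N g.E (g.cl x) (g.cl y) (g.cl z) ↔ Φ g'.N g'.E (g'.cl x) (g'.cl y) (g'.cl z) :=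
  tr (fun V E v => Φ V E (v 0) (v 1) (v 2)) hg ![x, y, z]
    (by intro i; fin_cases i <;> assumption) (by intro i; fin_cases i <;> assumption)

variable {g g' : GM P}

theorem Ext.tr1 (Φ : ∀ V : Type, (V → V → Prop) → V → Prop)
    [h : Dn 1 (fun V E v => Φ V E (v 0))]
    (hg : Ext g g') {x : Nm P} (hx : x ∈ g.M) :
    Φ g.N g.E (g.cl x) ↔ Φ g'.N g'.E (g'.cl x) :=
  GM.tr1 Φ hg.le hx (hg.sub hx)

theorem Ext.tr2 (Φ : ∀ V : Type, (V → V → Prop) → V → V → Prop)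
    [h : Dn 2 (fun V E v => Φ V E (v 0) (v 1))]
    (hg : Ext g g') {x y : Nm P} (hx : x ∈ g.M) (hy : y ∈ g.M) :
    Φ g.N g.E (g.cl x) (g.cl y) ↔ Φ g'.N g'.E (g'.cl x) (g'.cl y) :=
  GM.tr2 Φ hg.le hx (hg.sub hx) hy (hg.sub hy)

theorem Ext.tr3 (Φ : ∀ V : Type, (V → V → Prop) → V → V → V → Prop)
    [h : Dn 3 (fun V E v => Φ V E (v 0) (v 1) (v 2))]
    (hg : Ext g g') {x y z : Nm P} (hx : x ∈ g.M) (hy : y ∈ g.M) (hz : z ∈ g.M) :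
    Φ g.N g.E (g.cl x) (g.cl y) (g.cl z) ↔ Φ g'.N g'.E (g'.cl x) (g'.cl y) (g'.cl z) :=
  GM.tr3 Φ hg.le hx (hg.sub hx) hy (hg.sub hy) hz (hg.sub hz)

/-! ### Basic facts in the model -/

theorem mem_cl {y : Nm P} (hy : y ∈ g.M) {w : g.N} :
    g.E w (g.cl y) ↔ ∃ j, g.q ∈ y.cond j ∧ y.el j ∈ g.M ∧ w = g.cl (y.el j) := by
  obtain ⟨x, hx, rfl⟩ := cl_surj w
  rw [cl_mem hx hy]
  constructor
  · intro h
    obtain ⟨j, h1, h2, h3⟩ := g.child x y hx hy h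
    exact ⟨j, h1, h3, (cl_eq hx h3).2 h2⟩
  · rintro ⟨j, h1, h3, h2⟩
    exact Nm.memF_congr_left (Nm.eqF_symm ((cl_eq hx h3).1 h2)) (Nm.memF_el j h1)

theorem mem_of {y : Nm P} (hy : y ∈ g.M) (j : y.idx) (h : g.q ∈ y.cond j) (hj : y.el j ∈ g.M) :
    g.E (g.cl (y.el j)) (g.cl y) := (mem_cl hy).2 ⟨j, h, hj, rfl⟩

theorem E_wf : WellFounded g.E := by
  refine ⟨fun a => ?_⟩
  obtain ⟨x, hx, rfl⟩ := cl_surj a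
  induction x with
  | mk ι x c ih =>
    refine ⟨_, fun w hw => ?_⟩
    obtain ⟨j, h1, h2, rfl⟩ := (mem_cl hx).1 hw
    exact ih j h2

theorem E_ext {x y : g.N} (h : ∀ z, g.E z x ↔ g.E z y) : x = y := by
  obtain ⟨a, ha, rfl⟩ := cl_surj x
  obtain ⟨b, hb, rfl⟩ := cl_surj y
  rw [cl_eq ha hb]
  have hs : ∀ {a b : Nm P}, a ∈ g.M → b ∈ g.M → (∀ z, g.E z (g.cl a) → g.E z (g.cl b)) →
      ∀ z, ∀ q ≤ g.q, Nm.memF z a q → Nm.memF z b q := by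
    intro a b ha hb h z
    let φ : memLang.BoundedFormula Empty 2 := ∀' (mem' 2 0 ⟹ mem' 2 1)
    have : Nm.Forces φ ![a, b] g.q := by
      rw [← truth φ ![a, b] (by intro i; fin_cases i <;> assumption)]
      intro w
      exact h w
    exact this z
  exact Nm.eqF_ext fun z q hq => ⟨hs ha hb (fun z => (h z).1) z q hq, hs hb ha (fun z => (h z).2) z q hq⟩

theorem cl_upN {a b : Nm P} (ha : a ∈ g.M) (hb : b ∈ g.M) {w : g.N} :
    g.E w (g.cl (Nm.upN a b)) ↔ w = g.cl a ∨ w = g.cl b := by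
  rw [mem_cl (g.up a b ha hb)]
  constructor
  · rintro ⟨⟨j⟩, h1, h2, rfl⟩
    cases j
    · exact Or.inr rfl
    · exact Or.inl rfl
  · rintro (rfl | rfl)
    · exact ⟨⟨true⟩, trivial, ha, rfl⟩
    · exact ⟨⟨false⟩, trivial, hb, rfl⟩

theorem opN_mem {a b : Nm P} (ha : a ∈ g.M) (hb : b ∈ g.M) : Nm.opN a b ∈ g.M :=
  g.up _ _ (g.up _ _ ha ha) (g.up _ _ ha hb)

theorem of_upN {a b : Nm P} (h : Nm.upN a b ∈ g.M) : a ∈ g.M ∧ b ∈ g.M :=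
  ⟨by have := g.dl _ h; rwa [Nm.decL_upN] at this, by have := g.dr _ h; rwa [Nm.decR_upN] at this⟩

theorem of_opN {a b : Nm P} (h : Nm.opN a b ∈ g.M) : a ∈ g.M ∧ b ∈ g.M :=
  of_upN (of_upN h).2

theorem opair_cl {a b : Nm P} (ha : a ∈ g.M) (hb : b ∈ g.M) :
    IsOPairOf g.E (g.cl (Nm.opN a b)) (g.cl a) (g.cl b) := by
  refine ⟨g.cl (Nm.upN a a), g.cl (Nm.upN a b), ?_, ?_, ?_⟩
  · intro z; rw [cl_upN ha ha, or_self]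
  · intro z; rw [cl_upN ha hb]
  · intro z; exact cl_upN (g.up _ _ ha ha) (g.up _ _ ha hb)

theorem upair_unique {a b u u' : g.N} (h : IsUPairOf g.E u a b) (h' : IsUPairOf g.E u' a b) :
    u = u' := E_ext fun z => by rw [h z, h' z]

theorem sing_unique {a u u' : g.N} (h : IsSingletonOf g.E u a) (h' : IsSingletonOf g.E u' a) :
    u = u' := E_ext fun z => by rw [h z, h' z]

theorem opair_unique {a b u u' : g.N} (h : IsOPairOf g.E u a b) (h' : IsOPairOf g.E u' a b) :
    u = u' := by
  obtain ⟨s, t, h1, h2, h3⟩ := h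
  obtain ⟨s', t', h1', h2', h3'⟩ := h'
  rw [sing_unique h1 h1', upair_unique h2 h2'] at h3
  exact upair_unique h3 h3'

theorem opair_inj {a b a' b' u : g.N} (h : IsOPairOf g.E u a b) (h' : IsOPairOf g.E u a' b') :
    a = a' ∧ b = b' := by
  obtain ⟨s, t, h1, h2, h3⟩ := h
  obtain ⟨s', t', h1', h2', h3'⟩ := h'
  have haa : a = a' := by
    rcases (h3' s).1 ((h3 s).2 (Or.inl rfl)) with rfl | rfl
    · exact (h1' a).1 ((h1 a).2 rfl)
    · have := (h1 a').1 ((h2' a').2 (Or.inl rfl))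
      exact this.symm
  subst haa
  refine ⟨rfl, ?_⟩
  have hs : s = s' := sing_unique h1 h1'
  subst hs
  have hb : b = a ∨ b = b' := by
    rcases (h3' t).1 ((h3 t).2 (Or.inr rfl)) with rfl | rfl
    · exact Or.inl ((h1 b).1 ((h2 b).2 (Or.inr rfl)))
    · exact (h2' b).1 ((h2 b).2 (Or.inr rfl))
  have hb' : b' = a ∨ b' = b := by
    rcases (h3 t').1 ((h3' t').2 (Or.inr rfl)) with rfl | rfl
    · exact Or.inl ((h1 b').1 ((h2' b').2 (Or.inr rfl)))
    · exact (h2 b').1 ((h2' b').2 (Or.inr rfl))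
  rcases hb with rfl | rfl
  · rcases hb' with h | h <;> exact h.symm
  · rfl

theorem exists_opair (a b : g.N) : ∃ u, IsOPairOf g.E u a b := by
  obtain ⟨x, hx, rfl⟩ := cl_surj a
  obtain ⟨y, hy, rfl⟩ := cl_surj b
  exact ⟨_, opair_cl hx hy⟩

end GM

end JK3

section JK4
set_option linter.unusedVariables false
set_option linter.unusedSimpArgs false
set_option linter.unusedSectionVars false

namespace GM
variable {P : Type 1} [Preorder P] {g g' : GM P}

/-- Canonical names of ordinals. -/
noncomputable def oN : Ordinal.{0} → Nm P :=
  WellFoundedLT.fix (motive := fun _ => Nm P) (fun a ih => Nm.mk {b // b < a} (fun b => ih b.1 b.2) (fun _ => ⊤))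

theorem oN_eq (a : Ordinal.{0}) :
    oN a = Nm.mk (P := P) {b // b < a} (fun b => oN b.1) (fun _ => ⊤) := by
  unfold oN
  rw [WellFoundedLT.fix_eq]

theorem mem_oN {a : Ordinal.{0}} (ha : oN a ∈ g.M) {w : g.N} :
    g.E w (g.cl (oN a)) ↔ ∃ b < a, oN b ∈ g.M ∧ w = g.cl (oN b) := by
  have ha' := ha
  rw [oN_eq] at ha'
  conv_lhs => rw [oN_eq]
  rw [mem_cl ha']
  constructor
  · rintro ⟨j, _, h2, h3⟩; exact ⟨j.1, j.2, h2, h3⟩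
  · rintro ⟨b, hb, h2, h3⟩; exact ⟨⟨b, hb⟩, trivial, h2, h3⟩

section ZFC
variable [SCl P]

theorem exists_union (a : g.N) : ∃ u, ∀ z, g.E z u ↔ ∃ w, g.E w a ∧ g.E z w := by
  obtain ⟨a, ha, rfl⟩ := cl_surj a
  let U : Nm P := Nm.mk (Σ i : a.idx, (a.el i).idx) (fun k => (a.el k.1).el k.2)
    (fun k => a.cond k.1 ⊓ (a.el k.1).cond k.2)
  obtain ⟨g', h, -, hS⟩ := ext g le_rfl (Set.countable_singleton U)
  rw [h.tr1 (fun V E a => ∃ u, ∀ z, E z u ↔ ∃ w, E w a ∧ E z w) ha]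
  have hU : U ∈ g'.M := hS rfl
  have ha' := h.sub ha
  refine ⟨g'.cl U, fun z => ⟨fun hz => ?_, ?_⟩⟩
  · obtain ⟨⟨i, j⟩, h1, h2, rfl⟩ := (mem_cl hU).1 hz
    obtain ⟨g2, h', -, hS'⟩ := ext g' le_rfl (Set.countable_singleton (a.el i))
    have hi : a.el i ∈ g2.M := hS' rfl
    rw [h'.tr2 (fun V E z a => ∃ w, E w a ∧ E z w) h2 ha']
    exact ⟨g2.cl (a.el i), mem_of (h'.sub ha') i (LowerSet.lower _ h'.le h1.1) hi,
      mem_of hi j (LowerSet.lower _ h'.le h1.2) (h'.sub h2)⟩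
  · rintro ⟨w, hw, hz⟩
    obtain ⟨i, h1, h2, rfl⟩ := (mem_cl ha').1 hw
    obtain ⟨j, h3, h4, rfl⟩ := (mem_cl h2).1 hz
    exact mem_of hU ⟨i, j⟩ ⟨h1, h3⟩ h4

/-- The name for the subset of `a` determined by `S`. -/
def subN (a : Nm P) (S : Set (a.idx × P)) : Nm P := Nm.mk a.idx a.el
  (fun i => ⟨{p | p ∈ a.cond i ∧ ∃ p', p ≤ p' ∧ (i, p') ∈ S}, fun p r hr hp =>
    ⟨LowerSet.lower _ hr hp.1, hp.2.choose, hr.trans hp.2.choose_spec.1, hp.2.choose_spec.2⟩⟩)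

theorem exists_pow (a : g.N) : ∃ u, IsPowOf g.E u a := by
  obtain ⟨a, ha, rfl⟩ := cl_surj a
  let U : Nm P := Nm.mk (Set (a.idx × P)) (subN a) (fun _ => ⊤)
  obtain ⟨g', h, -, hS⟩ := ext g le_rfl (Set.countable_singleton U)
  rw [h.tr1 (fun V E a => ∃ u, IsPowOf E u a) ha]
  have hU : U ∈ g'.M := hS rfl
  have ha' := h.sub ha
  refine ⟨g'.cl U, fun z => ⟨fun hz => ?_, ?_⟩⟩
  · obtain ⟨S, h1, h2, rfl⟩ := (mem_cl hU).1 hz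
    intro w hw
    obtain ⟨i, h3, h4, rfl⟩ := (mem_cl h2).1 hw
    exact mem_of ha' i h3.1 h4
  · intro hz
    obtain ⟨z, hzM, rfl⟩ := cl_surj z
    let S : Set (a.idx × P) := {k | Nm.memF (a.el k.1) z k.2}
    obtain ⟨g2, h', -, hS'⟩ := ext g' le_rfl (Set.countable_singleton (subN a S))
    rw [h'.tr2 (fun V E x y => SubV E x y) hzM ha'] at hz
    rw [h'.tr2 (fun V E x y => E x y) hzM hU]
    have hs : subN a S ∈ g2.M := hS' rfl
    have : g2.cl z = g2.cl (subN a S) := by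
      refine E_ext fun w => ⟨fun hw => ?_, fun hw => ?_⟩
      · obtain ⟨i, h1, h2, rfl⟩ := (mem_cl (h'.sub ha')).1 (hz w hw)
        rw [cl_mem h2 (h'.sub hzM)] at hw
        exact mem_of hs i ⟨h1, g2.q, le_rfl, hw⟩ h2
      · obtain ⟨i, h1, h2, rfl⟩ := (mem_cl hs).1 hw
        obtain ⟨_, p', hp', h3⟩ := h1
        exact (cl_mem h2 (h'.sub hzM)).2 (Nm.memF_mono h3 hp')
    rw [this]
    exact mem_of (h'.sub hU) S trivial hs

theorem forces_at {n : ℕ} (φ : memLang.BoundedFormula Empty (n + 1)) {v : Fin n → Nm P} {x : Nm P}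
    (hv : ∀ i, v i ∈ g.M) (hx : x ∈ g.M) :
    @BoundedFormula.Realize memLang g.N (strOf g.E) _ _ φ default
      (Fin.snoc (fun i => g.cl (v i)) (g.cl x)) ↔ Nm.Forces φ (Fin.snoc v x) g.q := by
  rw [← truth φ (Fin.snoc v x)]
  · have : (fun i => g.cl ((Fin.snoc v x : Fin (n + 1) → Nm P) i)) =
      Fin.snoc (α := fun _ => g.N) (fun i => g.cl (v i)) (g.cl x) := by
      funext i
      refine Fin.lastCases ?_ (fun i => ?_) i <;> simp
    rw [this]
  · intro i
    refine Fin.lastCases ?_ (fun i => ?_) i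
    · simpa using hx
    · simpa using hv i

/-- Definable families with a parameter vector. -/
abbrev Sat {n : ℕ} (φ : memLang.BoundedFormula Empty n) (V : Type) (E : V → V → Prop)
    (v : Fin n → V) : Prop := @BoundedFormula.Realize memLang V (strOf E) _ _ φ default v

instance Dn_sat {n : ℕ} (φ : memLang.BoundedFormula Empty n) : Dn n (fun V E v => Sat φ V E v) :=
  ⟨φ, fun _ _ _ => Iff.rfl⟩

/-- Renaming of variables. -/
def renF : {k m : ℕ} → (Fin k → Fin m) → memLang.BoundedFormula Empty k → memLang.BoundedFormula Empty m
  | _, _, _, .falsum => .falsum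
  | _, _, f, .equal s t => .equal (s.relabel (Sum.map id f)) (t.relabel (Sum.map id f))
  | _, _, f, .rel R ts => .rel R (fun i => (ts i).relabel (Sum.map id f))
  | _, _, f, .imp φ ψ => .imp (renF f φ) (renF f ψ)
  | _, m, f, .all φ => .all (renF (Fin.snoc (α := fun _ => Fin (m + 1)) (fun i => (f i).castSucc) (Fin.last m)) φ)

theorem realize_renF {V : Type} (E : V → V → Prop) {k : ℕ} (φ : memLang.BoundedFormula Empty k) :
    ∀ {m : ℕ} (f : Fin k → Fin m) (w : Fin m → V),
    @BoundedFormula.Realize memLang V (strOf E) _ _ (renF f φ) default w ↔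
    @BoundedFormula.Realize memLang V (strOf E) _ _ φ default (fun i => w (f i)) := by
  let _ := strOf E
  have ht : ∀ {k m : ℕ} (f : Fin k → Fin m) (w : Fin m → V) (t : memLang.Term (Empty ⊕ Fin k)),
      (t.relabel (Sum.map id f)).realize (Sum.elim default w) =
        t.realize (Sum.elim (default : Empty → V) (fun i => w (f i))) := by
    intro k m f w t
    rw [Term.realize_relabel]
    congr 1
    funext i
    rcases i with i | i
    · exact i.elim
    · rfl
  induction φ with
  | falsum => intro m f w; exact Iff.rfl
  | equal s t => intro m f w; simp only [renF, BoundedFormula.Realize, ht]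
  | rel R ts => intro m f w; simp only [renF, BoundedFormula.Realize, ht]
  | imp φ ψ ih1 ih2 => intro m f w; simp only [renF, BoundedFormula.Realize, ih1, ih2]
  | @all k φ ih =>
    intro m f w
    simp only [renF, BoundedFormula.Realize, ih]
    refine forall_congr' fun x => ?_
    have : (fun i => (Fin.snoc w x : Fin (m + 1) → V) ((Fin.snoc (α := fun _ => Fin (m + 1))
      (fun i => (f i).castSucc) (Fin.last m) : Fin (k + 1) → Fin (m + 1)) i)) =
      (Fin.snoc (fun i => w (f i)) x : Fin (k + 1) → V) := by
      funext i
      refine Fin.lastCases ?_ (fun i => ?_) i <;> simp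
    rw [this]

theorem Dn_ren {k m : ℕ} {Φ : ∀ V : Type, (V → V → Prop) → (Fin k → V) → Prop} [h : Dn k Φ]
    (f : Fin k → Fin m) : Dn m (fun V E w => Φ V E (fun i => w (f i))) := by
  obtain ⟨φ, hφ⟩ := h
  exact ⟨renF f φ, fun V E w => by rw [realize_renF, hφ]⟩

instance Dn_snoc1 {k m : ℕ} (φ : memLang.BoundedFormula Empty (k + 1)) (f : Fin k → Fin m)
    (a : Fin m) : Dn m (fun V E w => Sat φ V E (Fin.snoc (fun i => w (f i)) (w a))) := by
  have := Dn_ren (Φ := fun V E v => Sat φ V E v) (Fin.snoc f a : Fin (k + 1) → Fin m)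
  have e : ∀ (V : Type) (w : Fin m → V), (fun i => w ((Fin.snoc f a : Fin (k + 1) → Fin m) i)) =
      (Fin.snoc (fun i => w (f i)) (w a) : Fin (k + 1) → V) := by
    intro V w
    funext i
    refine Fin.lastCases ?_ (fun i => ?_) i <;> simp
  simpa only [e] using this

instance Dn_snoc2 {k m : ℕ} (φ : memLang.BoundedFormula Empty (k + 2)) (f : Fin k → Fin m)
    (a b : Fin m) : Dn m (fun V E w => Sat φ V E
      (Fin.snoc (Fin.snoc (fun i => w (f i)) (w a) : Fin (k + 1) → V) (w b))) := by
  have := Dn_snoc1 φ (Fin.snoc f a : Fin (k + 1) → Fin m) b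
  have e : ∀ (V : Type) (w : Fin m → V), (fun i => w ((Fin.snoc f a : Fin (k + 1) → Fin m) i)) =
      (Fin.snoc (fun i => w (f i)) (w a) : Fin (k + 1) → V) := by
    intro V w
    funext i
    refine Fin.lastCases ?_ (fun i => ?_) i <;> simp
  simpa only [e] using this

theorem exists_lift {n : ℕ} (v : Fin n → g.N) : ∃ v' : Fin n → Nm P, (∀ i, v' i ∈ g.M) ∧
    v = fun i => g.cl (v' i) := by
  choose f hf hf' using fun i => cl_surj (v i)
  exact ⟨f, hf, funext fun i => (hf' i).symm⟩

def bfa1 {n : ℕ} : memLang.BoundedFormula Empty (n + 3) := mem' ⟨n + 2, by omega⟩ ⟨n + 1, by omega⟩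

theorem sat_mem {n : ℕ} {V : Type} {E : V → V → Prop} {i j : Fin n} {v : Fin n → V} :
    Sat (mem' i j) V E v ↔ E (v i) (v j) := by
  let _ := strOf E
  unfold mem' Sat
  rw [BoundedFormula.realize_rel₂]
  exact Iff.rfl

theorem sat_eq {n : ℕ} {V : Type} {E : V → V → Prop} {i j : Fin n} {v : Fin n → V} :
    Sat (eq' i j) V E v ↔ (v i) = (v j) := by
  let _ := strOf E
  unfold eq' Sat
  rw [BoundedFormula.realize_bdEqual]
  exact Iff.rfl

theorem sat_ext {n : ℕ} (φ : memLang.BoundedFormula Empty n) (h : Ext g g') (v : Fin n → Nm P)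
    (hv : ∀ i, v i ∈ g.M) : Sat φ g.N g.E (fun i => g.cl (v i)) ↔
      Sat φ g'.N g'.E (fun i => g'.cl (v i)) :=
  tr (fun V E v => Sat φ V E v) h.le v hv (fun i => h.sub (hv i))

theorem snoc_cl {n : ℕ} (v : Fin n → Nm P) (x : Nm P) :
    (Fin.snoc (fun i => g.cl (v i)) (g.cl x) : Fin (n + 1) → g.N) =
      fun i => g.cl ((Fin.snoc v x : Fin (n + 1) → Nm P) i) := by
  funext i
  refine Fin.lastCases ?_ (fun i => ?_) i <;> simp

theorem snoc_M {n : ℕ} {v : Fin n → Nm P} {x : Nm P} (hv : ∀ i, v i ∈ g.M) (hx : x ∈ g.M) :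
    ∀ i, (Fin.snoc v x : Fin (n + 1) → Nm P) i ∈ g.M := by
  intro i
  refine Fin.lastCases ?_ (fun i => ?_) i
  · simpa using hx
  · simpa using hv i

theorem exists_sep {n : ℕ} (φ : memLang.BoundedFormula Empty (n + 1)) (v : Fin n → g.N) (a : g.N) :
    ∃ b, ∀ z, g.E z b ↔ (g.E z a ∧ Sat φ g.N g.E (Fin.snoc v z)) := by
  obtain ⟨a, ha, rfl⟩ := cl_surj a
  obtain ⟨v, hv, rfl⟩ := exists_lift v
  let U : Nm P := Nm.mk a.idx a.el (fun i => ⟨{p | p ∈ a.cond i ∧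
    Nm.Forces φ (Fin.snoc v (a.el i)) p}, fun p r hr hp =>
    ⟨LowerSet.lower _ hr hp.1, Nm.forces_mono _ hp.2 hr⟩⟩)
  obtain ⟨g', h, -, hS⟩ := ext g le_rfl (Set.countable_singleton U)
  have hU : U ∈ g'.M := hS rfl
  have ha' := h.sub ha
  have hv' : ∀ i, v i ∈ g'.M := fun i => h.sub (hv i)
  have hmain : ∃ b, ∀ z, g'.E z b ↔ (g'.E z (g'.cl a) ∧
      Sat φ g'.N g'.E (Fin.snoc (fun i => g'.cl (v i)) z)) := by
    refine ⟨g'.cl U, fun z => ⟨fun hz => ?_, ?_⟩⟩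
    · obtain ⟨i, h1, h2, rfl⟩ := (mem_cl hU).1 hz
      exact ⟨mem_of ha' i h1.1 h2, (forces_at φ hv' h2).2 h1.2⟩
    · rintro ⟨h1, h2⟩
      obtain ⟨i, h3, h4, rfl⟩ := (mem_cl ha').1 h1
      exact mem_of hU i ⟨h3, (forces_at φ hv' h4).1 h2⟩ h4
  have h2 := tr (n := n + 1) (fun V E w => ∃ b, ∀ z, E z b ↔ (E z (w (Fin.last n)) ∧
    Sat φ V E (Fin.snoc (fun i : Fin n => w i.castSucc) z))) (h := ?_) h.le (Fin.snoc v a)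
    (snoc_M hv ha) (snoc_M hv' ha')
  · simp only [Fin.snoc_last, Fin.snoc_castSucc] at h2
    exact h2.2 hmain
  · infer_instance

theorem exists_coll {n : ℕ} (φ : memLang.BoundedFormula Empty (n + 2)) (v : Fin n → g.N) (a : g.N) :
    ∃ b, ∀ x, g.E x a → (∃ y, Sat φ g.N g.E (Fin.snoc (Fin.snoc v x) y)) →
      ∃ y, g.E y b ∧ Sat φ g.N g.E (Fin.snoc (Fin.snoc v x) y) := by
  classical
  obtain ⟨a, ha, rfl⟩ := cl_surj a
  obtain ⟨v, hv, rfl⟩ := exists_lift v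
  let W : a.idx × P → Nm P := fun k =>
    if h : ∃ y, Nm.Forces φ (Fin.snoc (Fin.snoc v (a.el k.1)) y) k.2 then h.choose else emp
  have hW : ∀ i p y, Nm.Forces φ (Fin.snoc (Fin.snoc v (a.el i)) y) p →
      Nm.Forces φ (Fin.snoc (Fin.snoc v (a.el i)) (W (i, p))) p := by
    intro i p y h
    have h' : ∃ y, Nm.Forces φ (Fin.snoc (Fin.snoc v (a.el i)) y) p := ⟨y, h⟩
    have : W (i, p) = h'.choose := dif_pos h'
    rw [this]
    exact h'.choose_spec
  let U : Nm P := Nm.mk (a.idx × P) W (fun k => LowerSet.Iic k.2)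
  obtain ⟨g', h, -, hS⟩ := ext g le_rfl (Set.countable_singleton U)
  have hU : U ∈ g'.M := hS rfl
  have ha' := h.sub ha
  have hv' : ∀ i, v i ∈ g'.M := fun i => h.sub (hv i)
  have hmain : ∃ b, ∀ x, g'.E x (g'.cl a) →
      (∃ y, Sat φ g'.N g'.E (Fin.snoc (Fin.snoc (fun i => g'.cl (v i)) x) y)) →
      ∃ y, g'.E y b ∧ Sat φ g'.N g'.E (Fin.snoc (Fin.snoc (fun i => g'.cl (v i)) x) y) := by
    refine ⟨g'.cl U, fun x hx hy => ?_⟩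
    obtain ⟨i, h1, h2, rfl⟩ := (mem_cl ha').1 hx
    obtain ⟨y, hy⟩ := hy
    obtain ⟨y, hyM, rfl⟩ := cl_surj y
    rw [snoc_cl] at hy
    have hy := (forces_at φ (snoc_M hv' h2) hyM).1 hy
    have hw := hW _ _ _ hy
    obtain ⟨g2, h', -, hS'⟩ := ext g' le_rfl (Set.countable_singleton (W (i, g'.q)))
    have hwM : W (i, g'.q) ∈ g2.M := hS' rfl
    have hv2 : ∀ i, v i ∈ g2.M := fun i => h'.sub (hv' i)
    have h3 := tr (n := n + 2) (fun V E w => ∃ y, E y (w (Fin.last n).castSucc) ∧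
      Sat φ V E (Fin.snoc (Fin.snoc (fun i : Fin n => w i.castSucc.castSucc) (w (Fin.last _))) y))
      h'.le (Fin.snoc (Fin.snoc v U) (a.el i)) (snoc_M (snoc_M hv' hU) h2)
      (snoc_M (snoc_M hv2 (h'.sub hU)) (h'.sub h2))
    simp only [Fin.snoc_last, Fin.snoc_castSucc] at h3
    refine h3.2 ⟨g2.cl (W (i, g'.q)), mem_of (h'.sub hU) (i, g'.q) h'.le hwM, ?_⟩
    rw [snoc_cl]
    exact (forces_at φ (snoc_M hv2 (h'.sub h2)) hwM).2 (Nm.forces_mono _ hw h'.le)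
  have h2 := tr (n := n + 1) (fun V E w => ∃ b, ∀ x, E x (w (Fin.last n)) →
    (∃ y, Sat φ V E (Fin.snoc (Fin.snoc (fun i : Fin n => w i.castSucc) x) y)) →
    ∃ y, E y b ∧ Sat φ V E (Fin.snoc (Fin.snoc (fun i : Fin n => w i.castSucc) x) y))
    h.le (Fin.snoc v a) (snoc_M hv ha) (snoc_M hv' ha')
  simp only [Fin.snoc_last, Fin.snoc_castSucc] at h2
  exact h2.2 hmain

theorem exists_choice (a : g.N) (h1 : ∀ y, g.E y a → ∃ z, g.E z y)
    (h2 : ∀ y y', (g.E y a ∧ g.E y' a) ∧ (∃ z, g.E z y ∧ g.E z y') → y = y') :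
    ∃ c, ∀ y, g.E y a → ∃ z, (g.E z y ∧ g.E z c) ∧ ∀ z', g.E z' y ∧ g.E z' c → z' = z := by
  obtain ⟨a, ha, rfl⟩ := cl_surj a
  let K := Σ i : a.idx, (a.el i).idx
  let act : P → K → Prop := fun p k => p ∈ a.cond k.1 ∧ p ∈ (a.el k.1).cond k.2
  have act_mono : ∀ {p q k}, act p k → q ≤ p → act q k := fun h hq =>
    ⟨LowerSet.lower _ hq h.1, LowerSet.lower _ hq h.2⟩
  let U : Nm P := Nm.mk K (fun k => (a.el k.1).el k.2) (fun k => ⟨{p | act p k ∧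
    ∀ k', WellOrderingRel k' k → ∀ q ≤ p, act q k' → ¬ Nm.eqF (a.el k'.1) (a.el k.1) q},
    fun p r hr hp => ⟨act_mono hp.1 hr, fun k' hk q hq => hp.2 k' hk q (hq.trans hr)⟩⟩)
  obtain ⟨g', h, -, hS⟩ := ext g le_rfl (Set.countable_singleton U)
  have hU : U ∈ g'.M := hS rfl
  have ha' := h.sub ha
  rw [h.tr1 (fun V E a => ∃ c, ∀ y, E y a → ∃ z, (E z y ∧ E z c) ∧ ∀ z', E z' y ∧ E z' c → z' = z)
    ha]
  rw [h.tr1 (fun V E a => ∀ y, E y a → ∃ z, E z y) ha] at h1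
  rw [h.tr1 (fun V E a => ∀ y y', (E y a ∧ E y' a) ∧ (∃ z, E z y ∧ E z y') → y = y') ha] at h2
  refine ⟨g'.cl U, fun y hy => ?_⟩
  obtain ⟨i, hi1, hi2, rfl⟩ := (mem_cl ha').1 hy
  have huniq : ∀ z z', (g'.E z (g'.cl (a.el i)) ∧ g'.E z (g'.cl U)) →
      (g'.E z' (g'.cl (a.el i)) ∧ g'.E z' (g'.cl U)) → z = z' := by
    rintro z z' ⟨hz1, hz2⟩ ⟨hz1', hz2'⟩
    obtain ⟨k, hk, hkM, rfl⟩ := (mem_cl hU).1 hz2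
    obtain ⟨k', hk', hkM', rfl⟩ := (mem_cl hU).1 hz2'
    obtain ⟨g2, h', -, hS'⟩ := ext g' le_rfl
      (Set.Countable.insert (a.el k.1) (Set.countable_singleton (a.el k'.1)))
    have hm1 : a.el k.1 ∈ g2.M := hS' (Or.inl rfl)
    have hm2 : a.el k'.1 ∈ g2.M := hS' (Or.inr rfl)
    have hi3 := h'.sub hi2
    rw [h'.tr1 (fun V E a => ∀ y y', (E y a ∧ E y' a) ∧ (∃ z, E z y ∧ E z y') → y = y') ha'] at h2
    rw [h'.tr2 (fun V E a b => E a b) hkM hi2] at hz1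
    rw [h'.tr2 (fun V E a b => E a b) hkM' hi2] at hz1'
    have hyy := mem_of (h'.sub ha') i (LowerSet.lower _ h'.le hi1) hi3
    have e1 := h2 (g2.cl (a.el i)) (g2.cl (a.el k.1)) ⟨⟨hyy,
      mem_of (h'.sub ha') _ (LowerSet.lower _ h'.le hk.1.1) hm1⟩, _, hz1,
      mem_of hm1 k.2 (LowerSet.lower _ h'.le hk.1.2) (h'.sub hkM)⟩
    have e2 := h2 (g2.cl (a.el i)) (g2.cl (a.el k'.1)) ⟨⟨hyy,
      mem_of (h'.sub ha') _ (LowerSet.lower _ h'.le hk'.1.1) hm2⟩, _, hz1',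
      mem_of hm2 k'.2 (LowerSet.lower _ h'.le hk'.1.2) (h'.sub hkM')⟩
    have e3 := (cl_eq hm1 hm2).1 (e1.symm.trans e2)
    have : k = k' := by
      rcases trichotomous_of WellOrderingRel k k' with hlt | heq | hlt
      · exact (hk'.2 k hlt g2.q h'.le (act_mono hk.1 h'.le) e3).elim
      · exact heq
      · exact (hk.2 k' hlt g2.q h'.le (act_mono hk'.1 h'.le) (Nm.eqF_symm e3)).elim
    rw [this]
  have hex : ∃ z, g'.E z (g'.cl (a.el i)) ∧ g'.E z (g'.cl U) := by
    obtain ⟨z, hz⟩ := h1 _ hy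
    obtain ⟨j, hj1, hj2, rfl⟩ := (mem_cl hi2).1 hz
    let A : Set K := {k | ∃ r ≤ g'.q, act r k ∧ Nm.eqF (a.el k.1) (a.el i) r}
    have hA : A.Nonempty := ⟨⟨i, j⟩, g'.q, le_rfl, ⟨hi1, hj1⟩, Nm.eqF_refl _ _⟩
    have wf : WellFounded (WellOrderingRel : K → K → Prop) := IsWellFounded.wf
    obtain ⟨r, hr, hact, heq⟩ := wf.min_mem A hA
    set k := wf.min A hA with hk
    obtain ⟨g2, h', hle, hS'⟩ := ext g' hr (Set.Countable.insert ((a.el k.1).el k.2)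
      (Set.countable_singleton (a.el k.1)))
    have hm1 : (a.el k.1).el k.2 ∈ g2.M := hS' (Or.inl rfl)
    have hm2 : a.el k.1 ∈ g2.M := hS' (Or.inr rfl)
    rw [h'.tr2 (fun V E x y => ∃ z, E z x ∧ E z y) hi2 hU]
    refine ⟨g2.cl ((a.el k.1).el k.2), ?_, ?_⟩
    · rw [← (cl_eq hm2 (h'.sub hi2)).2 (Nm.eqF_mono heq hle)]
      exact mem_of hm2 k.2 (LowerSet.lower _ hle hact.2) hm1
    · refine mem_of (h'.sub hU) k ⟨act_mono hact hle, ?_⟩ hm1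
      intro k' hk' q hq hact' heq'
      refine wf.not_lt_min A (x := k') ?_ hk'
      exact ⟨q, hq.trans h'.le, hact', Nm.eqF_trans heq' (Nm.eqF_mono heq (hq.trans hle))⟩
  obtain ⟨z, hz⟩ := hex
  exact ⟨z, hz, fun z' hz' => huniq _ _ hz' hz⟩

theorem exists_inf : ∃ w : g.N, (∃ e, g.E e w ∧ ∀ z, ¬ g.E z e) ∧
    ∀ x, g.E x w → ∃ y, g.E y w ∧ ∀ z, g.E z y ↔ (g.E z x ∨ z = x) := by
  have hc : (Set.range fun n : ℕ => (oN (n : Ordinal) : Nm P)).Countable := Set.countable_range _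
  obtain ⟨g', h, -, hS⟩ := ext g le_rfl (hc.insert (oN Ordinal.omega0))
  have hn : ∀ n : ℕ, (oN (n : Ordinal) : Nm P) ∈ g'.M := fun n => hS (Or.inr ⟨n, rfl⟩)
  have hw : oN Ordinal.omega0 ∈ g'.M := hS (Or.inl rfl)
  have := tr (n := 0) (fun V E _ => ∃ w : V, (∃ e, E e w ∧ ∀ z, ¬ E z e) ∧
    ∀ x, E x w → ∃ y, E y w ∧ ∀ z, E z y ↔ (E z x ∨ z = x)) h.le ![] (by simp) (by simp)
  refine this.2 ⟨g'.cl (oN Ordinal.omega0), ⟨g'.cl (oN (0 : ℕ)), ?_, ?_⟩, ?_⟩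
  · exact (mem_oN hw).2 ⟨_, Ordinal.natCast_lt_omega0 0, hn 0, rfl⟩
  · intro z hz
    obtain ⟨b, hb, _⟩ := (mem_oN (hn 0)).1 hz
    simp at hb
  · intro x hx
    obtain ⟨b, hb, _, rfl⟩ := (mem_oN hw).1 hx
    obtain ⟨n, rfl⟩ := Ordinal.lt_omega0.1 hb
    refine ⟨g'.cl (oN ((n + 1 : ℕ) : Ordinal)), (mem_oN hw).2 ⟨_, Ordinal.natCast_lt_omega0 _, hn _, rfl⟩, ?_⟩
    intro z
    rw [mem_oN (hn _), mem_oN (hn _)]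
    constructor
    · rintro ⟨b, hb, hbM, rfl⟩
      obtain ⟨m, rfl⟩ := Ordinal.lt_omega0.1 (hb.trans (Ordinal.natCast_lt_omega0 _))
      have hb' : m < n + 1 := by exact_mod_cast hb
      rcases Nat.lt_succ_iff_lt_or_eq.1 hb' with h | rfl
      · exact Or.inl ⟨m, by exact_mod_cast h, hbM, rfl⟩
      · exact Or.inr rfl
    · rintro (⟨b, hb, hbM, rfl⟩ | rfl)
      · exact ⟨b, hb.trans (by exact_mod_cast Nat.lt_succ_self n), hbM, rfl⟩
      · exact ⟨n, by exact_mod_cast Nat.lt_succ_self n, hn n, rfl⟩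

theorem zfc_model (g : GM P) : @Theory.Model memLang g.N (strOf g.E) ZFCTheory := by
  let _ := strOf g.E
  have hm : ∀ {n : ℕ} {i j : Fin n} {v : Empty → g.N} {xs : Fin n → g.N},
      (mem' i j).Realize v xs ↔ g.E (xs i) (xs j) := by
    intro n i j v xs
    unfold mem'; rw [BoundedFormula.realize_rel₂]; exact Iff.rfl
  have he : ∀ {n : ℕ} {i j : Fin n} {v : Empty → g.N} {xs : Fin n → g.N},
      (eq' i j).Realize v xs ↔ (xs i) = (xs j) := by
    intro n i j v xs
    unfold eq'; rw [BoundedFormula.realize_bdEqual]; exact Iff.rfl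
  refine ⟨fun φ hφ => ?_⟩
  rcases hφ with (hφ | hφ) | hφ
  · simp only [Set.mem_insert_iff, Set.mem_singleton_iff] at hφ
    unfold Sentence.Realize Formula.Realize
    rcases hφ with rfl | rfl | rfl | rfl | rfl | rfl | rfl
    · simp only [extAx, BoundedFormula.realize_all, BoundedFormula.realize_imp,
        BoundedFormula.realize_iff, hm, he]
      intro x y h
      exact E_ext h
    · simp only [pairAx, BoundedFormula.realize_all, BoundedFormula.realize_ex,
        BoundedFormula.realize_iff, BoundedFormula.realize_sup, hm, he]
      intro x y
      obtain ⟨x, hx, rfl⟩ := cl_surj x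
      obtain ⟨y, hy, rfl⟩ := cl_surj y
      exact ⟨_, fun z => cl_upN hx hy⟩
    · simp only [unionAx, BoundedFormula.realize_all, BoundedFormula.realize_ex,
        BoundedFormula.realize_iff, BoundedFormula.realize_inf, hm, he]
      intro x
      exact exists_union x
    · simp only [powerAx, BoundedFormula.realize_all, BoundedFormula.realize_ex,
        BoundedFormula.realize_iff, BoundedFormula.realize_imp, hm, he]
      intro x
      exact exists_pow x
    · simp only [infAx, BoundedFormula.realize_all, BoundedFormula.realize_ex,
        BoundedFormula.realize_iff, BoundedFormula.realize_imp, BoundedFormula.realize_inf,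
        BoundedFormula.realize_sup, BoundedFormula.realize_not, hm, he]
      exact exists_inf
    · simp only [foundAx, BoundedFormula.realize_all, BoundedFormula.realize_ex,
        BoundedFormula.realize_imp, BoundedFormula.realize_inf,
        BoundedFormula.realize_not, hm, he]
      intro x hx
      have hx' : {z | g.E z x}.Nonempty := hx
      exact ⟨E_wf.min _ hx', E_wf.min_mem _ hx', fun z hz hz' => E_wf.not_lt_min _ hz' hz⟩
    · simp only [choiceAx, BoundedFormula.realize_all, BoundedFormula.realize_ex,
        BoundedFormula.realize_imp, BoundedFormula.realize_inf,
        BoundedFormula.realize_not, hm, he]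
      intro x hx
      exact exists_choice x hx.1 hx.2
  · simp only [Set.mem_iUnion, Set.mem_range] at hφ
    obtain ⟨n, φ, rfl⟩ := hφ
    unfold Sentence.Realize
    rw [sepAx, BoundedFormula.realize_alls]
    intro v
    simp only [BoundedFormula.realize_all, BoundedFormula.realize_ex,
        BoundedFormula.realize_iff, BoundedFormula.realize_inf, hm]
    intro a
    obtain ⟨b, hb⟩ := exists_sep φ v a
    refine ⟨b, fun z => ?_⟩
    rw [BoundedFormula.realize_liftAt (by omega)]
    have e1 : ∀ (i : Fin (n + 1)), (Fin.snoc (α := fun _ => g.N) (Fin.snoc (α := fun _ => g.N)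
        (Fin.snoc (α := fun _ => g.N) v a) b) z)
        (if (i : ℕ) < n then Fin.castAdd 2 i else Fin.addNat i 2) =
        (Fin.snoc v z : Fin (n + 1) → g.N) i := by
      intro i
      refine Fin.lastCases ?_ (fun i => ?_) i
      · simp
      · have : (i : ℕ) ≤ n + 1 := by omega
        simp [Fin.snoc, this]
        rfl
    have e2 := hb z
    have e3 : ((Fin.snoc (α := fun _ => g.N) (Fin.snoc (α := fun _ => g.N)
        (Fin.snoc (α := fun _ => g.N) v a) b) z) ∘
        fun (i : Fin (n + 1)) => (if (i : ℕ) < n then Fin.castAdd 2 i else Fin.addNat i 2)) =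
        (Fin.snoc v z : Fin (n + 1) → g.N) := funext e1
    rw [e3]
    refine (iff_of_eq (congrArg₂ g.E ?_ ?_)).trans (e2.trans (and_congr_left'
      (iff_of_eq (congrArg₂ g.E ?_ ?_)))) <;> simp [Fin.snoc]
  · simp only [Set.mem_iUnion, Set.mem_range] at hφ
    obtain ⟨n, φ, rfl⟩ := hφ
    unfold Sentence.Realize
    rw [collAx, BoundedFormula.realize_alls]
    intro v
    simp only [BoundedFormula.realize_all, BoundedFormula.realize_ex,
        BoundedFormula.realize_imp, BoundedFormula.realize_inf, hm]
    intro a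
    obtain ⟨b, hb⟩ := exists_coll φ v a
    refine ⟨b, fun x => ?_⟩
    have key : ∀ y, (φ.liftAt 2 n).Realize (default : Empty → g.N) (Fin.snoc (Fin.snoc (Fin.snoc
        (Fin.snoc (α := fun _ => g.N) v a : Fin (n + 1) → g.N) b : Fin (n + 2) → g.N) x :
        Fin (n + 3) → g.N) y : Fin (n + 4) → g.N) ↔
        Sat φ g.N g.E (Fin.snoc (Fin.snoc v x : Fin (n + 1) → g.N) y) := by
      intro y
      rw [BoundedFormula.realize_liftAt (by omega)]
      unfold Sat
      have e1 : ∀ (i : Fin (n + 2)), (Fin.snoc (α := fun _ => g.N) (Fin.snoc (α := fun _ => g.N)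
        (Fin.snoc (α := fun _ => g.N) (Fin.snoc (α := fun _ => g.N) v a) b) x) y)
        (if (i : ℕ) < n then Fin.castAdd 2 i else Fin.addNat i 2) =
        (Fin.snoc (α := fun _ => g.N) (Fin.snoc (α := fun _ => g.N) v x) y : Fin (n + 2) → g.N) i := by
        intro i
        refine Fin.lastCases ?_ (fun i => ?_) i
        · simp
        · refine Fin.lastCases ?_ (fun i => ?_) i
          · simp
            simp [Fin.snoc]
          · have h1 : (i : ℕ) ≤ n + 1 := by omega
            have h2 : (i : ℕ) ≤ n + 1 + 1 := by omega
            simp [Fin.snoc, h1, h2]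
            rfl
      have e3 := funext e1
      exact iff_of_eq (congrArg _ e3)
    have e2 := hb x
    intro hx hy
    simp only [key] at hy ⊢
    obtain ⟨y, hy1, hy2⟩ := e2 ((iff_of_eq (congrArg₂ g.E (by simp [Fin.snoc])
      (by simp [Fin.snoc]))).1 hx) hy
    exact ⟨y, (iff_of_eq (congrArg₂ g.E (by simp [Fin.snoc]) (by simp [Fin.snoc]))).2 hy1, hy2⟩

end ZFC
end GM

end JK4

section JK5
set_option linter.unusedVariables false
set_option linter.unusedSectionVars false
set_option linter.unusedSimpArgs false

namespace GM
variable {P : Type 1} [Preorder P] {g g' : GM P}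

theorem mem_mk {ι : Type 1} {a : ι → Nm P} {c : ι → LowerSet P} (h : Nm.mk ι a c ∈ g.M) {w : g.N} :
    g.E w (g.cl (Nm.mk ι a c)) ↔ ∃ i, g.q ∈ c i ∧ a i ∈ g.M ∧ w = g.cl (a i) := mem_cl h

theorem mk_mem {ι : Type 1} {a : ι → Nm P} {c : ι → LowerSet P} (h : Nm.mk ι a c ∈ g.M)
    (i : ι) (hc : g.q ∈ c i) (ha : a i ∈ g.M) : g.E (g.cl (a i)) (g.cl (Nm.mk ι a c)) :=
  (mem_mk h).2 ⟨i, hc, ha, rfl⟩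

/-- Names for sets of ordered pairs. -/
def fnN (ι : Type 1) (a b : ι → Nm P) (c : ι → LowerSet P) : Nm P :=
  Nm.mk ι (fun i => Nm.opN (a i) (b i)) c

theorem funVal_iff {f x y u : g.N} (hu : IsOPairOf g.E u x y) : FunVal g.E f x y ↔ g.E u f := by
  constructor
  · rintro ⟨p, hp, hp'⟩
    rwa [opair_unique hu hp']
  · intro h; exact ⟨u, h, hu⟩

theorem funVal_fn {ι : Type 1} {a b : ι → Nm P} {c : ι → LowerSet P} (h : fnN ι a b c ∈ g.M)
    {x y : g.N} : FunVal g.E (g.cl (fnN ι a b c)) x y ↔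
      ∃ i, g.q ∈ c i ∧ a i ∈ g.M ∧ b i ∈ g.M ∧ x = g.cl (a i) ∧ y = g.cl (b i) := by
  constructor
  · rintro ⟨p, hp, hp'⟩
    obtain ⟨i, h1, h2, rfl⟩ := (mem_mk h).1 hp
    have h3 := of_opN h2
    obtain ⟨rfl, rfl⟩ := opair_inj hp' (opair_cl h3.1 h3.2)
    exact ⟨i, h1, h3.1, h3.2, rfl, rfl⟩
  · rintro ⟨i, h1, h2, h3, rfl, rfl⟩
    exact ⟨_, mk_mem h i h1 (opN_mem h2 h3), opair_cl h2 h3⟩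

theorem funcOn_fn {ι : Type 1} {a b : ι → Nm P} {c : ι → LowerSet P} (h : fnN ι a b c ∈ g.M)
    {A : g.N}
    (hf : ∀ i j, g.q ∈ c i → g.q ∈ c j → a i ∈ g.M → b i ∈ g.M → a j ∈ g.M → b j ∈ g.M →
      g.cl (a i) = g.cl (a j) → g.cl (b i) = g.cl (b j))
    (hd : ∀ x, (∃ i, g.q ∈ c i ∧ a i ∈ g.M ∧ b i ∈ g.M ∧ x = g.cl (a i)) ↔ g.E x A) :
    IsFuncOn g.E (g.cl (fnN ι a b c)) A := by
  refine ⟨?_, ?_, ?_⟩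
  · intro p hp
    obtain ⟨i, h1, h2, rfl⟩ := (mem_mk h).1 hp
    have h3 := of_opN h2
    exact ⟨_, _, opair_cl h3.1 h3.2⟩
  · intro x y y' hy hy'
    obtain ⟨i, h1, h2, h3, rfl, rfl⟩ := (funVal_fn h).1 hy
    obtain ⟨j, h1', h2', h3', h4, rfl⟩ := (funVal_fn h).1 hy'
    exact hf i j h1 h1' h2 h3 h2' h3' h4
  · intro x
    rw [← hd]
    constructor
    · rintro ⟨y, hy⟩
      obtain ⟨i, h1, h2, h3, rfl, rfl⟩ := (funVal_fn h).1 hy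
      exact ⟨i, h1, h2, h3, rfl⟩
    · rintro ⟨i, h1, h2, h3, rfl⟩
      exact ⟨_, (funVal_fn h).2 ⟨i, h1, h2, h3, rfl, rfl⟩⟩

theorem injFun_fn {ι : Type 1} {a b : ι → Nm P} {c : ι → LowerSet P} (h : fnN ι a b c ∈ g.M)
    (hf : ∀ i j, g.q ∈ c i → g.q ∈ c j → a i ∈ g.M → b i ∈ g.M → a j ∈ g.M → b j ∈ g.M →
      g.cl (b i) = g.cl (b j) → g.cl (a i) = g.cl (a j)) :
    InjFun g.E (g.cl (fnN ι a b c)) := by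
  intro x y z hx hy
  obtain ⟨i, h1, h2, h3, rfl, rfl⟩ := (funVal_fn h).1 hx
  obtain ⟨j, h1', h2', h3', rfl, h4⟩ := (funVal_fn h).1 hy
  exact hf i j h1 h1' h2 h3 h2' h3' h4

theorem E_irrefl (x : g.N) : ¬ g.E x x := fun h => E_wf.asymmetric _ _ h h

theorem E_asymm {x y : g.N} (h : g.E x y) : ¬ g.E y x := fun h' => E_wf.asymmetric _ _ h h'

theorem E_no3 {x y z : g.N} (h1 : g.E x y) (h2 : g.E y z) (h3 : g.E z x) : False := by
  have hne : ({x, y, z} : Set g.N).Nonempty := ⟨x, by simp⟩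
  have hm := E_wf.min_mem _ hne
  simp only [Set.mem_insert_iff, Set.mem_singleton_iff] at hm
  rcases hm with h | h | h
  · exact E_wf.not_lt_min ({x, y, z} : Set g.N) (x := z) (by simp) (h ▸ h3)
  · exact E_wf.not_lt_min ({x, y, z} : Set g.N) (x := x) (by simp) (h ▸ h1)
  · exact E_wf.not_lt_min ({x, y, z} : Set g.N) (x := y) (by simp) (h ▸ h2)

theorem ord_mem {x y : g.N} (hx : IsOrdV g.E x) (hy : g.E y x) : IsOrdV g.E y := by
  refine ⟨?_, ?_⟩
  · intro z hz w hw
    have hz' := hx.1 y hy z hz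
    have hw' := hx.1 z hz' w hw
    rcases hx.2 w y hw' hy with h | rfl | h
    · exact h
    · exact (E_asymm hz hw).elim
    · exact (E_no3 hw hz h).elim
  · intro z w hz hw
    exact hx.2 z w (hx.1 y hy z hz) (hx.1 y hy w hw)

theorem ord_tri {x y : g.N} (hx : IsOrdV g.E x) (hy : IsOrdV g.E y) :
    g.E x y ∨ x = y ∨ g.E y x := by
  induction x using E_wf.induction generalizing y with
  | _ x ihx =>
    induction y using E_wf.induction with
    | _ y ihy =>
      by_cases h1 : g.E y x
      · exact Or.inr (Or.inr h1)
      by_cases h2 : g.E x y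
      · exact Or.inl h2
      refine Or.inr (Or.inl (E_ext fun z => ⟨fun hz => ?_, fun hz => ?_⟩))
      · rcases ihx z hz (ord_mem hx hz) hy with h | rfl | h
        · exact h
        · exact (h1 hz).elim
        · exact (h1 (hx.1 z hz y h)).elim
      · rcases ihy z hz (ord_mem hy hz) with h | rfl | h
        · exact (h2 (hy.1 z hz x h)).elim
        · exact (h2 hz).elim
        · exact h

theorem omega_unique {x y : g.N} (hx : IsOmegaV g.E x) (hy : IsOmegaV g.E y) : x = y := by
  rcases ord_tri hx.1.1 hy.1.1 with h | h | h
  · exact (hy.2 x h hx.1).elim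
  · exact h
  · exact (hx.2 y h hy.1).elim

theorem omega1_unique {x y : g.N} (hx : IsOmega1V g.E x) (hy : IsOmega1V g.E y) : x = y := by
  rcases ord_tri hx.1 hy.1 with h | h | h
  · exact (hx.2.1 (hy.2.2 x h)).elim
  · exact h
  · exact (hy.2.1 (hx.2.2 y h)).elim

theorem omega2_unique {x y k : g.N} (hk : IsOmega1V g.E k) (hx : IsOmega2V g.E x)
    (hy : IsOmega2V g.E y) : x = y := by
  rcases ord_tri hx.1 hy.1 with h | h | h
  · exact ((hx.2 k hk).1 ((hy.2 k hk).2 x h)).elim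
  · exact h
  · exact ((hy.2 k hk).1 ((hx.2 k hk).2 y h)).elim

theorem pow_unique {x p p' : g.N} (h : IsPowOf g.E p x) (h' : IsPowOf g.E p' x) : p = p' :=
  E_ext fun z => by rw [h z, h' z]

/-! ### Ordinals -/

theorem oN_lt {a b : Ordinal.{0}} (ha : oN a ∈ g.M) (hb : oN b ∈ g.M) (h : a < b) :
    g.E (g.cl (oN a)) (g.cl (oN b)) := (mem_oN hb).2 ⟨a, h, ha, rfl⟩

theorem oN_inj {a b : Ordinal.{0}} (ha : oN a ∈ g.M) (hb : oN b ∈ g.M) :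
    g.cl (oN a) = g.cl (oN b) ↔ a = b := by
  refine ⟨fun h => ?_, fun h => h ▸ rfl⟩
  rcases lt_trichotomy a b with h' | h' | h'
  · exact (E_irrefl _ (h ▸ oN_lt ha hb h')).elim
  · exact h'
  · exact (E_irrefl _ (h ▸ oN_lt hb ha h')).elim

theorem oN_mem_iff {a b : Ordinal.{0}} (ha : oN a ∈ g.M) (hb : oN b ∈ g.M) :
    g.E (g.cl (oN a)) (g.cl (oN b)) ↔ a < b := by
  refine ⟨fun h => ?_, oN_lt ha hb⟩
  obtain ⟨c, hc, hcM, h⟩ := (mem_oN hb).1 h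
  rwa [(oN_inj ha hcM).1 h]

theorem oN_ord {a : Ordinal.{0}} (ha : oN a ∈ g.M) : IsOrdV g.E (g.cl (oN a)) := by
  refine ⟨?_, ?_⟩
  · intro y hy z hz
    obtain ⟨b, hb, hbM, rfl⟩ := (mem_oN ha).1 hy
    obtain ⟨c, hc, hcM, rfl⟩ := (mem_oN hbM).1 hz
    exact oN_lt hcM ha (hc.trans hb)
  · intro y z hy hz
    obtain ⟨b, hb, hbM, rfl⟩ := (mem_oN ha).1 hy
    obtain ⟨c, hc, hcM, rfl⟩ := (mem_oN ha).1 hz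
    rw [oN_mem_iff hbM hcM, oN_inj hbM hcM, oN_mem_iff hcM hbM]
    exact lt_trichotomy b c

/-- The countable set of names of ordinals `≤ a`. -/
def oS (a : Ordinal.{0}) : Set (Nm P) := oN '' Set.Iic a

theorem omega0_lt_omega1 : Ordinal.omega0 < Ordinal.omega.{0} 1 := by
  rw [← Ordinal.omega_zero]
  exact Ordinal.omega_lt_omega.2 zero_lt_one

theorem lt_omega1_iff {a : Ordinal.{0}} : a < Ordinal.omega 1 ↔ (Set.Iio a).Countable := by
  rw [← Cardinal.ord_aleph, Cardinal.lt_ord, ← Cardinal.le_aleph0_iff_set_countable,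
    Cardinal.mk_Iio_ordinal, Cardinal.lift_le_aleph0, ← Cardinal.succ_aleph0, Order.lt_succ_iff]

theorem Iic_countable {a : Ordinal.{0}} (h : a < Ordinal.omega 1) : (Set.Iic a).Countable := by
  rw [← Set.Iio_insert]
  exact (lt_omega1_iff.1 h).insert a

theorem oS_countable {a : Ordinal.{0}} (h : a < Ordinal.omega 1) :
    (oS a : Set (Nm P)).Countable := (Iic_countable h).image _

theorem oS_mem {a b : Ordinal.{0}} {S : Set (Nm P)} (h : oS a ⊆ S) (hb : b ≤ a) : oN b ∈ S :=
  h ⟨b, hb, rfl⟩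

variable [SCl P]

theorem oN_omega (h : oN Ordinal.omega0 ∈ g.M) : IsOmegaV g.E (g.cl (oN Ordinal.omega0)) := by
  obtain ⟨g', he, -, hS⟩ := ext g le_rfl (oS_countable (P := P) omega0_lt_omega1)
  rw [he.tr1 (fun V E x => IsOmegaV E x) h]
  have hw := he.sub h
  have hn : ∀ n : ℕ, (oN (n : Ordinal) : Nm P) ∈ g'.M :=
    fun n => oS_mem hS (Ordinal.natCast_lt_omega0 n).le
  refine ⟨⟨oN_ord hw, ⟨g'.cl (oN (0 : ℕ)), oN_lt (hn 0) hw (Ordinal.natCast_lt_omega0 0)⟩, ?_⟩, ?_⟩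
  · intro y hy
    obtain ⟨b, hb, hbM, rfl⟩ := (mem_oN hw).1 hy
    obtain ⟨n, rfl⟩ := Ordinal.lt_omega0.1 hb
    refine ⟨g'.cl (oN (n + 1 : ℕ)), oN_lt (hn _) hw (Ordinal.natCast_lt_omega0 _),
      oN_lt hbM (hn _) ?_⟩
    exact_mod_cast Nat.lt_succ_self n
  · intro x hx hl
    obtain ⟨b, hb, hbM, rfl⟩ := (mem_oN hw).1 hx
    obtain ⟨n, rfl⟩ := Ordinal.lt_omega0.1 hb
    obtain ⟨y, hy⟩ := hl.2.1
    obtain ⟨c, hc, hcM, rfl⟩ := (mem_oN hbM).1 hy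
    obtain ⟨m, rfl⟩ := Ordinal.lt_omega0.1 (hc.trans hb)
    have hmn : m < n := by exact_mod_cast hc
    obtain ⟨k, rfl⟩ : ∃ k, n = k + 1 := ⟨n - 1, by omega⟩
    obtain ⟨z, hz, hz'⟩ := hl.2.2 _ (oN_lt (hn k) hbM (by exact_mod_cast Nat.lt_succ_self k))
    obtain ⟨d, hd, hdM, rfl⟩ := (mem_oN hbM).1 hz
    rw [oN_mem_iff (hn k) hdM] at hz'
    have : (k : Ordinal) + 1 ≤ d := Order.add_one_le_of_lt hz'
    have h2 : d < (k : Ordinal) + 1 := by exact_mod_cast hd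
    exact absurd h2 (not_lt.2 this)

theorem countableV_iff (h : oN Ordinal.omega0 ∈ g.M) {x : g.N} :
    CountableV g.E x ↔ InjInto g.E x (g.cl (oN Ordinal.omega0)) := by
  constructor
  · rintro ⟨w, hw, hx⟩
    rwa [omega_unique hw (oN_omega h)] at hx
  · intro hx; exact ⟨_, oN_omega h, hx⟩

/-- Ground model injections give injections between checked families. -/
theorem injInto_of_fn {ι : Type 1} {a b : ι → Nm P} {c : ι → LowerSet P} (h : fnN ι a b c ∈ g.M)
    {A B : g.N}
    (hf : ∀ i j, g.q ∈ c i → g.q ∈ c j → a i ∈ g.M → b i ∈ g.M → a j ∈ g.M → b j ∈ g.M →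
      (g.cl (a i) = g.cl (a j) ↔ g.cl (b i) = g.cl (b j)))
    (hd : ∀ x, (∃ i, g.q ∈ c i ∧ a i ∈ g.M ∧ b i ∈ g.M ∧ x = g.cl (a i)) ↔ g.E x A)
    (hr : ∀ i, g.q ∈ c i → a i ∈ g.M → b i ∈ g.M → g.E (g.cl (b i)) B) :
    InjInto g.E A B := by
  refine ⟨_, ⟨funcOn_fn h (fun i j h1 h2 h3 h4 h5 h6 => (hf i j h1 h2 h3 h4 h5 h6).1) hd, ?_⟩,
    injFun_fn h (fun i j h1 h2 h3 h4 h5 h6 => (hf i j h1 h2 h3 h4 h5 h6).2)⟩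
  intro x y hxy
  obtain ⟨i, h1, h2, h3, rfl, rfl⟩ := (funVal_fn h).1 hxy
  exact hr i h1 h2 h3

/-- A countable set, all of whose elements have names among countably many, is countable. -/
theorem countable_of_ground {ι : Type 1} [Countable ι] {a : ι → Nm P} {x : Nm P} (hx : x ∈ g.M)
    (c : ι → LowerSet P)
    (h : ∀ g', Ext g g' → (∀ i, a i ∈ g'.M) → ∀ w, g'.E w (g'.cl x) ↔ ∃ i, g'.q ∈ c i ∧ w = g'.cl (a i))
    (hinj : ∀ g', Ext g g' → ∀ i j, a i ∈ g'.M → a j ∈ g'.M → g'.cl (a i) = g'.cl (a j) → i = j) :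
    CountableV g.E (g.cl x) := by
  obtain ⟨e, he⟩ := exists_injective_nat ι
  let f : Nm P := fnN ι a (fun i => oN (e i)) c
  obtain ⟨g', hg, -, hS⟩ := ext g le_rfl (((oS_countable (P := P) omega0_lt_omega1).union
    (Set.countable_range a)).insert f)
  rw [hg.tr1 (fun V E x => CountableV E x) hx]
  have hf : f ∈ g'.M := hS (Or.inl rfl)
  have hn : ∀ n : ℕ, (oN (n : Ordinal) : Nm P) ∈ g'.M :=
    fun n => hS (Or.inr (Or.inl ⟨_, (Ordinal.natCast_lt_omega0 n).le, rfl⟩))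
  have hw : oN Ordinal.omega0 ∈ g'.M := hS (Or.inr (Or.inl ⟨_, Set.mem_Iic.2 le_rfl, rfl⟩))
  have ha : ∀ i, a i ∈ g'.M := fun i => hS (Or.inr (Or.inr ⟨i, rfl⟩))
  refine ⟨_, oN_omega hw, injInto_of_fn hf ?_ ?_ ?_⟩
  · intro i j _ _ h1 h2 h3 h4
    rw [oN_inj h2 h4]
    constructor
    · intro h; rw [hinj g' hg i j h1 h3 h]
    · intro h
      have : e i = e j := by exact_mod_cast h
      rw [he this]
  · intro w
    rw [h g' hg ha]
    constructor
    · rintro ⟨i, h1, _, _, h2⟩; exact ⟨i, h1, h2⟩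
    · rintro ⟨i, h1, h2⟩; exact ⟨i, h1, ha i, hn _, h2⟩
  · intro i _ _ _
    exact oN_lt (hn _) hw (Ordinal.natCast_lt_omega0 _)

theorem oN_countable {a : Ordinal.{0}} (h : oN a ∈ g.M) (ha : a < Ordinal.omega 1) :
    CountableV g.E (g.cl (oN a)) := by
  have : Countable (Set.Iio a) := (lt_omega1_iff.1 ha).to_subtype
  refine countable_of_ground (a := fun b : Set.Iio a => oN b.1) h (fun _ => ⊤) ?_ ?_
  · intro g' hg hM w
    rw [mem_oN (hg.sub h)]
    constructor
    · rintro ⟨b, hb, _, hw⟩; exact ⟨⟨b, hb⟩, trivial, hw⟩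
    · rintro ⟨b, _, hw⟩; exact ⟨b.1, b.2, hM b, hw⟩
  · intro g' hg i j hi hj hij
    exact Subtype.ext ((oN_inj hi hj).1 hij)

theorem countable_bdd {A : Set Ordinal.{0}} (hA : A.Countable) (h : ∀ a ∈ A, a < Ordinal.omega 1) :
    ∃ γ < Ordinal.omega.{0} 1, ∀ b ∈ A, b < γ := by
  by_contra hc
  push Not at hc
  have : (⋃ a ∈ A, Set.Iic a).Countable := hA.biUnion fun a ha => Iic_countable (h a ha)
  have h2 : Set.Iio (Ordinal.omega.{0} 1) ⊆ ⋃ a ∈ A, Set.Iic a := by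
    intro γ hγ
    obtain ⟨b, hb, hb'⟩ := hc γ hγ
    exact Set.mem_biUnion hb hb'
  exact lt_irrefl _ (lt_omega1_iff.2 (this.mono h2))

theorem exists_missing (g : GM P) :
    ∃ γ < Ordinal.omega.{0} 1, ∀ b, oN b ∈ g.M → b < Ordinal.omega 1 → b < γ := by
  let A : Set Ordinal.{0} := {b | oN b ∈ g.M ∧ b < Ordinal.omega 1}
  have hA : A.Countable := by
    refine Set.MapsTo.countable_of_injOn (f := oN (P := P)) (t := g.M) (fun b hb => hb.1) ?_ g.M_countable
    intro a ha b hb hab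
    exact (oN_inj ha.1 hb.1).1 (by rw [hab])
  obtain ⟨γ, h, h'⟩ := countable_bdd hA (fun a ha => ha.2)
  exact ⟨γ, h, fun b h1 h2 => h' b ⟨h1, h2⟩⟩

theorem omega1_not_countable (h : oN (Ordinal.omega 1) ∈ g.M) :
    ¬ CountableV g.E (g.cl (oN (Ordinal.omega 1))) := by
  obtain ⟨g', he, -, hS⟩ := ext g le_rfl (oS_countable (P := P) omega0_lt_omega1)
  rw [he.tr1 (fun V E x => CountableV E x) h]
  have hw : oN Ordinal.omega0 ∈ g'.M := oS_mem hS le_rfl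
  have hk := he.sub h
  have hn : ∀ n : ℕ, (oN (n : Ordinal) : Nm P) ∈ g'.M :=
    fun n => oS_mem hS (Ordinal.natCast_lt_omega0 n).le
  rw [countableV_iff hw]
  rintro ⟨f, ⟨hf, hr⟩, hi⟩
  obtain ⟨f, hfM, rfl⟩ := cl_surj f
  obtain ⟨γ, hγ, hγ'⟩ := exists_missing g'
  obtain ⟨g2, he2, -, hS2⟩ := ext g' le_rfl (Set.countable_singleton (oN γ))
  have hγM : oN γ ∈ g2.M := hS2 rfl
  have A1 : InjFun g2.E (g2.cl f) := (he2.tr1 (fun V E x => InjFun E x) hfM).1 hi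
  have A2 : IsFuncInto g2.E (g2.cl f) (g2.cl (oN (Ordinal.omega 1))) (g2.cl (oN Ordinal.omega0)) :=
    (he2.tr3 (fun V E x y z => IsFuncInto E x y z) hfM hk hw).1 ⟨hf, hr⟩
  obtain ⟨y, hy⟩ := (A2.1.2.2 (g2.cl (oN γ))).2 (oN_lt hγM (he2.sub hk) hγ)
  obtain ⟨b, hb, hbM, rfl⟩ := (mem_oN (he2.sub hw)).1 (A2.2 _ _ hy)
  obtain ⟨n, rfl⟩ := Ordinal.lt_omega0.1 hb
  have B : ∃ x, FunVal g'.E (g'.cl f) x (g'.cl (oN n)) :=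
    (he2.tr2 (fun V E x y => ∃ z, FunVal E x z y) hfM (hn n)).2 ⟨_, hy⟩
  obtain ⟨x, hx⟩ := B
  have hx1 := (hf.2.2 x).1 ⟨_, hx⟩
  obtain ⟨c, hc, hcM, rfl⟩ := (mem_oN hk).1 hx1
  have hx2 : FunVal g2.E (g2.cl f) (g2.cl (oN c)) (g2.cl (oN n)) :=
    (he2.tr3 (fun V E x y z => FunVal E x y z) hfM hcM (hn n)).1 hx
  have := (oN_inj hγM (he2.sub hcM)).1 (A1 _ _ _ hy hx2)
  exact absurd (hγ' c hcM hc) (by rw [this]; exact lt_irrefl _)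

theorem oN_omega1 (h : oN (Ordinal.omega 1) ∈ g.M) : IsOmega1V g.E (g.cl (oN (Ordinal.omega 1))) := by
  refine ⟨oN_ord h, omega1_not_countable h, ?_⟩
  intro a ha
  obtain ⟨b, hb, hbM, rfl⟩ := (mem_oN h).1 ha
  exact oN_countable hbM hb

end GM

end JK5

section JK6
set_option linter.unusedVariables false
set_option linter.unusedSectionVars false
set_option linter.unusedSimpArgs false

/-- Ground model nodes of `2^{<ω₁}`. -/
@[ext] structure Nd where
  len : Ordinal.{0}
  S : Set Ordinal.{0}
  lt : len < Ordinal.omega 1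
  sub : S ⊆ Set.Iio len

namespace Nd

instance : PartialOrder Nd where
  le x y := x.len ≤ y.len ∧ ∀ b < x.len, b ∈ x.S ↔ b ∈ y.S
  le_refl x := ⟨le_rfl, fun _ _ => Iff.rfl⟩
  le_trans x y z h h' := ⟨h.1.trans h'.1, fun b hb => (h.2 b hb).trans (h'.2 b (hb.trans_le h.1))⟩
  le_antisymm x y h h' := by
    have hl := le_antisymm h.1 h'.1
    refine Nd.ext hl (Set.ext fun b => ⟨fun hb => ?_, fun hb => ?_⟩)
    · exact (h.2 b (x.sub hb)).1 hb
    · exact (h'.2 b (y.sub hb)).1 hb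

theorem le_def {x y : Nd} : x ≤ y ↔ x.len ≤ y.len ∧ ∀ b < x.len, b ∈ x.S ↔ b ∈ y.S := Iff.rfl

theorem eq_of_le {x y : Nd} (h : x ≤ y) (hl : x.len = y.len) : x = y :=
  le_antisymm h ⟨hl.ge, fun b hb => (h.2 b (hl ▸ hb)).symm⟩

/-- Restriction of a node. -/
noncomputable def res (x : Nd) (a : Ordinal.{0}) : Nd where
  len := min x.len a
  S := {b | b ∈ x.S ∧ b < a}
  lt := (min_le_left _ _).trans_lt x.lt
  sub := fun b hb => lt_min (x.sub hb.1) hb.2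

theorem res_le (x : Nd) (a : Ordinal.{0}) : x.res a ≤ x :=
  ⟨min_le_left _ _, fun b hb => ⟨fun h => h.1, fun h => ⟨h, hb.trans_le (min_le_right _ _)⟩⟩⟩

theorem res_len (x : Nd) {a : Ordinal.{0}} (h : a ≤ x.len) : (x.res a).len = a := min_eq_right h

theorem le_res {x y : Nd} (h : x ≤ y) : x = y.res x.len := by
  refine Nd.ext (min_eq_right h.1).symm (Set.ext fun b => ⟨fun hb => ?_, fun hb => ?_⟩)
  · exact ⟨(h.2 b (x.sub hb)).1 hb, x.sub hb⟩
  · exact (h.2 b hb.2).2 hb.1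

theorem comp_of_le {x y z : Nd} (hx : x ≤ z) (hy : y ≤ z) (hl : x.len ≤ y.len) : x ≤ y :=
  ⟨hl, fun b hb => (hx.2 b hb).trans (hy.2 b (hb.trans_le hl)).symm⟩

instance : Small.{0} Nd := by
  let f : Nd → Set.Iio (Ordinal.omega.{0} 1) × Set (Set.Iio (Ordinal.omega.{0} 1)) :=
    fun x => (⟨x.len, x.lt⟩, {b | b.1 ∈ x.S})
  refine small_of_injective (f := f) ?_
  intro x y h
  have h1 : x.len = y.len := congrArg (fun z => z.1.1) h
  refine Nd.ext h1 (Set.ext fun b => ?_)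
  have h2 := congrArg (fun z => z.2) h
  constructor
  · intro hb
    have : (⟨b, (x.sub hb).trans x.lt⟩ : Set.Iio (Ordinal.omega.{0} 1)) ∈ (f x).2 := hb
    rw [h] at this
    exact this
  · intro hb
    have : (⟨b, (y.sub hb).trans y.lt⟩ : Set.Iio (Ordinal.omega.{0} 1)) ∈ (f y).2 := hb
    rw [← h] at this
    exact this

end Nd

namespace GM
variable {P : Type 1} [Preorder P] {g g' : GM P}

open Classical in
/-- Name of a truth value. -/
noncomputable def bN (p : Prop) : Nm P := if p then oN 1 else oN 0

theorem bN_t {p : Prop} (h : p) : (bN p : Nm P) = oN 1 := if_pos h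
theorem bN_f {p : Prop} (h : ¬ p) : (bN p : Nm P) = oN 0 := if_neg h

theorem bN_mem {p : Prop} (h0 : oN 0 ∈ g.M) (h1 : oN 1 ∈ g.M) : bN p ∈ g.M := by
  unfold bN; split_ifs <;> assumption

theorem bN_inj {p q : Prop} (hp : bN p ∈ g.M) (hq : bN q ∈ g.M) :
    g.cl (bN p) = g.cl (bN q) ↔ (p ↔ q) := by
  by_cases h : p <;> by_cases h' : q <;> simp only [h, h', bN_t, bN_f, not_false_eq_true, not_true_eq_false, not_true] at * <;> simp [oN_inj hp hq]

theorem oN_empty : IsEmptyV g.E (g.cl (oN 0)) ∨ oN 0 ∉ g.M := by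
  by_cases h : oN 0 ∈ g.M
  · left; intro z hz
    obtain ⟨b, hb, _⟩ := (mem_oN h).1 hz
    exact absurd hb (not_lt.2 zero_le)
  · exact Or.inr h

theorem empty_iff (h : oN 0 ∈ g.M) {z : g.N} : IsEmptyV g.E z ↔ z = g.cl (oN 0) := by
  have h0 := oN_empty.resolve_right (not_not.2 h)
  constructor
  · intro hz
    exact E_ext fun w => ⟨fun h => (hz w h).elim, fun h => (h0 w h).elim⟩
  · rintro rfl; exact h0

theorem one_iff (h : oN 0 ∈ g.M) (h1 : oN 1 ∈ g.M) {z : g.N} : IsOneV g.E z ↔ z = g.cl (oN 1) := by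
  have : IsOneV g.E (g.cl (oN 1)) := by
    intro w
    rw [mem_oN h1, empty_iff h]
    constructor
    · rintro ⟨b, hb, _, rfl⟩
      rw [Order.lt_one_iff.1 hb]
    · rintro rfl; exact ⟨0, zero_lt_one, h, rfl⟩
  constructor
  · intro hz
    exact E_ext fun w => by rw [hz w, this w]
  · rintro rfl; exact this

theorem two_iff (h : oN 0 ∈ g.M) (h1 : oN 1 ∈ g.M) {t : g.N} :
    IsTwoV g.E t ↔ ∀ z, g.E z t ↔ (z = g.cl (oN 0) ∨ z = g.cl (oN 1)) := by
  unfold IsTwoV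
  simp only [empty_iff h, one_iff h h1]

theorem oN_two (h : oN 0 ∈ g.M) (h1 : oN 1 ∈ g.M) (h2 : oN 2 ∈ g.M) : IsTwoV g.E (g.cl (oN 2)) := by
  rw [two_iff h h1]
  intro z
  rw [mem_oN h2]
  constructor
  · rintro ⟨b, hb, _, rfl⟩
    have hb2 : b < Ordinal.omega0 := hb.trans (Ordinal.natCast_lt_omega0 2)
    obtain ⟨n, rfl⟩ := Ordinal.lt_omega0.1 hb2
    have : n < 2 := by exact_mod_cast hb
    interval_cases n
    · left; simp
    · right; simp
  · rintro (rfl | rfl)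
    · exact ⟨0, by exact_mod_cast (show (0 : ℕ) < 2 by norm_num), h, rfl⟩
    · exact ⟨1, by exact_mod_cast (show (1 : ℕ) < 2 by norm_num), h1, rfl⟩

/-- The name of a ground model node. -/
noncomputable def ndN (x : Nd) : Nm P :=
  fnN {b : Ordinal.{0} // b < x.len} (fun b => oN b.1) (fun b => bN (b.1 ∈ x.S)) (fun _ => ⊤)

/-- The name of the ground model `2^{<ω₁}`. -/
noncomputable def NDS : Nm P := Nm.mk Nd ndN (fun _ => ⊤)

theorem nd_val {x : Nd} (h : ndN x ∈ g.M) {u v : g.N} : FunVal g.E (g.cl (ndN x)) u v ↔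
    ∃ b < x.len, oN b ∈ g.M ∧ bN (b ∈ x.S) ∈ g.M ∧ u = g.cl (oN b) ∧ v = g.cl (bN (b ∈ x.S)) := by
  rw [ndN, funVal_fn h]
  constructor
  · rintro ⟨b, _, h1, h2, h3, h4⟩; exact ⟨b.1, b.2, h1, h2, h3, h4⟩
  · rintro ⟨b, hb, h1, h2, h3, h4⟩; exact ⟨⟨b, hb⟩, trivial, h1, h2, h3, h4⟩

theorem dom_unique {z a a' : g.N} (h : HasDomV g.E z a) (h' : HasDomV g.E z a') : a = a' :=
  E_ext fun u => by rw [← h u, ← h' u]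

theorem omega1_pos_lt {n : ℕ} : (n : Ordinal.{0}) < Ordinal.omega 1 :=
  (Ordinal.natCast_lt_omega0 n).trans omega0_lt_omega1

/-- Countably many names sufficient to compute with nodes of length `≤ a`. -/
def bS (a : Ordinal.{0}) : Set (Nm P) := oS (max a 2)

theorem bS_countable {a : Ordinal.{0}} (h : a < Ordinal.omega 1) : (bS a : Set (Nm P)).Countable :=
  oS_countable (max_lt h (by exact_mod_cast omega1_pos_lt (n := 2)))

theorem bS_mem {a b : Ordinal.{0}} {S : Set (Nm P)} (h : bS a ⊆ S) (hb : b ≤ a) : oN b ∈ S :=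
  oS_mem h (hb.trans (le_max_left _ _))
theorem bS_0 {a : Ordinal.{0}} {S : Set (Nm P)} (h : bS a ⊆ S) : oN 0 ∈ S :=
  oS_mem h zero_le
theorem bS_1 {a : Ordinal.{0}} {S : Set (Nm P)} (h : bS a ⊆ S) : oN 1 ∈ S :=
  oS_mem h ((by exact_mod_cast (show (1 : ℕ) ≤ 2 by norm_num) : (1 : Ordinal.{0}) ≤ 2).trans (le_max_right _ _))
theorem bS_2 {a : Ordinal.{0}} {S : Set (Nm P)} (h : bS a ⊆ S) : oN 2 ∈ S :=
  oS_mem h (le_max_right _ _)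

variable [SCl P]

theorem nd_func {x : Nd} (h : ndN x ∈ g.M) (hl : oN x.len ∈ g.M) :
    IsFuncOn g.E (g.cl (ndN x)) (g.cl (oN x.len)) := by
  obtain ⟨g', he, -, hS⟩ := ext g le_rfl (bS_countable (P := P) x.lt)
  rw [he.tr2 (fun V E x y => IsFuncOn E x y) h hl]
  refine funcOn_fn (he.sub h) ?_ ?_
  · intro i j _ _ h1 h2 h3 h4 h5
    rw [(oN_inj h1 h3).1 h5]
  · intro u
    rw [mem_oN (he.sub hl)]
    constructor
    · rintro ⟨b, _, h1, h2, h3⟩; exact ⟨b.1, b.2, h1, h3⟩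
    · rintro ⟨b, hb, h1, h3⟩
      exact ⟨⟨b, hb⟩, trivial, h1, bN_mem (bS_0 hS) (bS_1 hS), h3⟩

theorem nd_dom {x : Nd} (h : ndN x ∈ g.M) (hl : oN x.len ∈ g.M) :
    HasDomV g.E (g.cl (ndN x)) (g.cl (oN x.len)) := (nd_func h hl).2.2

theorem nd_dom_iff {x : Nd} {a : Ordinal.{0}} (h : ndN x ∈ g.M) (ha : oN a ∈ g.M) :
    HasDomV g.E (g.cl (ndN x)) (g.cl (oN a)) ↔ x.len = a := by
  obtain ⟨g', he, -, hS⟩ := ext g le_rfl (bS_countable (P := P) x.lt)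
  rw [he.tr2 (fun V E x y => HasDomV E x y) h ha]
  have h2 := nd_dom (he.sub h) (bS_mem hS le_rfl)
  constructor
  · intro h'
    exact (oN_inj (bS_mem hS le_rfl) (he.sub ha)).1 (dom_unique h2 h')
  · rintro rfl; exact h2

theorem nd_len_mem {x : Nd} (h : ndN x ∈ g.M) (hk : oN (Ordinal.omega 1) ∈ g.M) : oN x.len ∈ g.M := by
  obtain ⟨g', he, -, hS⟩ := ext g le_rfl (bS_countable (P := P) x.lt)
  have h2 := nd_dom (he.sub h) (bS_mem hS le_rfl)
  have h3 : ∃ a, g'.E a (g'.cl (oN (Ordinal.omega 1))) ∧ HasDomV g'.E (g'.cl (ndN x)) a :=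
    ⟨_, oN_lt (bS_mem hS le_rfl) (he.sub hk) x.lt, h2⟩
  rw [← he.tr2 (fun V E x y => ∃ a, E a x ∧ HasDomV E y a) hk h] at h3
  obtain ⟨a, ha, ha'⟩ := h3
  obtain ⟨b, hb, hbM, rfl⟩ := (mem_oN hk).1 ha
  rwa [(nd_dom_iff h hbM).1 ha']

theorem nd_node {x : Nd} (h : ndN x ∈ g.M) (hk : oN (Ordinal.omega 1) ∈ g.M) :
    IsNodeV g.E (g.cl (oN (Ordinal.omega 1))) (g.cl (ndN x)) := by
  obtain ⟨g', he, -, hS⟩ := ext g le_rfl (bS_countable (P := P) x.lt)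
  rw [he.tr2 (fun V E x y => IsNodeV E x y) hk h]
  have hl : oN x.len ∈ g'.M := bS_mem hS le_rfl
  refine ⟨_, _, oN_lt hl (he.sub hk) x.lt, oN_ord hl, oN_two (bS_0 hS) (bS_1 hS) (bS_2 hS),
    nd_func (he.sub h) hl, ?_⟩
  intro u v huv
  obtain ⟨b, hb, h1, h2, rfl, rfl⟩ := (nd_val (he.sub h)).1 huv
  rw [(two_iff (bS_0 hS) (bS_1 hS)).1 (oN_two (bS_0 hS) (bS_1 hS) (bS_2 hS))]
  by_cases hb : b ∈ x.S
  · right; rw [bN_t hb]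
  · left; rw [bN_f hb]

theorem nd_sub {x y : Nd} (hx : ndN x ∈ g.M) (hy : ndN y ∈ g.M) :
    SubV g.E (g.cl (ndN x)) (g.cl (ndN y)) ↔ x ≤ y := by
  obtain ⟨g', he, -, hS⟩ := ext g le_rfl (bS_countable (P := P) x.lt)
  rw [he.tr2 (fun V E x y => SubV E x y) hx hy]
  have hx' := he.sub hx
  have hy' := he.sub hy
  constructor
  · intro h
    have key : ∀ b < x.len, b < y.len ∧ (b ∈ x.S ↔ b ∈ y.S) := by
      intro b hb
      have hbM : oN b ∈ g'.M := bS_mem hS hb.le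
      obtain ⟨u, hu, hu'⟩ := (nd_val hx').2 ⟨b, hb, hbM, bN_mem (bS_0 hS) (bS_1 hS), rfl, rfl⟩
      have h2 := (nd_val hy').1 ⟨u, h u hu, hu'⟩
      obtain ⟨c, hc, hcM, hc2, h3, h4⟩ := h2
      obtain rfl := (oN_inj hbM hcM).1 h3
      exact ⟨hc, (bN_inj (bN_mem (bS_0 hS) (bS_1 hS)) hc2).1 h4⟩
    exact ⟨le_of_forall_lt fun b hb => (key b hb).1, fun b hb => (key b hb).2⟩
  · intro h w hw
    obtain ⟨u, v, huv⟩ := (nd_func hx' (bS_mem hS le_rfl)).1 w hw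
    obtain ⟨b, hb, hbM, hbM', rfl, rfl⟩ := (nd_val hx').1 ⟨w, hw, huv⟩
    have : FunVal g'.E (g'.cl (ndN y)) (g'.cl (oN b)) (g'.cl (bN (b ∈ x.S))) :=
      (nd_val hy').2 ⟨b, hb.trans_le h.1, hbM, bN_mem (bS_0 hS) (bS_1 hS), rfl, by
        rw [propext (h.2 b hb)]⟩
    rwa [funVal_iff huv] at this

theorem nd_inj {x y : Nd} (hx : ndN x ∈ g.M) (hy : ndN y ∈ g.M) :
    g.cl (ndN x) = g.cl (ndN y) ↔ x = y := by
  refine ⟨fun h => ?_, fun h => h ▸ rfl⟩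
  refine le_antisymm ((nd_sub hx hy).1 ?_) ((nd_sub hy hx).1 ?_) <;> rw [h] <;> intro z hz <;> exact hz

theorem nd_decide (hk : oN (Ordinal.omega 1) ∈ g.M) (hD : NDS ∈ g.M) {z : g.N}
    (hz : IsNodeV g.E (g.cl (oN (Ordinal.omega 1))) z) : ∃ x, ndN x ∈ g.M ∧ z = g.cl (ndN x) := by
  obtain ⟨z, hzM, rfl⟩ := cl_surj z
  suffices h : g.E (g.cl z) (g.cl NDS) by
    obtain ⟨x, -, h1, h2⟩ := (mem_mk hD).1 h
    exact ⟨x, h1, h2⟩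
  obtain ⟨a, t, ha, hao, ht, hf⟩ := id hz
  obtain ⟨b, hb, hbM, rfl⟩ := (mem_oN hk).1 ha
  obtain ⟨g', he, -, hS⟩ := ext g le_rfl (bS_countable (P := P) hb)
  rw [he.tr2 (fun V E x y => E x y) hzM hD]
  have hf' : ∃ t, IsTwoV g'.E t ∧ IsFuncInto g'.E (g'.cl z) (g'.cl (oN b)) t :=
    (he.tr2 (fun V E x y => ∃ t, IsTwoV E t ∧ IsFuncInto E x y t) hzM hbM).1 ⟨t, ht, hf⟩
  clear hf ht
  obtain ⟨t', ht', hf'⟩ := hf'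
  let S : Set Ordinal.{0} := {c | c < b ∧ FunVal g'.E (g'.cl z) (g'.cl (oN c)) (g'.cl (oN 1))}
  let x : Nd := ⟨b, S, hb, fun c hc => hc.1⟩
  obtain ⟨g2, he2, -, hS2⟩ := ext g' le_rfl (Set.countable_singleton (ndN x))
  have hx : ndN x ∈ g2.M := hS2 rfl
  rw [he2.tr2 (fun V E x y => E x y) (he.sub hzM) (he.sub hD)]
  have hM2 : ∀ {c}, c ≤ b → oN c ∈ g2.M := fun hc => he2.sub (bS_mem hS hc)
  have hbn : ∀ {p : Prop}, bN p ∈ g2.M := he2.sub (bN_mem (bS_0 hS) (bS_1 hS))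
  have hfo : IsFuncOn g2.E (g2.cl z) (g2.cl (oN b)) :=
    (he2.tr2 (fun V E x y => IsFuncOn E x y) (he.sub hzM) (he.sub hbM)).1 hf'.1
  have key : ∀ c < b, FunVal g2.E (g2.cl z) (g2.cl (oN c)) (g2.cl (bN (c ∈ S))) := by
    intro c hc
    have hcM : oN c ∈ g'.M := bS_mem hS hc.le
    have : FunVal g'.E (g'.cl z) (g'.cl (oN c)) (g'.cl (bN (c ∈ S))) := by
      by_cases h : c ∈ S
      · rw [bN_t h]; exact h.2
      · rw [bN_f h]
        obtain ⟨v, hv⟩ := (hf'.1.2.2 (g'.cl (oN c))).2 (oN_lt hcM (he.sub hbM) hc)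
        rcases ((two_iff (bS_0 hS) (bS_1 hS)).1 ht' v).1 (hf'.2 _ _ hv) with rfl | rfl
        · exact hv
        · exact (h ⟨hc, hv⟩).elim
    exact (he2.tr3 (fun V E x y z => FunVal E x y z) (he.sub hzM) hcM (bN_mem (bS_0 hS) (bS_1 hS))).1 this
  have : g2.cl z = g2.cl (ndN x) := by
    refine E_ext fun w => ⟨fun hw => ?_, fun hw => ?_⟩
    · obtain ⟨u, v, huv⟩ := hfo.1 w hw
      have h1 := (hfo.2.2 u).1 ⟨v, w, hw, huv⟩
      obtain ⟨c, hc, hcM, rfl⟩ := (mem_oN (hM2 le_rfl)).1 h1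
      obtain rfl := hfo.2.1 _ _ _ ⟨w, hw, huv⟩ (key c hc)
      exact (funVal_iff huv).1 ((nd_val hx).2 ⟨c, hc, hcM, hbn, rfl, rfl⟩)
    · obtain ⟨u, v, huv⟩ := (nd_func hx (hM2 le_rfl)).1 w hw
      obtain ⟨c, hc, hcM, hcM', rfl, rfl⟩ := (nd_val hx).1 ⟨w, hw, huv⟩
      exact (funVal_iff huv).1 (key c hc)
  rw [this]
  exact mk_mem (he2.sub (he.sub hD)) x trivial hx

/-! ### Subsets of `ω` -/

noncomputable def sN (A : Set (Set.Iio Ordinal.omega0.{0})) : Nm P :=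
  Nm.mk A (fun b => oN b.1.1) (fun _ => ⊤)

noncomputable def PWN : Nm P := Nm.mk (Set (Set.Iio Ordinal.omega0.{0})) sN (fun _ => ⊤)

theorem sN_mem {A : Set (Set.Iio Ordinal.omega0.{0})} (h : sN A ∈ g.M) {b : Set.Iio Ordinal.omega0.{0}}
    (hb : oN b.1 ∈ g.M) : g.E (g.cl (oN b.1)) (g.cl (sN A)) ↔ b ∈ A := by
  rw [sN, mem_mk h]
  constructor
  · rintro ⟨c, _, h1, h2⟩
    have := (oN_inj hb h1).1 h2
    rw [Subtype.ext this]; exact c.2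
  · intro h; exact ⟨⟨b, h⟩, trivial, hb, rfl⟩

theorem sN_inj {A B : Set (Set.Iio Ordinal.omega0.{0})} (hA : sN A ∈ g.M) (hB : sN B ∈ g.M) :
    g.cl (sN A) = g.cl (sN B) ↔ A = B := by
  refine ⟨fun h => ?_, fun h => h ▸ rfl⟩
  obtain ⟨g', he, -, hS⟩ := ext g le_rfl (oS_countable (P := P) omega0_lt_omega1)
  rw [he.tr2 (fun V E x y => x = y) hA hB] at h
  ext b
  have hb : oN b.1 ∈ g'.M := oS_mem hS b.2.le
  rw [← sN_mem (he.sub hA) hb, h, sN_mem (he.sub hB) hb]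

theorem sN_decide (hw : oN Ordinal.omega0 ∈ g.M) (hD : PWN ∈ g.M) {z : g.N} :
    SubV g.E z (g.cl (oN Ordinal.omega0)) ↔ g.E z (g.cl PWN) := by
  constructor
  swap
  · intro h
    obtain ⟨A, -, h1, rfl⟩ := (mem_mk hD).1 h
    intro u hu
    obtain ⟨b, _, hb, rfl⟩ := (mem_mk h1).1 hu
    exact oN_lt hb hw b.1.2
  intro hz
  obtain ⟨z, hzM, rfl⟩ := cl_surj z
  obtain ⟨g', he, -, hS⟩ := ext g le_rfl (oS_countable (P := P) omega0_lt_omega1)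
  let A : Set (Set.Iio Ordinal.omega0.{0}) := {b | g'.E (g'.cl (oN b.1)) (g'.cl z)}
  obtain ⟨g2, he2, -, hS2⟩ := ext g' le_rfl (Set.countable_singleton (sN A))
  have he3 := he.trans he2
  have hA : sN A ∈ g2.M := hS2 rfl
  rw [he3.tr2 (fun V E x y => E x y) hzM hD]
  rw [he3.tr2 (fun V E x y => SubV E x y) hzM hw] at hz
  have key : ∀ b : Set.Iio Ordinal.omega0.{0}, g2.E (g2.cl (oN b.1)) (g2.cl z) ↔ b ∈ A := fun b =>
    (he2.tr2 (fun V E x y => E x y) (oS_mem hS b.2.le) (he.sub hzM)).symm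
  have : g2.cl z = g2.cl (sN A) := by
    refine E_ext fun w => ⟨fun hw' => ?_, fun hw' => ?_⟩
    · obtain ⟨c, hc, hcM, rfl⟩ := (mem_oN (he3.sub hw)).1 (hz w hw')
      exact (sN_mem hA (b := ⟨c, hc⟩) hcM).2 ((key ⟨c, hc⟩).1 hw')
    · obtain ⟨b, _, hb, rfl⟩ := (mem_mk hA).1 hw'
      exact (key b.1).2 b.2
  rw [this]
  exact mk_mem (he3.sub hD) A trivial hA

end GM

end JK6

section JK7
set_option linter.unusedVariables false
set_option linter.unusedSectionVars false
set_option linter.unusedSimpArgs false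

/-- Coordinates of the forcing: branches, collapses, Cohen subsets of `ω₁`. -/
inductive Co : Type 1
  | br (i : Ordinal.{0})
  | coll (a : Ordinal.{0})
  | coh (X : Set Ordinal.{0})

/-- Bounds of values. -/
noncomputable def Co.bd : Co → Ordinal.{0}
  | .br _ => 2
  | .coll a => max a (Ordinal.omega 1)
  | .coh _ => 2

/-- Atomic information. -/
@[ext] structure At : Type 1 where
  k : Co
  ξ : Ordinal.{0}
  v : Ordinal.{0}

open Classical in
noncomputable def bt (p : Prop) : Ordinal.{0} := if p then 1 else 0

theorem bt_t {p : Prop} (h : p) : bt p = 1 := if_pos h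
theorem bt_f {p : Prop} (h : ¬ p) : bt p = 0 := if_neg h
theorem bt_lt (p : Prop) : bt p < 2 := by
  unfold bt
  split_ifs
  · exact_mod_cast (show (1 : ℕ) < 2 by norm_num)
  · exact_mod_cast (show (0 : ℕ) < 2 by norm_num)
theorem bt_inj {p q : Prop} : bt p = bt q ↔ (p ↔ q) := by
  by_cases hp : p <;> by_cases hq : q <;> simp [bt, hp, hq]

/-- Limit lengths. -/
def LimO (a : Ordinal.{0}) : Prop := 0 < a ∧ ∀ b < a, b + 1 < a

theorem LimO.add {a b : Ordinal.{0}} (h : LimO a) (hb : b < a) : ∀ n : ℕ, b + n < a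
  | 0 => by simpa using hb
  | n + 1 => by
    have := h.2 _ (LimO.add h hb n)
    rwa [add_assoc] at this

def Act (c : Set At) (i : Ordinal.{0}) : Prop := ∃ ξ v, (⟨.br i, ξ, v⟩ : At) ∈ c

structure Valid (h : Ordinal.{0}) (O : Set Nd) (c : Set At) : Prop where
  hlt : h < Ordinal.omega 1
  Oc : O.Countable
  Ol : ∀ x ∈ O, LimO x.len ∧ x.len ≤ h
  cc : c.Countable
  bd : ∀ a ∈ c, a.ξ < Ordinal.omega 1 ∧ a.v < a.k.bd
  fn : ∀ k ξ v v', (⟨k, ξ, v⟩ : At) ∈ c → (⟨k, ξ, v'⟩ : At) ∈ c → v = v'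
  inj : ∀ a ξ ξ' v, (⟨.coll a, ξ, v⟩ : At) ∈ c → (⟨.coll a, ξ', v⟩ : At) ∈ c → ξ = ξ'
  brlt : ∀ i ξ v, (⟨.br i, ξ, v⟩ : At) ∈ c → ξ < h
  brt : ∀ i, Act c i → ∀ ξ < h, ∃ v, (⟨.br i, ξ, v⟩ : At) ∈ c
  br0 : ∀ i v, (⟨.br i, 0, v⟩ : At) ∈ c → v = 0
  dodge : ∀ x ∈ O, ∀ i, Act c i → ∃ ξ < x.len, (⟨.br i, ξ, bt (ξ ∉ x.S)⟩ : At) ∈ c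

/-- The forcing notion. -/
@[ext] structure PP : Type 1 where
  h : Ordinal.{0}
  O : Set Nd
  c : Set At
  val : Valid h O c

namespace PP

instance : Preorder PP where
  le q p := p.h ≤ q.h ∧ p.c ⊆ q.c ∧ p.O ⊆ q.O ∧ ∀ x ∈ q.O, x.len ≤ p.h → x ∈ p.O
  le_refl p := ⟨le_rfl, subset_rfl, subset_rfl, fun x hx _ => hx⟩
  le_trans r q p h h' := ⟨h'.1.trans h.1, h'.2.1.trans h.2.1, h'.2.2.1.trans h.2.2.1,
    fun x hx hl => h'.2.2.2 x (h.2.2.2 x hx (hl.trans h'.1)) hl⟩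

theorem le_iff {p q : PP} : q ≤ p ↔ p.h ≤ q.h ∧ p.c ⊆ q.c ∧ p.O ⊆ q.O ∧
    ∀ x ∈ q.O, x.len ≤ p.h → x ∈ p.O := Iff.rfl

theorem hle {p q : PP} (h : q ≤ p) : p.h ≤ q.h := h.1
theorem cle {p q : PP} (h : q ≤ p) : p.c ⊆ q.c := h.2.1
theorem Ole {p q : PP} (h : q ≤ p) : p.O ⊆ q.O := h.2.2.1

theorem Act.mono {c c' : Set At} (h : c ⊆ c') {i : Ordinal.{0}} (ha : Act c i) : Act c' i := by
  obtain ⟨ξ, v, h1⟩ := ha; exact ⟨ξ, v, h h1⟩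

def top : PP where
  h := 0
  O := ∅
  c := ∅
  val := by
    constructor <;> try simp [Act]
    exact Ordinal.omega_pos 1

/-! ### Limits -/

theorem exists_sup {s : ℕ → PP} (hs : Antitone s) :
    ∃ h < Ordinal.omega.{0} 1, (∀ n, (s n).h ≤ h) ∧ ∀ ξ < h, ∃ n, ξ < (s n).h := by
  obtain ⟨γ, hγ, hb⟩ := GM.countable_bdd (Set.countable_range fun n => (s n).h)
    (by rintro _ ⟨n, rfl⟩; exact (s n).val.hlt)
  have hbdd : BddAbove (Set.range fun n => (s n).h) := ⟨γ, by rintro _ ⟨n, rfl⟩; exact (hb _ ⟨n, rfl⟩).le⟩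
  refine ⟨⨆ n, (s n).h, ?_, fun n => le_ciSup hbdd n, fun ξ hξ => exists_lt_of_lt_ciSup hξ⟩
  refine lt_of_le_of_lt (ciSup_le fun n => (hb _ ⟨n, rfl⟩).le) hγ

noncomputable def sup (s : ℕ → PP) (hs : Antitone s) : Ordinal.{0} := (exists_sup hs).choose
theorem sup_lt (s : ℕ → PP) (hs : Antitone s) : sup s hs < Ordinal.omega 1 := (exists_sup hs).choose_spec.1
theorem le_sup (s : ℕ → PP) (hs : Antitone s) (n : ℕ) : (s n).h ≤ sup s hs := (exists_sup hs).choose_spec.2.1 n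
theorem lt_sup (s : ℕ → PP) (hs : Antitone s) {ξ : Ordinal.{0}} (h : ξ < sup s hs) : ∃ n, ξ < (s n).h :=
  (exists_sup hs).choose_spec.2.2 ξ h

theorem mem_c2 {s : ℕ → PP} (hs : Antitone s) {a b : At} (ha : a ∈ ⋃ n, (s n).c) (hb : b ∈ ⋃ n, (s n).c) :
    ∃ n, a ∈ (s n).c ∧ b ∈ (s n).c := by
  obtain ⟨n, hn⟩ := Set.mem_iUnion.1 ha
  obtain ⟨m, hm⟩ := Set.mem_iUnion.1 hb
  exact ⟨max n m, cle (hs (le_max_left _ _)) hn, cle (hs (le_max_right _ _)) hm⟩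

theorem lim_act {s : ℕ → PP} {i : Ordinal.{0}} (h : Act (⋃ n, (s n).c) i) : ∃ n, Act (s n).c i := by
  obtain ⟨ξ, v, h1⟩ := h
  obtain ⟨n, hn⟩ := Set.mem_iUnion.1 h1
  exact ⟨n, ξ, v, hn⟩

noncomputable def lim (s : ℕ → PP) (hs : Antitone s) : PP where
  h := sup s hs
  O := ⋃ n, (s n).O
  c := ⋃ n, (s n).c
  val := by
    constructor
    · exact sup_lt s hs
    · exact Set.countable_iUnion fun n => (s n).val.Oc
    · intro x hx
      obtain ⟨n, hn⟩ := Set.mem_iUnion.1 hx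
      exact ⟨((s n).val.Ol x hn).1, ((s n).val.Ol x hn).2.trans (le_sup s hs n)⟩
    · exact Set.countable_iUnion fun n => (s n).val.cc
    · intro x hx
      obtain ⟨n, hn⟩ := Set.mem_iUnion.1 hx
      exact (s n).val.bd x hn
    · intro k ξ v v' h1 h2
      obtain ⟨n, h1, h2⟩ := mem_c2 hs h1 h2
      exact (s n).val.fn k ξ v v' h1 h2
    · intro k ξ v v' h1 h2
      obtain ⟨n, h1, h2⟩ := mem_c2 hs h1 h2
      exact (s n).val.inj k ξ v v' h1 h2
    · intro i ξ v h1
      obtain ⟨n, hn⟩ := Set.mem_iUnion.1 h1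
      exact ((s n).val.brlt i ξ v hn).trans_le (le_sup s hs n)
    · intro i ha ξ hξ
      obtain ⟨n, hn⟩ := lim_act ha
      obtain ⟨m, hm⟩ := lt_sup s hs hξ
      obtain ⟨v, hv⟩ := (s (max n m)).val.brt i (Act.mono (cle (hs (le_max_left _ _))) hn) ξ
        (hm.trans_le (hle (hs (le_max_right _ _))))
      exact ⟨v, Set.mem_iUnion.2 ⟨_, hv⟩⟩
    · intro i v h1
      obtain ⟨n, hn⟩ := Set.mem_iUnion.1 h1
      exact (s n).val.br0 i v hn
    · intro x hx i ha
      obtain ⟨n, hn⟩ := lim_act ha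
      obtain ⟨m, hm⟩ := Set.mem_iUnion.1 hx
      obtain ⟨ξ, h1, h2⟩ := (s (max n m)).val.dodge x (Ole (hs (le_max_right _ _)) hm) i
        (Act.mono (cle (hs (le_max_left _ _))) hn)
      exact ⟨ξ, h1, Set.mem_iUnion.2 ⟨_, h2⟩⟩

theorem lim_le (s : ℕ → PP) (hs : Antitone s) (n : ℕ) : lim s hs ≤ s n := by
  refine ⟨le_sup s hs n, Set.subset_iUnion (fun n => (s n).c) n, Set.subset_iUnion (fun n => (s n).O) n, ?_⟩
  intro x hx hl
  obtain ⟨m, hm⟩ := Set.mem_iUnion.1 hx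
  rcases le_total n m with h | h
  · exact (hs h).2.2.2 x hm hl
  · exact Ole (hs h) hm

instance : SCl PP := ⟨fun s hs => ⟨lim s (antitone_nat_of_succ_le hs), lim_le s _⟩⟩

/-! ### Equivalence modulo a set of coordinates -/

def Eqv (J : Set Co) (p p' : PP) : Prop :=
  p.h = p'.h ∧ p.O = p'.O ∧ ∀ a : At, a.k ∈ J → (a ∈ p.c ↔ a ∈ p'.c)

theorem Eqv.refl (J : Set Co) (p : PP) : Eqv J p p := ⟨rfl, rfl, fun _ _ => Iff.rfl⟩
theorem Eqv.symm {J : Set Co} {p q : PP} (h : Eqv J p q) : Eqv J q p :=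
  ⟨h.1.symm, h.2.1.symm, fun a ha => (h.2.2 a ha).symm⟩
theorem Eqv.trans {J : Set Co} {p q r : PP} (h : Eqv J p q) (h' : Eqv J q r) : Eqv J p r :=
  ⟨h.1.trans h'.1, h.2.1.trans h'.2.1, fun a ha => (h.2.2 a ha).trans (h'.2.2 a ha)⟩

/-- Conditions supported by `J`. -/
def On (J : Set Co) (p : PP) : Prop := ∀ a ∈ p.c, a.k ∈ J

theorem Eqv.le {J : Set Co} {p e : PP} (h : Eqv J p e) (he : On J e) : p ≤ e :=
  ⟨h.1.ge, fun a ha => (h.2.2 a (he a ha)).2 ha, h.2.1.ge, fun x hx _ => h.2.1 ▸ hx⟩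

theorem Eqv.eq {J : Set Co} {p e : PP} (h : Eqv J p e) (hp : On J p) (he : On J e) : p = e := by
  refine PP.ext h.1 h.2.1 (Set.ext fun a => ⟨fun ha => ?_, fun ha => ?_⟩)
  · exact (h.2.2 a (hp a ha)).1 ha
  · exact (h.2.2 a (he a ha)).2 ha

def res (J : Set Co) (p : PP) : PP where
  h := p.h
  O := p.O
  c := {a | a ∈ p.c ∧ a.k ∈ J}
  val := by
    have hv := p.val
    constructor
    · exact hv.hlt
    · exact hv.Oc
    · exact hv.Ol
    · exact hv.cc.mono fun a ha => ha.1
    · exact fun a ha => hv.bd a ha.1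
    · exact fun k ξ v v' h1 h2 => hv.fn k ξ v v' h1.1 h2.1
    · exact fun k ξ v v' h1 h2 => hv.inj k ξ v v' h1.1 h2.1
    · exact fun i ξ v h => hv.brlt i ξ v h.1
    · rintro i ⟨ξ', v', h1, h2⟩ ξ hξ
      obtain ⟨v, hv⟩ := hv.brt i ⟨ξ', v', h1⟩ ξ hξ
      exact ⟨v, hv, h2⟩
    · exact fun i v h => hv.br0 i v h.1
    · rintro x hx i ⟨ξ', v', h1, h2⟩
      obtain ⟨ξ, h3, h4⟩ := hv.dodge x hx i ⟨ξ', v', h1⟩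
      exact ⟨ξ, h3, h4, h2⟩

theorem res_on (J : Set Co) (p : PP) : On J (res J p) := fun a ha => ha.2
theorem res_eqv (J : Set Co) (p : PP) : Eqv J p (res J p) :=
  ⟨rfl, rfl, fun a ha => ⟨fun h => ⟨h, ha⟩, fun h => h.1⟩⟩
theorem le_res (J : Set Co) (p : PP) : p ≤ res J p := (res_eqv J p).le (res_on J p)

theorem res_congr {J : Set Co} {p q : PP} (h : Eqv J p q) : res J p = res J q :=
  (((res_eqv J p).symm.trans h).trans (res_eqv J q)).eq (res_on _ _) (res_on _ _)

theorem res_mono {J : Set Co} {p q : PP} (h : p ≤ q) : res J p ≤ res J q :=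
  ⟨h.1, fun a ha => ⟨h.2.1 ha.1, ha.2⟩, h.2.2.1, h.2.2.2⟩

theorem lim_eqv {J : Set Co} {s s' : ℕ → PP} (hs : Antitone s) (hs' : Antitone s')
    (h : ∀ n, Eqv J (s n) (s' n)) : Eqv J (lim s hs) (lim s' hs') := by
  refine ⟨?_, ?_, ?_⟩
  · apply le_antisymm <;> refine le_of_forall_lt fun ξ hξ => ?_
    · obtain ⟨n, hn⟩ := lt_sup s hs hξ
      rw [(h n).1] at hn
      exact hn.trans_le (le_sup s' hs' n)
    · obtain ⟨n, hn⟩ := lt_sup s' hs' hξ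
      rw [← (h n).1] at hn
      exact hn.trans_le (le_sup s hs n)
  · exact Set.iUnion_congr fun n => (h n).2.1
  · intro a ha
    show a ∈ (⋃ n, (s n).c) ↔ a ∈ ⋃ n, (s' n).c
    simp only [Set.mem_iUnion]
    exact exists_congr fun n => (h n).2.2 a ha

/-- Diagonalizing against countably many nodes of limit length above `h`. -/
theorem exists_diag (h : Ordinal.{0}) {O : Set Nd} (hO : O.Countable)
    (hl : ∀ x ∈ O, LimO x.len ∧ h < x.len) :
    ∃ w : Ordinal.{0} → Prop, ∀ x ∈ O, ∃ ξ, h ≤ ξ ∧ ξ < x.len ∧ (w ξ ↔ ξ ∉ x.S) := by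
  rcases O.eq_empty_or_nonempty with rfl | hne
  · exact ⟨fun _ => True, by simp⟩
  obtain ⟨e, rfl⟩ := hO.exists_eq_range hne
  refine ⟨fun ξ => ∀ n : ℕ, ξ = h + n → ξ ∉ (e n).S, ?_⟩
  rintro _ ⟨n, rfl⟩
  refine ⟨h + n, le_self_add, (hl _ ⟨n, rfl⟩).1.add (hl _ ⟨n, rfl⟩).2 n, ?_⟩
  constructor
  · intro hw; exact hw n rfl
  · intro hw m hm
    have : (n : Ordinal.{0}) = m := (add_right_inj _).1 hm
    rw [Nat.cast_inj] at this
    rwa [← this]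

theorem act_pos {p : PP} {i : Ordinal.{0}} (h : Act p.c i) : 0 < p.h := by
  obtain ⟨ξ, v, h⟩ := h
  exact lt_of_le_of_lt zero_le (p.val.brlt i ξ v h)

/-- Bisimulation. -/
theorem bisim {J : Set Co} {p p' p1 : PP} (he : Eqv J p p') (h1 : p1 ≤ p) :
    ∃ p1' ≤ p', Eqv J p1' p1 := by
  obtain ⟨w, hw⟩ := exists_diag p.h (O := p1.O \ p.O) (p1.val.Oc.mono Set.sdiff_subset)
    (fun x hx => ⟨(p1.val.Ol x hx.1).1, not_le.1 fun hl => hx.2 (h1.2.2.2 x hx.1 hl)⟩)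
  let N : Set At := {a | ∃ i ξ, Co.br i ∉ J ∧ Act p'.c i ∧ p.h ≤ ξ ∧ ξ < p1.h ∧ a = ⟨.br i, ξ, bt (w ξ)⟩}
  let c : Set At := {a | (a.k ∈ J ∧ a ∈ p1.c) ∨ (a.k ∉ J ∧ (a ∈ p'.c ∨ a ∈ N))}
  have hJ : ∀ {a : At}, a.k ∈ J → (a ∈ c ↔ a ∈ p1.c) := by
    intro a ha
    simp [c, ha]
  have hnJ : ∀ {a : At}, a.k ∉ J → (a ∈ c ↔ a ∈ p'.c ∨ a ∈ N) := by
    intro a ha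
    simp [c, ha]
  have hsub : p'.c ⊆ c := by
    intro a ha
    by_cases hk : a.k ∈ J
    · exact (hJ hk).2 (h1.2.1 ((he.2.2 a hk).2 ha))
    · exact (hnJ hk).2 (Or.inl ha)
  have hactJ : ∀ {i}, Co.br i ∈ J → (Act c i ↔ Act p1.c i) := by
    intro i hi
    exact exists_congr fun ξ => exists_congr fun v => hJ hi
  have hactn : ∀ {i}, Co.br i ∉ J → (Act c i ↔ Act p'.c i) := by
    intro i hi
    constructor
    · rintro ⟨ξ, v, h⟩
      rcases (hnJ hi).1 h with h | ⟨i', ξ', _, h2, _, _, h3⟩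
      · exact ⟨ξ, v, h⟩
      · cases h3; exact h2
    · exact Act.mono hsub
  have hv : Valid p1.h p1.O c := by
    constructor
    · exact p1.val.hlt
    · exact p1.val.Oc
    · exact p1.val.Ol
    · have hN : N.Countable := by
        have : N ⊆ (fun t : At × Ordinal.{0} => (⟨t.1.k, t.2, bt (w t.2)⟩ : At)) '' (p'.c ×ˢ Set.Iio p1.h) := by
          rintro _ ⟨i, ξ, _, ⟨ξ', v', h2⟩, _, h3, rfl⟩
          exact ⟨(_, ξ), ⟨h2, h3⟩, rfl⟩
        exact ((p'.val.cc.prod (GM.lt_omega1_iff.1 p1.val.hlt)).image _).mono this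
      refine ((p1.val.cc.union p'.val.cc).union hN).mono ?_
      rintro a (h | ⟨_, h | h⟩)
      · exact Or.inl (Or.inl h.2)
      · exact Or.inl (Or.inr h)
      · exact Or.inr h
    · rintro a (h | ⟨_, h | h⟩)
      · exact p1.val.bd a h.2
      · exact p'.val.bd a h
      · obtain ⟨i, ξ, _, _, _, h3, rfl⟩ := h
        exact ⟨h3.trans p1.val.hlt, bt_lt _⟩
    · intro k ξ v v' h2 h3
      by_cases hk : k ∈ J
      · exact p1.val.fn k ξ v v' ((hJ hk).1 h2) ((hJ hk).1 h3)
      · rcases (hnJ hk).1 h2 with h2 | ⟨i, ξ', _, h4, h5, h6, h7⟩ <;>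
          rcases (hnJ hk).1 h3 with h3 | ⟨i', ξ'', _, h4', h5', h6', h7'⟩
        · exact p'.val.fn k ξ v v' h2 h3
        · cases h7'
          exact absurd (p'.val.brlt _ _ _ h2) (not_lt.2 (he.1 ▸ h5'))
        · cases h7
          exact absurd (p'.val.brlt _ _ _ h3) (not_lt.2 (he.1 ▸ h5))
        · cases h7; cases h7'; rfl
    · intro a ξ ξ' v h2 h3
      by_cases hk : Co.coll a ∈ J
      · exact p1.val.inj a ξ ξ' v ((hJ hk).1 h2) ((hJ hk).1 h3)
      · rcases (hnJ hk).1 h2 with h2 | ⟨i, ξ', _, h4, h5, h6, h7⟩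
        · rcases (hnJ hk).1 h3 with h3 | ⟨i', ξ'', _, h4', h5', h6', h7'⟩
          · exact p'.val.inj a ξ ξ' v h2 h3
          · cases h7'
        · cases h7
    · intro i ξ v h2
      by_cases hk : Co.br i ∈ J
      · exact p1.val.brlt i ξ v ((hJ hk).1 h2)
      · rcases (hnJ hk).1 h2 with h2 | ⟨i, ξ', _, h4, h5, h6, h7⟩
        · exact (p'.val.brlt i ξ v h2).trans_le (he.1 ▸ h1.1)
        · cases h7; exact h6
    · intro i ha ξ hξ
      by_cases hk : Co.br i ∈ J
      · obtain ⟨v, hv⟩ := p1.val.brt i ((hactJ hk).1 ha) ξ hξ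
        exact ⟨v, (hJ hk).2 hv⟩
      · have ha' := (hactn hk).1 ha
        rcases lt_or_ge ξ p.h with h | h
        · obtain ⟨v, hv⟩ := p'.val.brt i ha' ξ (he.1 ▸ h)
          exact ⟨v, hsub hv⟩
        · exact ⟨_, (hnJ hk).2 (Or.inr ⟨i, ξ, hk, ha', h, hξ, rfl⟩)⟩
    · intro i v h2
      by_cases hk : Co.br i ∈ J
      · exact p1.val.br0 i v ((hJ hk).1 h2)
      · rcases (hnJ hk).1 h2 with h2 | ⟨i, ξ', _, h4, h5, h6, h7⟩
        · exact p'.val.br0 i v h2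
        · cases h7
          have := act_pos h4
          rw [← he.1] at this
          exact absurd this (not_lt.2 h5)
    · intro x hx i ha
      by_cases hk : Co.br i ∈ J
      · obtain ⟨ξ, h2, h3⟩ := p1.val.dodge x hx i ((hactJ hk).1 ha)
        exact ⟨ξ, h2, (hJ hk).2 h3⟩
      · have ha' := (hactn hk).1 ha
        by_cases hxp : x ∈ p.O
        · obtain ⟨ξ, h2, h3⟩ := p'.val.dodge x (he.2.1 ▸ hxp) i ha'
          exact ⟨ξ, h2, hsub h3⟩
        · obtain ⟨ξ, h2, h3, h4⟩ := hw x ⟨hx, hxp⟩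
          refine ⟨ξ, h3, (hnJ hk).2 (Or.inr ⟨i, ξ, hk, ha', h2, h3.trans_le (p1.val.Ol x hx).2, ?_⟩)⟩
          rw [propext h4]
  refine ⟨⟨p1.h, p1.O, c, hv⟩, ⟨he.1 ▸ h1.1, hsub, he.2.1 ▸ h1.2.2.1, ?_⟩, rfl, rfl, fun a ha => hJ ha⟩
  intro x hx hl
  rw [← he.1] at hl
  rw [← he.2.1]
  exact h1.2.2.2 x hx hl

/-- If `p0 ≤ p|J` is supported by `J`, then `p0` and `p` are compatible. -/
theorem compat {J : Set Co} {p p0 : PP} (h : p0 ≤ res J p) (h0 : On J p0) :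
    ∃ r, r ≤ p ∧ r ≤ p0 ∧ Eqv J r p0 := by
  obtain ⟨r, hr, hr'⟩ := bisim (res_eqv J p).symm h
  exact ⟨r, hr, hr'.le h0, hr'⟩

/-! ### Extensions -/

theorem raise (p : PP) {h : Ordinal.{0}} (hp : p.h ≤ h) (hh : h < Ordinal.omega 1) :
    ∃ p' ≤ p, p'.h = h ∧ p'.O = p.O := by
  let q : PP := ⟨h, p.O, ∅, by
    have := p.val
    constructor <;> try simp [Act]
    · exact hh
    · exact this.Oc
    · exact fun x hx => ⟨(this.Ol x hx).1, (this.Ol x hx).2.trans hp⟩⟩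
  have hq : q ≤ res ∅ p := ⟨hp, fun a ha => ha.2.elim, subset_rfl, fun x hx _ => hx⟩
  obtain ⟨r, hr, hr'⟩ := bisim (res_eqv ∅ p).symm hq
  exact ⟨r, hr, hr'.1, hr'.2.1⟩

theorem add1 (p : PP) (k : Co) (hk : ∀ i, k ≠ .br i) {ξ v : Ordinal.{0}} (hξ : ξ < Ordinal.omega 1)
    (hv : v < k.bd) (hf : ∀ v', (⟨k, ξ, v'⟩ : At) ∉ p.c)
    (hi : ∀ a, k = .coll a → ∀ ξ', (⟨k, ξ', v⟩ : At) ∉ p.c) :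
    ∃ p' ≤ p, (⟨k, ξ, v⟩ : At) ∈ p'.c ∧ p'.h = p.h ∧ p'.O = p.O ∧ p'.c = insert ⟨k, ξ, v⟩ p.c := by
  have hbr : ∀ i ξ' v', (⟨.br i, ξ', v'⟩ : At) ∈ insert (⟨k, ξ, v⟩ : At) p.c → (⟨.br i, ξ', v'⟩ : At) ∈ p.c := by
    rintro i ξ' v' (h | h)
    · exact absurd (congrArg At.k h).symm (hk i)
    · exact h
  have hact : ∀ i, Act (insert (⟨k, ξ, v⟩ : At) p.c) i → Act p.c i := by
    rintro i ⟨ξ', v', h⟩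
    exact ⟨ξ', v', hbr _ _ _ h⟩
  refine ⟨⟨p.h, p.O, insert ⟨k, ξ, v⟩ p.c, ?_⟩, ⟨le_rfl, Set.subset_insert _ _, subset_rfl,
    fun x hx _ => hx⟩, Set.mem_insert _ _, rfl, rfl, rfl⟩
  have hV := p.val
  constructor
  · exact hV.hlt
  · exact hV.Oc
  · exact hV.Ol
  · exact hV.cc.insert _
  · rintro a (rfl | h)
    · exact ⟨hξ, hv⟩
    · exact hV.bd a h
  · rintro k' ξ' w w' (h | h) (h' | h')
    · exact (congrArg At.v h).trans (congrArg At.v h').symm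
    · cases h; exact (hf _ h').elim
    · cases h'; exact (hf _ h).elim
    · exact hV.fn _ _ _ _ h h'
  · rintro a ξ' ξ'' w (h | h) (h' | h')
    · exact (congrArg At.ξ h).trans (congrArg At.ξ h').symm
    · cases h; exact (hi _ rfl _ h').elim
    · cases h'; exact (hi _ rfl _ h).elim
    · exact hV.inj _ _ _ _ h h'
  · exact fun i ξ' v' h => hV.brlt i ξ' v' (hbr _ _ _ h)
  · intro i ha ξ' hξ'
    obtain ⟨v', h⟩ := hV.brt i (hact i ha) ξ' hξ'
    exact ⟨v', Or.inr h⟩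
  · exact fun i v' h => hV.br0 i v' (hbr _ _ _ h)
  · intro x hx i ha
    obtain ⟨ξ', h1, h⟩ := hV.dodge x hx i (hact i ha)
    exact ⟨ξ', h1, Or.inr h⟩

theorem dom_countable (p : PP) (k : Co) : {ξ | ∃ v, (⟨k, ξ, v⟩ : At) ∈ p.c}.Countable := by
  refine (p.val.cc.image At.ξ).mono ?_
  rintro ξ ⟨v, h⟩; exact ⟨_, h, rfl⟩

theorem ran_countable (p : PP) (k : Co) : {v | ∃ ξ, (⟨k, ξ, v⟩ : At) ∈ p.c}.Countable := by
  refine (p.val.cc.image At.v).mono ?_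
  rintro ξ ⟨v, h⟩; exact ⟨_, h, rfl⟩

/-- A fresh position above a bound. -/
theorem fresh (p : PP) (k : Co) (b : Ordinal.{0}) (hb : b < Ordinal.omega 1) :
    ∃ ξ < Ordinal.omega.{0} 1, b ≤ ξ ∧ ∀ v, (⟨k, ξ, v⟩ : At) ∉ p.c := by
  obtain ⟨γ, hγ, h⟩ := GM.countable_bdd (A := insert b {ξ | ∃ v, (⟨k, ξ, v⟩ : At) ∈ p.c})
    ((dom_countable p k).insert b) (by
      rintro ξ (rfl | ⟨v, h⟩)
      · exact hb
      · exact (p.val.bd _ h).1)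
  exact ⟨γ, hγ, (h b (Or.inl rfl)).le, fun v hv => lt_irrefl _ (h γ (Or.inr ⟨v, hv⟩))⟩

theorem coll_hit (p : PP) (a : Ordinal.{0}) {v : Ordinal.{0}} (hv : v < (Co.coll a).bd) :
    ∃ p' ≤ p, ∃ ξ < Ordinal.omega.{0} 1, (⟨.coll a, ξ, v⟩ : At) ∈ p'.c := by
  by_cases h : ∃ ξ, (⟨.coll a, ξ, v⟩ : At) ∈ p.c
  · obtain ⟨ξ, h⟩ := h
    exact ⟨p, le_rfl, ξ, (p.val.bd _ h).1, h⟩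
  · push Not at h
    obtain ⟨ξ, h1, _, h2⟩ := fresh p (.coll a) 0 (Ordinal.omega_pos 1)
    obtain ⟨p', h3, h4, _⟩ := add1 p (.coll a) (by simp) h1 hv h2 (fun _ _ => h)
    exact ⟨p', h3, ξ, h1, h4⟩

theorem coll_dom (p : PP) (a : Ordinal.{0}) {ξ : Ordinal.{0}} (hξ : ξ < Ordinal.omega 1) :
    ∃ p' ≤ p, ∃ v, (⟨.coll a, ξ, v⟩ : At) ∈ p'.c := by
  by_cases h : ∃ v, (⟨.coll a, ξ, v⟩ : At) ∈ p.c
  · obtain ⟨v, h⟩ := h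
    exact ⟨p, le_rfl, v, h⟩
  · push Not at h
    obtain ⟨v, h1, h2⟩ : ∃ v < (Co.coll a).bd, ∀ ξ, (⟨.coll a, ξ, v⟩ : At) ∉ p.c := by
      by_contra hc
      push Not at hc
      have : Set.Iio (Co.coll a).bd ⊆ {v | ∃ ξ, (⟨.coll a, ξ, v⟩ : At) ∈ p.c} := fun v hv => hc v hv
      have h3 := GM.lt_omega1_iff.2 ((ran_countable p (.coll a)).mono this)
      exact absurd (le_max_right a (Ordinal.omega 1)) (not_le.2 h3)
    obtain ⟨p', h3, h4, _⟩ := add1 p (.coll a) (by simp) hξ h1 h (fun _ _ => h2)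
    exact ⟨p', h3, v, h4⟩

theorem coh_dom (p : PP) (X : Set Ordinal.{0}) {ξ : Ordinal.{0}} (hξ : ξ < Ordinal.omega 1)
    (h : ∀ v, (⟨.coh X, ξ, v⟩ : At) ∉ p.c) (b : Prop) :
    ∃ p' ≤ p, (⟨.coh X, ξ, bt b⟩ : At) ∈ p'.c := by
  obtain ⟨p', h3, h4, _⟩ := add1 p (.coh X) (by simp) hξ (bt_lt b) h (by simp)
  exact ⟨p', h3, h4⟩

theorem coh_split (p : PP) {X Y : Set Ordinal.{0}} (hXY : X ≠ Y) :
    ∃ p' ≤ p, ∃ ξ < Ordinal.omega.{0} 1, (⟨.coh X, ξ, 1⟩ : At) ∈ p'.c ∧ (⟨.coh Y, ξ, 0⟩ : At) ∈ p'.c := by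
  obtain ⟨b, hb, hbX⟩ := GM.countable_bdd (A := {ξ | ∃ v, (⟨.coh X, ξ, v⟩ : At) ∈ p.c})
    (dom_countable p _) (by rintro ξ ⟨v, h⟩; exact (p.val.bd _ h).1)
  obtain ⟨ξ, hξ, h1, h2⟩ := fresh p (.coh Y) b hb
  have hX : ∀ v, (⟨.coh X, ξ, v⟩ : At) ∉ p.c := fun v hv => absurd (hbX ξ ⟨v, hv⟩) (not_lt.2 h1)
  obtain ⟨p1, h3, h4, _, _, hc⟩ := add1 p (.coh X) (by simp) hξ (v := 1) (by
    have := bt_lt True; rwa [bt_t trivial] at this) hX (by simp)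
  have h5 : ∀ v, (⟨.coh Y, ξ, v⟩ : At) ∉ p1.c := by
    intro v hv
    rw [hc] at hv
    rcases hv with hv | hv
    · have := congrArg At.k hv
      simp only [Co.coh.injEq] at this
      exact hXY this.symm
    · exact h2 v hv
  obtain ⟨p2, h6, h7⟩ := coh_dom p1 Y hξ h5 False
  rw [bt_f id] at h7
  exact ⟨p2, h6.trans h3, ξ, hξ, cle h6 h4, h7⟩

/-- Activate a branch. -/
theorem activate (p : PP) (i : Ordinal.{0}) : ∃ p' ≤ p, Act p'.c i := by
  by_cases hac : Act p.c i
  · exact ⟨p, le_rfl, hac⟩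
  wlog hpos : 0 < p.h generalizing p
  · obtain ⟨p1, h1, h2, _⟩ := raise p (h := 1) (by rw [not_lt.1 hpos |>.antisymm zero_le]; exact zero_le)
      (by exact_mod_cast GM.omega1_pos_lt (n := 1))
    by_cases h : Act p1.c i
    · exact ⟨p1, h1, h⟩
    · obtain ⟨p2, h3, h4⟩ := this p1 h (by rw [h2]; exact zero_lt_one)
      exact ⟨p2, h3.trans h1, h4⟩
  have one_lt : ∀ x ∈ p.O, 1 < x.len := fun x hx => by
    have := (p.val.Ol x hx).1.2 0 (p.val.Ol x hx).1.1
    rwa [zero_add] at this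
  obtain ⟨w, hw⟩ := exists_diag 1 p.val.Oc (fun x hx => ⟨(p.val.Ol x hx).1, one_lt x hx⟩)
  let N : Set At := {a | ∃ ξ < p.h, a = ⟨.br i, ξ, bt (w ξ ∧ ξ ≠ 0)⟩}
  have hN : ∀ {ξ}, ξ < p.h → (⟨.br i, ξ, bt (w ξ ∧ ξ ≠ 0)⟩ : At) ∈ p.c ∪ N :=
    fun h => Or.inr ⟨_, h, rfl⟩
  have hV := p.val
  have hact : ∀ j, Act (p.c ∪ N) j → Act p.c j ∨ j = i := by
    rintro j ⟨ξ, v, h | ⟨ξ', _, h⟩⟩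
    · exact Or.inl ⟨ξ, v, h⟩
    · cases h; exact Or.inr rfl
  refine ⟨⟨p.h, p.O, p.c ∪ N, ?_⟩, ⟨le_rfl, Set.subset_union_left, subset_rfl, fun x hx _ => hx⟩,
    0, _, hN hpos⟩
  constructor
  · exact hV.hlt
  · exact hV.Oc
  · exact hV.Ol
  · refine hV.cc.union (((GM.lt_omega1_iff.1 hV.hlt).image
      fun ξ => (⟨.br i, ξ, bt (w ξ ∧ ξ ≠ 0)⟩ : At)).mono ?_)
    rintro a ⟨ξ, h, rfl⟩; exact ⟨ξ, h, rfl⟩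
  · rintro a (h | ⟨ξ, h, rfl⟩)
    · exact hV.bd a h
    · exact ⟨h.trans hV.hlt, bt_lt _⟩
  · rintro k ξ v v' (h | ⟨_, _, h⟩) (h' | ⟨_, _, h'⟩)
    · exact hV.fn _ _ _ _ h h'
    · cases h'; exact (hac ⟨_, _, h⟩).elim
    · cases h; exact (hac ⟨_, _, h'⟩).elim
    · cases h; cases h'; rfl
  · rintro a ξ ξ' v (h | ⟨_, _, h⟩) (h' | ⟨_, _, h'⟩)
    · exact hV.inj _ _ _ _ h h'
    · cases h'
    · cases h
    · cases h
  · rintro j ξ v (h | ⟨ξ', h1, h⟩)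
    · exact hV.brlt _ _ _ h
    · cases h; exact h1
  · intro j hj ξ hξ
    rcases hact j hj with hj | rfl
    · obtain ⟨v, hv⟩ := hV.brt j hj ξ hξ
      exact ⟨v, Or.inl hv⟩
    · exact ⟨_, hN hξ⟩
  · rintro j v (h | ⟨ξ', h1, h⟩)
    · exact hV.br0 _ _ h
    · cases h; exact bt_f (by simp)
  · intro x hx j hj
    rcases hact j hj with hj | rfl
    · obtain ⟨ξ, h1, h2⟩ := hV.dodge x hx j hj
      exact ⟨ξ, h1, Or.inl h2⟩
    · obtain ⟨ξ, h1, h2, h3⟩ := hw x hx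
      refine ⟨ξ, h2, ?_⟩
      have h0 : ξ ≠ 0 := (lt_of_lt_of_le zero_lt_one h1).ne'
      have := hN (h2.trans_le (hV.Ol x hx).2)
      rwa [show (w ξ ∧ ξ ≠ 0) = (ξ ∉ x.S) by rw [← propext h3]; exact and_iff_left h0 |> propext] at this

/-- Extend all branches by one chosen bit. -/
theorem raise1 (p : PP) (w : Ordinal.{0} → Prop) :
    ∃ p' ≤ p, ∀ i, Act p.c i → (⟨.br i, p.h, bt (w i)⟩ : At) ∈ p'.c := by
  have hV := p.val
  let N : Set At := {a | ∃ i, Act p.c i ∧ a = ⟨.br i, p.h, bt (w i)⟩}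
  have hact : ∀ j, Act (p.c ∪ N) j → Act p.c j := by
    rintro j ⟨ξ, v, h | ⟨i, hi, h⟩⟩
    · exact ⟨ξ, v, h⟩
    · cases h; exact hi
  have hh : p.h < p.h + 1 := Order.lt_add_one_iff.2 le_rfl
  have hlim : LimO (Ordinal.omega.{0} 1) := by
    refine ⟨Ordinal.omega_pos 1, fun b hb => ?_⟩
    obtain ⟨γ, h1, h2⟩ := GM.countable_bdd (Set.countable_singleton b) (by rintro _ rfl; exact hb)
    exact lt_of_le_of_lt (Order.add_one_le_of_lt (h2 b rfl)) h1
  refine ⟨⟨p.h + 1, p.O, p.c ∪ N, ?_⟩, ⟨hh.le, Set.subset_union_left, subset_rfl, fun x hx _ => hx⟩,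
    fun i hi => Or.inr ⟨i, hi, rfl⟩⟩
  constructor
  · exact hlim.2 _ hV.hlt
  · exact hV.Oc
  · exact fun x hx => ⟨(hV.Ol x hx).1, (hV.Ol x hx).2.trans hh.le⟩
  · refine hV.cc.union ((hV.cc.image fun a : At =>
      match a.k with | .br i => (⟨.br i, p.h, bt (w i)⟩ : At) | _ => a).mono ?_)
    rintro a ⟨i, ⟨ξ, v, h⟩, rfl⟩; exact ⟨_, h, rfl⟩
  · rintro a (h | ⟨ξ, h, rfl⟩)
    · exact hV.bd a h
    · exact ⟨hV.hlt, bt_lt _⟩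
  · rintro k ξ v v' (h | ⟨_, _, h⟩) (h' | ⟨_, _, h'⟩)
    · exact hV.fn _ _ _ _ h h'
    · cases h'; exact (lt_irrefl _ (hV.brlt _ _ _ h)).elim
    · cases h; exact (lt_irrefl _ (hV.brlt _ _ _ h')).elim
    · cases h; cases h'; rfl
  · rintro a ξ ξ' v (h | ⟨_, _, h⟩) (h' | ⟨_, _, h'⟩)
    · exact hV.inj _ _ _ _ h h'
    · cases h'
    · cases h
    · cases h
  · rintro j ξ v (h | ⟨ξ', h1, h⟩)
    · exact (hV.brlt _ _ _ h).trans hh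
    · cases h; exact hh
  · intro j hj ξ hξ
    rcases (Order.lt_add_one_iff.1 hξ).lt_or_eq with hξ | rfl
    · obtain ⟨v, hv⟩ := hV.brt j (hact j hj) ξ hξ
      exact ⟨v, Or.inl hv⟩
    · exact ⟨_, Or.inr ⟨j, hact j hj, rfl⟩⟩
  · rintro j v (h | ⟨i, hi, h⟩)
    · exact hV.br0 _ _ h
    · have h2 := congrArg At.ξ h
      have := act_pos hi
      simp only at h2
      rw [← h2] at this
      exact (lt_irrefl _ this).elim
  · intro x hx j hj
    obtain ⟨ξ, h1, h2⟩ := hV.dodge x hx j (hact j hj)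
    exact ⟨ξ, h1, Or.inl h2⟩

theorem br_split (p : PP) {i j : Ordinal.{0}} (hij : i ≠ j) :
    ∃ p' ≤ p, ∃ ξ < p'.h, (⟨.br i, ξ, 1⟩ : At) ∈ p'.c ∧ (⟨.br j, ξ, 0⟩ : At) ∈ p'.c := by
  obtain ⟨p1, h1, h2⟩ := activate p i
  obtain ⟨p2, h3, h4⟩ := activate p1 j
  obtain ⟨p3, h5, h6⟩ := raise1 p2 (fun k => k = i)
  have hi := h6 i (Act.mono (cle h3) h2)
  have hj := h6 j h4
  rw [bt_t rfl] at hi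
  rw [bt_f hij.symm] at hj
  exact ⟨p3, (h5.trans h3).trans h1, _, p3.val.brlt _ _ _ hi, hi, hj⟩

/-! ### Smallness and capturing -/

theorem small_on (J : Set Co) [Small.{0} J] : Small.{0} {p : PP // On J p} := by
  let A := Σ k : J, Set.Iio (Ordinal.omega.{0} 1) × Set.Iio k.1.bd
  let f : {p : PP // On J p} → Set.Iio (Ordinal.omega.{0} 1) × Set Nd × Set A :=
    fun p => (⟨p.1.h, p.1.val.hlt⟩, p.1.O, {a | (⟨a.1.1, a.2.1.1, a.2.2.1⟩ : At) ∈ p.1.c})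
  refine small_of_injective (f := f) ?_
  rintro ⟨p, hp⟩ ⟨q, hq⟩ h
  have h1 : p.h = q.h := congrArg (fun z => z.1.1) h
  have h2 : p.O = q.O := congrArg (fun z => z.2.1) h
  have h3 : ∀ a : A, (⟨a.1.1, a.2.1.1, a.2.2.1⟩ : At) ∈ p.c ↔ (⟨a.1.1, a.2.1.1, a.2.2.1⟩ : At) ∈ q.c := by
    intro a
    have : (a ∈ (f ⟨p, hp⟩).2.2) = (a ∈ (f ⟨q, hq⟩).2.2) := by rw [h]
    exact iff_of_eq this
  refine Subtype.ext (PP.ext h1 h2 (Set.ext fun a => ⟨fun ha => ?_, fun ha => ?_⟩))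
  · exact (h3 ⟨⟨a.k, hp a ha⟩, ⟨a.ξ, (p.val.bd a ha).1⟩, ⟨a.v, (p.val.bd a ha).2⟩⟩).1 ha
  · exact (h3 ⟨⟨a.k, hq a ha⟩, ⟨a.ξ, (q.val.bd a ha).1⟩, ⟨a.v, (q.val.bd a ha).2⟩⟩).2 ha

def supp (p : PP) : Set Co := At.k '' p.c

theorem supp_countable (p : PP) : (supp p).Countable := p.val.cc.image _

noncomputable def stage {X : Type 1} (Φ : X → PP → PP) (J0 : Set Co) (a : Ordinal.{0}) : Set Co :=
  J0 ∪ ⋃ b : Set.Iio a, ⋃ (x : X) (p : {p : PP // On (stage Φ J0 b.1) p}), supp (Φ x p.1)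
termination_by a
decreasing_by exact b.2

theorem stage_eq {X : Type 1} (Φ : X → PP → PP) (J0 : Set Co) (a : Ordinal.{0}) : stage Φ J0 a =
    J0 ∪ ⋃ b : Set.Iio a, ⋃ (x : X) (p : {p : PP // On (stage Φ J0 b.1) p}), supp (Φ x p.1) := by
  rw [stage]

theorem stage_small {X : Type 1} [Small.{0} X] (Φ : X → PP → PP) (J0 : Set Co) [Small.{0} J0]
    (a : Ordinal.{0}) : Small.{0} (stage Φ J0 a) := by
  induction a using WellFoundedLT.induction with
  | _ a ih =>
    rw [stage]
    have : Small.{0} (Set.Iio a) := inferInstance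
    refine @small_union _ _ _ _ ?_
    refine @small_iUnion _ _ _ _ (fun b => ?_)
    have := ih b.1 b.2
    have := small_on (stage Φ J0 b.1)
    refine @small_iUnion _ _ _ _ (fun x => @small_iUnion _ _ _ _ (fun p => ?_))
    have : Countable (supp (Φ x p.1)) := (supp_countable _).to_subtype
    exact Countable.toSmall _

theorem stage_mono {X : Type 1} (Φ : X → PP → PP) (J0 : Set Co) {a b : Ordinal.{0}} (h : a ≤ b) :
    stage Φ J0 a ⊆ stage Φ J0 b := by
  rw [stage_eq Φ J0 a, stage_eq Φ J0 b]
  refine Set.union_subset_union subset_rfl ?_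
  intro k hk
  obtain ⟨c, hc⟩ := Set.mem_iUnion.1 hk
  exact Set.mem_iUnion.2 ⟨⟨c.1, c.2.trans_le h⟩, hc⟩

/-- Capturing. -/
theorem capture {X : Type 1} [Small.{0} X] (Φ : X → PP → PP) (J0 : Set Co) [Small.{0} J0] :
    ∃ J : Set Co, Small.{0} J ∧ J0 ⊆ J ∧ ∀ x p, On J p → On J (Φ x p) := by
  refine ⟨⋃ a : Set.Iio (Ordinal.omega.{0} 1), stage Φ J0 a.1, ?_, ?_, ?_⟩
  · have := fun a => stage_small Φ J0 a
    exact small_iUnion _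
  · intro k hk
    refine Set.mem_iUnion.2 ⟨⟨0, Ordinal.omega_pos 1⟩, ?_⟩
    rw [stage]; exact Or.inl hk
  · intro x p hp
    have h1 : ∀ k : supp p, ∃ a < Ordinal.omega.{0} 1, k.1 ∈ stage Φ J0 a := by
      rintro ⟨_, a, ha, rfl⟩
      obtain ⟨b, hb⟩ := Set.mem_iUnion.1 (hp a ha)
      exact ⟨b.1, b.2, hb⟩
    choose f hf hf' using h1
    have : Countable (supp p) := (supp_countable p).to_subtype
    obtain ⟨γ, hγ, hb⟩ := GM.countable_bdd (Set.countable_range f) (by rintro _ ⟨k, rfl⟩; exact hf k)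
    have hon : On (stage Φ J0 γ) p := fun a ha =>
      stage_mono Φ J0 (hb _ ⟨⟨a.k, a, ha, rfl⟩, rfl⟩).le (hf' ⟨a.k, a, ha, rfl⟩)
    obtain ⟨δ, hδ, hd⟩ := GM.countable_bdd (Set.countable_singleton γ) (by rintro _ rfl; exact hγ)
    intro a ha
    refine Set.mem_iUnion.2 ⟨⟨δ, hδ⟩, ?_⟩
    rw [stage]
    exact Or.inr (Set.mem_iUnion.2 ⟨⟨γ, hd γ rfl⟩, Set.mem_iUnion.2 ⟨x, Set.mem_iUnion.2 ⟨⟨p, hon⟩, a, ha, rfl⟩⟩⟩)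

/-- The chain condition. -/
theorem chain {Y : Type 1} (R : PP → Y → Prop)
    (hR : ∀ p p' y y', R p y → R p' y' → y ≠ y' → ∀ r, r ≤ p → ¬ r ≤ p') :
    Small.{0} {y | ∃ p, R p y} := by
  classical
  let Φ : PUnit.{2} → PP → PP := fun _ e => if h : ∃ p ≤ e, ∃ y, R p y then h.choose else e
  have hΦ : ∀ x e, (∃ p ≤ e, ∃ y, R p y) → Φ x e ≤ e ∧ ∃ y, R (Φ x e) y := by
    intro x e h
    have : Φ x e = h.choose := dif_pos h
    rw [this]; exact h.choose_spec
  obtain ⟨J, hJ, -, hcl⟩ := capture Φ (∅ : Set Co)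
  have := small_on J
  let S : Set Y := ⋃ e : {p : PP // On J p}, {y | R (Φ ⟨⟩ e.1) y}
  have hS : Small.{0} S := by
    refine @small_iUnion _ _ _ _ (fun e => ?_)
    have : Subsingleton {y | R (Φ ⟨⟩ e.1) y} := by
      constructor
      rintro ⟨y, hy⟩ ⟨y', hy'⟩
      by_contra h
      exact hR _ _ y y' hy hy' (fun h' => h (Subtype.ext h')) _ le_rfl le_rfl
    infer_instance
  refine @small_subset _ _ _ ?_ hS
  rintro y ⟨p, hp⟩
  have h1 := hΦ ⟨⟩ (res J p) ⟨p, le_res J p, y, hp⟩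
  obtain ⟨r, hr, hr', -⟩ := compat h1.1 (hcl ⟨⟩ _ (res_on J p))
  obtain ⟨y', hy'⟩ := h1.2
  have : y = y' := by
    by_contra h
    exact hR _ _ y y' hp hy' h r hr hr'
  exact Set.mem_iUnion.2 ⟨⟨res J p, res_on J p⟩, this ▸ hy'⟩

end PP

end JK7

section JK8
set_option linter.unusedVariables false
set_option linter.unusedSectionVars false
set_option linter.unusedSimpArgs false

theorem exists_lab0 (ι : Type 1) [hs : Small.{0} ι] : ∃ α : Ordinal.{0}, ∃ lab : ι → Ordinal.{0},
    Function.Injective lab ∧ Set.range lab = Set.Iio α ∧ α = (Cardinal.mk (Shrink.{0} ι)).ord := by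
  let α : Ordinal.{0} := (Cardinal.mk (Shrink.{0} ι)).ord
  have h1 : Cardinal.mk (Shrink.{0} ι) = Cardinal.mk α.ToType := (Cardinal.mk_ord_toType _).symm
  obtain ⟨e⟩ := Cardinal.eq.1 h1
  let E : ι ≃ Set.Iio α := ((equivShrink ι).trans e).trans (Ordinal.ToType.mk (o := α)).toEquiv.symm
  refine ⟨α, fun i => (E i).1, fun i j h => E.injective (Subtype.ext h), ?_, rfl⟩
  ext b
  constructor
  · rintro ⟨i, rfl⟩; exact (E i).2
  · intro hb; exact ⟨E.symm ⟨b, hb⟩, by simp⟩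

theorem exists_lab (ι : Type 1) [Small.{0} ι] [Uncountable ι] :
    ∃ α : Ordinal.{0}, Ordinal.omega 1 ≤ α ∧ ∃ lab : ι → Ordinal.{0},
    Function.Injective lab ∧ Set.range lab = Set.Iio α := by
  obtain ⟨α, lab, h1, h2, h3⟩ := exists_lab0 ι
  refine ⟨α, ?_, lab, h1, h2⟩
  rw [h3, ← Cardinal.ord_aleph, Cardinal.ord_le_ord]
  have : Uncountable (Shrink.{0} ι) := (equivShrink ι).injective.uncountable
  rw [Cardinal.aleph_one_le_iff]
  exact Cardinal.aleph0_lt_mk_iff.2 this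

theorem exists_lab1 (ι : Type 1) [Small.{0} ι] :
    ∃ α : Ordinal.{0}, Ordinal.omega 1 ≤ α ∧ ∃ lab : ι → Ordinal.{0},
    Function.Injective lab ∧ ∀ i, lab i < α := by
  obtain ⟨α, lab, h1, h2, h3⟩ := exists_lab0 ι
  refine ⟨max (Ordinal.omega 1) α, le_max_left _ _, lab, h1, fun i => lt_max_of_lt_right ?_⟩
  have : lab i ∈ Set.range lab := ⟨i, rfl⟩
  rwa [h2] at this

namespace GM
variable {g g' : GM PP}

theorem bd_coll {α : Ordinal.{0}} (h : Ordinal.omega 1 ≤ α) : (Co.coll α).bd = α := max_eq_left h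

theorem equinum_lab {ι : Type 1} {a : ι → Nm PP} {c : ι → LowerSet PP}
    (ht : Nm.mk ι a c ∈ g.M) (hk : oN (Ordinal.omega 1) ∈ g.M) {α : Ordinal.{0}}
    (hα : Ordinal.omega 1 ≤ α) (lab : ι → Ordinal.{0}) (hlab : ∀ i, lab i < α)
    (H1 : ∀ β < α, ∀ p, ∃ p' ≤ p, ∃ i, lab i = β ∧ p' ∈ c i)
    (H2 : ∀ p i j, p ∈ c i → p ∈ c j → lab i = lab j → i = j)
    (H3 : ∀ g', Ext g g' → ∀ i j, g'.q ∈ c i → g'.q ∈ c j → a i ∈ g'.M → a j ∈ g'.M →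
      g'.cl (a i) = g'.cl (a j) → lab i = lab j) :
    EquinumV g.E (g.cl (Nm.mk ι a c)) (g.cl (oN (Ordinal.omega 1))) := by
  let C : ι × Set.Iio (Ordinal.omega.{0} 1) → LowerSet PP := fun x =>
    ⟨{p | p ∈ c x.1 ∧ (⟨.coll α, x.2.1, lab x.1⟩ : At) ∈ p.c},
      fun p q hqp hp => ⟨(c x.1).lower hqp hp.1, PP.cle hqp hp.2⟩⟩
  let f : Nm PP := fnN (ι × Set.Iio (Ordinal.omega.{0} 1)) (fun x => a x.1) (fun x => oN x.2.1) C
  obtain ⟨g1, hg, -, hS⟩ := ext g le_rfl (Set.countable_singleton f)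
  rw [hg.tr2 (fun V E x y => EquinumV E x y) ht hk]
  have hf : f ∈ g1.M := hS rfl
  have ht1 := hg.sub ht
  have hk1 := hg.sub hk
  refine ⟨_, ⟨funcOn_fn hf ?_ ?_, ?_⟩, injFun_fn hf ?_, ?_⟩
  · rintro ⟨i, ξ⟩ ⟨j, η⟩ hi hj h1 h2 h3 h4 h5
    have e := H3 g1 hg i j hi.1 hj.1 h1 h3 h5
    have h6 := hi.2
    have h7 := hj.2
    simp only at h6 h7
    rw [← e] at h7
    have := g1.q.val.inj _ _ _ _ h6 h7
    simp only [this]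
  · intro x
    constructor
    · rintro ⟨⟨i, ξ⟩, hi, h1, h2, rfl⟩
      exact mk_mem ht1 i hi.1 h1
    · intro hx
      obtain ⟨i, hi, ha, rfl⟩ := (mem_mk ht1).1 hx
      obtain ⟨p', hp', ξ, hξ, hc⟩ := PP.coll_hit g1.q α (v := lab i) (by rw [bd_coll hα]; exact hlab i)
      obtain ⟨g2, hg2, hq, hS2⟩ := ext g1 hp' (Set.countable_singleton (oN ξ))
      have h1 : ∃ y, FunVal g1.E (g1.cl f) (g1.cl (a i)) y := by
        rw [hg2.tr2 (fun V E x y => ∃ z, FunVal E x y z) hf ha]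
        exact ⟨g2.cl (oN ξ), (funVal_fn (hg2.sub hf)).2
          ⟨(i, ⟨ξ, hξ⟩), ⟨(c i).lower (hg2.le) hi, PP.cle hq hc⟩, hg2.sub ha, hS2 rfl, rfl, rfl⟩⟩
      obtain ⟨y, hy⟩ := h1
      obtain ⟨k, h2, h3, h4, h5, h6⟩ := (funVal_fn hf).1 hy
      exact ⟨k, h2, h3, h4, h5⟩
  · intro x y hxy
    obtain ⟨⟨i, ξ⟩, h2, h3, h4, h5, rfl⟩ := (funVal_fn hf).1 hxy
    exact oN_lt h4 hk1 ξ.2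
  · rintro ⟨i, ξ⟩ ⟨j, η⟩ hi hj h1 h2 h3 h4 h5
    have e := (oN_inj h2 h4).1 h5
    have h6 := hi.2
    have h7 := hj.2
    simp only at h6 h7 e
    rw [← e] at h7
    have := g1.q.val.fn _ _ _ _ h6 h7
    rw [H2 _ i j hi.1 hj.1 this]
  · intro y hy
    obtain ⟨ξ, hξ, hξM, rfl⟩ := (mem_oN hk1).1 hy
    obtain ⟨p1, hp1, v, hv⟩ := PP.coll_dom g1.q α hξ
    have hvα : v < α := by
      have := (p1.val.bd _ hv).2
      simpa [bd_coll hα] using this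
    obtain ⟨p2, hp2, i, rfl, hi⟩ := H1 v hvα p1
    obtain ⟨g2, hg2, hq, hS2⟩ := ext g1 (hp2.trans hp1) (Set.countable_singleton (a i))
    rw [hg2.tr2 (fun V E x y => ∃ z, FunVal E x z y) hf hξM]
    exact ⟨g2.cl (a i), (funVal_fn (hg2.sub hf)).2
      ⟨(i, ⟨ξ, hξ⟩), ⟨(c i).lower hq hi, PP.cle (hq.trans hp2) hv⟩, hS2 rfl, hg2.sub hξM, rfl, rfl⟩⟩

theorem inj_small {y : Nm PP} (hy : y ∈ g.M) (hk : oN (Ordinal.omega 1) ∈ g.M)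
    [Small.{0} y.idx] : InjInto g.E (g.cl y) (g.cl (oN (Ordinal.omega 1))) := by
  obtain ⟨α, hα, e, he, heα⟩ := exists_lab1 y.idx
  let C : y.idx × Set.Iio (Ordinal.omega.{0} 1) → LowerSet PP := fun x =>
    ⟨{p | p ∈ y.cond x.1 ∧ (⟨.coll α, x.2.1, e x.1⟩ : At) ∈ p.c ∧
      ∀ j, e j < e x.1 → ∀ r ≤ p, r ∈ y.cond j → ¬ Nm.eqF (y.el j) (y.el x.1) r},
      fun p q hqp hp => ⟨(y.cond x.1).lower hqp hp.1, PP.cle hqp hp.2.1,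
        fun j hj r hr => hp.2.2 j hj r (hr.trans hqp)⟩⟩
  let f : Nm PP := fnN (y.idx × Set.Iio (Ordinal.omega.{0} 1)) (fun x => y.el x.1) (fun x => oN x.2.1) C
  obtain ⟨g1, hg, -, hS⟩ := ext g le_rfl (Set.countable_singleton f)
  rw [hg.tr2 (fun V E x y => InjInto E x y) hy hk]
  have hf : f ∈ g1.M := hS rfl
  have ht1 := hg.sub hy
  have hk1 := hg.sub hk
  refine injInto_of_fn hf ?_ ?_ ?_
  · rintro ⟨i, ξ⟩ ⟨j, η⟩ hi hj h1 h2 h3 h4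
    have h6 := hi.2.1
    have h7 := hj.2.1
    simp only at h6 h7
    constructor
    · intro h5
      have h5 := (cl_eq h1 h3).1 h5
      have : e i = e j := by
        rcases lt_trichotomy (e i) (e j) with h | h | h
        · exact (hj.2.2 i h _ le_rfl hi.1 h5).elim
        · exact h
        · exact (hi.2.2 j h _ le_rfl hj.1 (Nm.eqF_symm h5)).elim
      rw [← this] at h7
      simp only [g1.q.val.inj _ _ _ _ h6 h7]
    · intro h5
      have e' := (oN_inj h2 h4).1 h5
      simp only at e'
      rw [← e'] at h7
      simp only [he (g1.q.val.fn _ _ _ _ h6 h7)]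
  · intro x
    constructor
    · rintro ⟨⟨i, ξ⟩, hi, h1, h2, rfl⟩
      exact mem_of ht1 i hi.1 h1
    · intro hx
      obtain ⟨i, hi, ha, rfl⟩ := (mem_cl ht1).1 hx
      let A : Set Ordinal.{0} := {b | ∃ j, e j = b ∧ ∃ p ≤ g1.q, p ∈ y.cond j ∧ Nm.eqF (y.el j) (y.el i) p}
      have hA : A.Nonempty := ⟨_, i, rfl, g1.q, le_rfl, hi, Nm.eqF_refl _ _⟩
      obtain ⟨j, hj, p, hp, hpj, heq⟩ := WellFounded.min_mem (wellFounded_lt (α := Ordinal.{0})) A hA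
      have hmin : ∀ b < e j, b ∉ A := fun b hb hbA =>
        WellFounded.not_lt_min (wellFounded_lt (α := Ordinal.{0})) A hbA (hj ▸ hb)
      obtain ⟨p', hp', ξ, hξ, hc⟩ := PP.coll_hit p α (v := e j) (by rw [bd_coll hα]; exact heα j)
      obtain ⟨g2, hg2, hq, hS2⟩ := ext g1 (hp'.trans hp) (S := {oN ξ, y.el j}) (by simp)
      have h1 : ∃ z, FunVal g1.E (g1.cl f) (g1.cl (y.el i)) z := by
        rw [hg2.tr2 (fun V E x y => ∃ z, FunVal E x y z) hf ha]
        refine ⟨g2.cl (oN ξ), (funVal_fn (hg2.sub hf)).2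
          ⟨(j, ⟨ξ, hξ⟩), ⟨(y.cond j).lower (hq.trans hp') hpj, PP.cle hq hc, ?_⟩, hS2 (by simp), hS2 (by simp),
            ?_, rfl⟩⟩
        · intro k hk r hr hrk hre
          exact hmin _ hk ⟨k, rfl, r, hr.trans hg2.le, hrk,
            Nm.eqF_trans hre (Nm.eqF_mono heq (hr.trans (hq.trans hp')))⟩
        · exact (cl_eq (hg2.sub ha) (hS2 (by simp))).2 (Nm.eqF_symm (Nm.eqF_mono heq (hq.trans hp')))
      obtain ⟨z, hz⟩ := h1
      obtain ⟨k, h2, h3, h4, h5, h6⟩ := (funVal_fn hf).1 hz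
      exact ⟨k, h2, h3, h4, h5⟩
  · rintro ⟨i, ξ⟩ _ _ h
    exact oN_lt h hk1 ξ.2

theorem cover (Φ : ∀ V : Type, (V → V → Prop) → V → V → V → Prop)
    [h : Dn 3 (fun V E v => Φ V E (v 0) (v 1) (v 2))] {I J : Type 1} {a : I → Nm PP} {b : J → Nm PP}
    {f : Nm PP} (hf : f ∈ g.M)
    (huniq : ∀ g', Ext g g' → ∀ x x' y, Φ g'.N g'.E (g'.cl f) x y → Φ g'.N g'.E (g'.cl f) x' y → x = x')
    (htot : ∀ i g', Ext g g' → a i ∈ g'.M → ∃ j, b j ∈ g'.M ∧ Φ g'.N g'.E (g'.cl f) (g'.cl (a i)) (g'.cl (b j)))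
    (hdist : ∀ g', Ext g g' → ∀ i i', a i ∈ g'.M → a i' ∈ g'.M → g'.cl (a i) = g'.cl (a i') → i = i') :
    ∃ S : J → Set I, (∀ j, Small.{0} (S j)) ∧ ∀ i, ∃ j, i ∈ S j := by
  let R : J → PP → I → Prop := fun j p i => ∃ g', Ext g g' ∧ g'.q = p ∧ a i ∈ g'.M ∧ b j ∈ g'.M ∧
    Φ g'.N g'.E (g'.cl f) (g'.cl (a i)) (g'.cl (b j))
  refine ⟨fun j => {i | ∃ p, R j p i}, fun j => PP.chain (R j) ?_, ?_⟩
  · rintro p p' i i' ⟨g1, hg1, rfl, h1, h2, h3⟩ ⟨g2, hg2, rfl, h1', h2', h3'⟩ hne r hr hr'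
    obtain ⟨g3, hg3, hq, hS⟩ := ext g (hr.trans hg1.le) (S := {a i, a i', b j}) (by simp)
    have hi : a i ∈ g3.M := hS (by simp)
    have hi' : a i' ∈ g3.M := hS (by simp)
    have hj : b j ∈ g3.M := hS (by simp)
    have A := (tr3 Φ (hq.trans hr) (hg1.sub hf) (hg3.sub hf) h1 hi h2 hj).1 h3
    have B := (tr3 Φ (hq.trans hr') (hg2.sub hf) (hg3.sub hf) h1' hi' h2' hj).1 h3'
    exact hne (hdist g3 hg3 i i' hi hi' (huniq g3 hg3 _ _ _ A B))
  · intro i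
    obtain ⟨g1, hg1, -, hS⟩ := ext g le_rfl (Set.countable_singleton (a i))
    obtain ⟨j, hj, hΦ⟩ := htot i g1 hg1 (hS rfl)
    exact ⟨j, _, g1, hg1, rfl, hS rfl, hj, hΦ⟩

theorem not_cover_ord {J : Type 1} [Small.{0} J] (S : J → Set Ordinal.{0}) (hS : ∀ j, Small.{0} (S j)) :
    ¬ ∀ i, ∃ j, i ∈ S j := by
  intro h
  have : (⋃ j, S j) = Set.univ := Set.eq_univ_of_forall fun i => Set.mem_iUnion.2 (h i)
  have h2 : Small.{0} (⋃ j, S j) := small_iUnion S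
  rw [this] at h2
  exact not_small_ordinal.{0} ((small_congr (Equiv.Set.univ _)).1 h2)

theorem small_emb {α : Type 1} [Small.{0} α] : ∃ e : α → Ordinal.{0}, Function.Injective e := by
  obtain ⟨_, _, e, he, _⟩ := exists_lab1 α
  exact ⟨e, he⟩

theorem not_cover_set (S : Ordinal.{0} → Set (Set Ordinal.{0})) (hS : ∀ j, Small.{0} (S j)) :
    ¬ ∀ i, ∃ j, i ∈ S j := by
  intro h
  choose J hJ using h
  have : ∀ j, ∃ e : S j → Ordinal.{0}, Function.Injective e := fun j => small_emb
  choose e he using this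
  let F : Set Ordinal.{0} → Ordinal.{0} × Ordinal.{0} := fun X => (J X, e (J X) ⟨X, hJ X⟩)
  have hF : Function.Injective F := by
    intro X Y hXY
    have h1 : J X = J Y := congrArg Prod.fst hXY
    have h2 : e (J X) ⟨X, hJ X⟩ = e (J Y) ⟨Y, hJ Y⟩ := congrArg Prod.snd hXY
    have : ∀ (k : Ordinal.{0}) (hk : k = J X) (hX : X ∈ S k), e k ⟨X, hX⟩ = e (J Y) ⟨Y, hJ Y⟩ := by
      rintro k rfl hX; exact h2
    have := he _ (this (J Y) h1.symm (h1 ▸ hJ X))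
    exact congrArg Subtype.val this
  have hc : Cardinal.mk (Set Ordinal.{0}) ≤ Cardinal.mk Ordinal.{0} := by
    have h1 := Cardinal.mk_le_of_injective hF
    rw [Cardinal.mk_prod, Cardinal.lift_id, Cardinal.mul_eq_self] at h1
    · exact h1
    · exact Cardinal.infinite_iff.1 inferInstance
  rw [Cardinal.mk_set] at hc
  exact absurd (Cardinal.cantor _) (not_lt.2 hc)


theorem cover_inj {I J : Type 1} {a : I → Nm PP} {b : J → Nm PP} {A B : Nm PP} (hA : A ∈ g.M) (hB : B ∈ g.M)
    (hinj : InjInto g.E (g.cl A) (g.cl B))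
    (ha : ∀ g', Ext g g' → ∀ i, a i ∈ g'.M → g'.E (g'.cl (a i)) (g'.cl A))
    (hb : ∀ g', Ext g g' → ∀ y, g'.E y (g'.cl B) → ∃ j, b j ∈ g'.M ∧ y = g'.cl (b j))
    (hdist : ∀ g', Ext g g' → ∀ i i', a i ∈ g'.M → a i' ∈ g'.M → g'.cl (a i) = g'.cl (a i') → i = i') :
    ∃ S : J → Set I, (∀ j, Small.{0} (S j)) ∧ ∀ i, ∃ j, i ∈ S j := by
  obtain ⟨f, hf, hi⟩ := hinj
  obtain ⟨f, hfM, rfl⟩ := cl_surj f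
  refine cover (fun V E f x y => FunVal E f x y) (a := a) (b := b) hfM ?_ ?_ hdist
  · intro g' hg x x' y
    exact (hg.tr1 (fun V E x => InjFun E x) hfM).1 hi x x' y
  · intro i g' hg hM
    have h1 := (hg.tr3 (fun V E x y z => IsFuncInto E x y z) hfM hA hB).1 hf
    obtain ⟨y, hy⟩ := (h1.1.2.2 _).2 (ha g' hg i hM)
    obtain ⟨j, hj, rfl⟩ := hb g' hg y (h1.2 _ _ hy)
    exact ⟨j, hj, hy⟩

theorem cover_equi {I J : Type 1} {a : I → Nm PP} {b : J → Nm PP} {A B : Nm PP} (hA : A ∈ g.M) (hB : B ∈ g.M)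
    (hinj : EquinumV g.E (g.cl B) (g.cl A))
    (ha : ∀ g', Ext g g' → ∀ i, a i ∈ g'.M → g'.E (g'.cl (a i)) (g'.cl A))
    (hb : ∀ g', Ext g g' → ∀ y, g'.E y (g'.cl B) → ∃ j, b j ∈ g'.M ∧ y = g'.cl (b j))
    (hdist : ∀ g', Ext g g' → ∀ i i', a i ∈ g'.M → a i' ∈ g'.M → g'.cl (a i) = g'.cl (a i') → i = i') :
    ∃ S : J → Set I, (∀ j, Small.{0} (S j)) ∧ ∀ i, ∃ j, i ∈ S j := by
  obtain ⟨f, hf, hi, hs⟩ := hinj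
  obtain ⟨f, hfM, rfl⟩ := cl_surj f
  refine cover (fun V E f x y => FunVal E f y x) (a := a) (b := b) hfM ?_ ?_ hdist
  · intro g' hg x x' y
    exact ((hg.tr3 (fun V E x y z => IsFuncInto E x y z) hfM hB hA).1 hf).1.2.1 y x x'
  · intro i g' hg hM
    have h1 := (hg.tr3 (fun V E x y z => IsFuncInto E x y z) hfM hB hA).1 hf
    have h2 := (hg.tr2 (fun V E x z => ∀ y, E y z → ∃ w, FunVal E x w y) hfM hA).1 hs
    obtain ⟨y, hy⟩ := h2 _ (ha g' hg i hM)
    obtain ⟨j, hj, rfl⟩ := hb g' hg y ((h1.1.2.2 _).1 ⟨_, hy⟩)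
    exact ⟨j, hj, hy⟩

noncomputable def kN : Nm PP := Nm.mk Ordinal.{0} oN (fun _ => ⊤)

theorem mem_kN (h : kN ∈ g.M) {w : g.N} : g.E w (g.cl kN) ↔ ∃ b, oN b ∈ g.M ∧ w = g.cl (oN b) := by
  unfold kN at *
  rw [mem_mk h]
  constructor
  · rintro ⟨i, _, h⟩; exact ⟨i, h⟩
  · rintro ⟨i, h⟩; exact ⟨i, trivial, h⟩

instance (b : Ordinal.{0}) : Small.{0} (oN (P := PP) b).idx := by
  rw [oN_eq]
  exact Ordinal.small_Iio b

theorem oN_cover_tgt (hk : oN (Ordinal.omega 1) ∈ g.M) : ∀ g', Ext g g' → ∀ y, g'.E y (g'.cl (oN (Ordinal.omega 1))) →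
    ∃ j : Set.Iio (Ordinal.omega.{0} 1), oN j.1 ∈ g'.M ∧ y = g'.cl (oN j.1) := by
  intro g' hg y hy
  obtain ⟨b, hb, hM, rfl⟩ := (mem_oN (hg.sub hk)).1 hy
  exact ⟨⟨b, hb⟩, hM, rfl⟩

theorem kN_omega2 (h : kN ∈ g.M) (hk : oN (Ordinal.omega 1) ∈ g.M) : IsOmega2V g.E (g.cl kN) := by
  refine ⟨⟨?_, ?_⟩, ?_⟩
  · intro y hy z hz
    obtain ⟨b, hb, rfl⟩ := (mem_kN h).1 hy
    obtain ⟨c, _, hc, rfl⟩ := (mem_oN hb).1 hz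
    exact (mem_kN h).2 ⟨c, hc, rfl⟩
  · intro y z hy hz
    obtain ⟨b, hb, rfl⟩ := (mem_kN h).1 hy
    obtain ⟨c, hc, rfl⟩ := (mem_kN h).1 hz
    rcases lt_trichotomy b c with h | h | h
    · exact Or.inl (oN_lt hb hc h)
    · exact Or.inr (Or.inl (by rw [h]))
    · exact Or.inr (Or.inr (oN_lt hc hb h))
  · intro k₁ hk1
    rw [omega1_unique hk1 (oN_omega1 hk)]
    constructor
    · intro hinj
      obtain ⟨S, h1, h2⟩ := cover_inj (a := oN) (b := fun j : Set.Iio (Ordinal.omega.{0} 1) => oN j.1) h hk hinj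
        (fun g' hg i hM => (mem_kN (hg.sub h)).2 ⟨i, hM, rfl⟩) (oN_cover_tgt hk)
        (fun g' hg i i' hi hi' he => (oN_inj hi hi').1 he)
      have : Small.{0} (Set.Iio (Ordinal.omega.{0} 1)) := Ordinal.small_Iio _
      exact not_cover_ord S h1 h2
    · intro a ha
      obtain ⟨b, hb, rfl⟩ := (mem_kN h).1 ha
      exact inj_small hb hk

/-- Cohen subsets of `ω₁`. -/
noncomputable def cohN (X : Set Ordinal.{0}) : Nm PP :=
  Nm.mk (Set.Iio (Ordinal.omega.{0} 1)) (fun ξ => oN ξ.1)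
    (fun ξ => ⟨{p | (⟨.coh X, ξ.1, 1⟩ : At) ∈ p.c}, fun p q hqp hp => PP.cle hqp hp⟩)

theorem coh_sub {X : Set Ordinal.{0}} (h : cohN X ∈ g.M) (hk : oN (Ordinal.omega 1) ∈ g.M) :
    SubV g.E (g.cl (cohN X)) (g.cl (oN (Ordinal.omega 1))) := by
  intro z hz
  obtain ⟨ξ, _, hM, rfl⟩ := (mem_mk h).1 hz
  exact oN_lt hM hk ξ.2

theorem coh_inj {X Y : Set Ordinal.{0}} (hX : cohN X ∈ g.M) (hY : cohN Y ∈ g.M)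
    (h : g.cl (cohN X) = g.cl (cohN Y)) : X = Y := by
  by_contra hne
  obtain ⟨p, hp, ξ, hξ, h1, h2⟩ := PP.coh_split g.q hne
  obtain ⟨g1, hg, hq, hS⟩ := ext g hp (Set.countable_singleton (oN ξ))
  rw [hg.tr2 (fun V E x y => x = y) hX hY] at h
  have hM : oN ξ ∈ g1.M := hS rfl
  have h3 : g1.E (g1.cl (oN ξ)) (g1.cl (cohN X)) :=
    mk_mem (hg.sub hX) ⟨ξ, hξ⟩ (PP.cle hq h1) hM
  rw [h] at h3
  obtain ⟨η, h4, hη, h5⟩ := (mem_mk (hg.sub hY)).1 h3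
  have := (oN_inj hM hη).1 h5
  have h4' : (⟨.coh Y, η.1, 1⟩ : At) ∈ g1.q.c := h4
  rw [← this] at h4'
  have := g1.q.val.fn _ _ _ _ h4' (PP.cle hq h2)
  exact one_ne_zero this

theorem small_pw : Small.{0} (Set (Set.Iio Ordinal.omega0.{0})) := by
  have : Small.{0} (Set.Iio Ordinal.omega0.{0}) := Ordinal.small_Iio _
  have : Small.{0} (Set.Iio Ordinal.omega0.{0} → Prop) := inferInstance
  exact this

theorem unc_pw : Uncountable (Set (Set.Iio Ordinal.omega0.{0})) := by
  have : Infinite (Set.Iio Ordinal.omega0.{0}) :=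
    Infinite.of_injective (fun n : ℕ => (⟨n, Ordinal.natCast_lt_omega0 n⟩ : Set.Iio Ordinal.omega0.{0}))
      (fun a b h => by have : (a : Ordinal.{0}) = b := congrArg Subtype.val h; exact_mod_cast this)
  rw [← Cardinal.aleph0_lt_mk_iff, Cardinal.mk_set]
  exact (Cardinal.infinite_iff.1 this).trans_lt (Cardinal.cantor _)

theorem chv (hw : oN Ordinal.omega0 ∈ g.M) (hD : PWN ∈ g.M) (hk : oN (Ordinal.omega 1) ∈ g.M) : CHV g.E := by
  intro w p k₁ h1 h2 h3
  rw [omega1_unique h3 (oN_omega1 hk)]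
  rw [omega_unique h1 (oN_omega hw)] at h2
  have : p = g.cl PWN := E_ext fun z => by rw [h2 z, sN_decide hw hD]
  rw [this]
  have := small_pw
  have := unc_pw
  obtain ⟨α, hα, lab, hl, hr⟩ := exists_lab (Set (Set.Iio Ordinal.omega0.{0}))
  refine equinum_lab (a := sN) hD hk hα lab ?_ ?_ ?_ ?_
  · intro i; have : lab i ∈ Set.range lab := ⟨i, rfl⟩
    rwa [hr] at this
  · intro β hβ p
    have : β ∈ Set.range lab := by rw [hr]; exact hβ
    obtain ⟨i, hi⟩ := this
    exact ⟨p, le_rfl, i, hi, trivial⟩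
  · intro p i j _ _ h; exact hl h
  · intro g' hg i j _ _ h4 h5 h6
    rw [(sN_inj h4 h5).1 h6]

theorem pow_above (hK : kN ∈ g.M) (hk : oN (Ordinal.omega 1) ∈ g.M) : PowOmega1AboveOmega2V g.E := by
  intro k₁ p k₂ h1 h2 h3 hinj
  rw [omega2_unique h1 h3 (kN_omega2 hK hk)] at hinj
  rw [omega1_unique h1 (oN_omega1 hk)] at h2
  obtain ⟨p, hp, rfl⟩ := cl_surj p
  suffices h : ∃ S : Ordinal.{0} → Set (Set Ordinal.{0}), (∀ j, Small.{0} (S j)) ∧ ∀ i, ∃ j, i ∈ S j by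
    obtain ⟨S, h4, h5⟩ := h
    exact not_cover_set S h4 h5
  refine cover_inj (a := cohN) (b := fun j : Ordinal.{0} => oN j) hp hK hinj ?_ ?_ ?_
  · intro g' hg X hX
    exact ((hg.tr2 (fun V E x y => IsPowOf E x y) hp hk).1 h2 _).2 (coh_sub hX (hg.sub hk))
  · intro g' hg y hy
    exact (mem_kN (hg.sub hK)).1 hy
  · intro g' hg i i' hi hi' he
    exact coh_inj hi hi' he

end GM

end JK8

section JK9
set_option linter.unusedVariables false
set_option linter.unusedSectionVars false
set_option linter.unusedSimpArgs false

instance : Inhabited Nd := ⟨⟨0, ∅, Ordinal.omega_pos 1, Set.empty_subset _⟩⟩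
instance : Inhabited PP := ⟨PP.top⟩

namespace Nd

/-- Clear the bit `0`. -/
def clr (x : Nd) : Nd := ⟨x.len, x.S \ {0}, x.lt, Set.sdiff_subset.trans x.sub⟩

theorem clr_0 (x : Nd) : (0 : Ordinal.{0}) ∉ x.clr.S := fun h => h.2 rfl

theorem clr_eq {x : Nd} (h : (0 : Ordinal.{0}) ∉ x.S) : x.clr = x :=
  Nd.ext rfl (Set.sdiff_singleton_eq_self h)

/-- Set the bit `0`. -/
def st (x : Nd) (h : 0 < x.len) : Nd := ⟨x.len, insert 0 x.S, x.lt, Set.insert_subset h x.sub⟩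

theorem clr_st {x : Nd} (h : 0 < x.len) (h0 : (0 : Ordinal.{0}) ∉ x.S) : (x.st h).clr = x :=
  Nd.ext rfl (Set.insert_sdiff_self_of_notMem h0)

end Nd

namespace PP

def Alive (p : PP) (x : Nd) : Prop := x.len ≤ p.h ∧ ∀ y ∈ p.O, ¬ y ≤ x
def Killed (p : PP) (x : Nd) : Prop := ∃ y ∈ p.O, y ≤ x

theorem Alive.mono {p q : PP} {x : Nd} (h : q ≤ p) (hp : p.Alive x) : q.Alive x :=
  ⟨hp.1.trans (hle h), fun y hy hyx => hp.2 y (h.2.2.2 y hy (hyx.1.trans hp.1)) hyx⟩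

theorem Killed.mono {p q : PP} {x : Nd} (h : q ≤ p) (hp : p.Killed x) : q.Killed x := by
  obtain ⟨y, hy, h'⟩ := hp; exact ⟨y, Ole h hy, h'⟩

theorem Killed.pos {p : PP} {x : Nd} (hp : p.Killed x) : 1 < x.len := by
  obtain ⟨y, hy, h⟩ := hp
  have := (p.val.Ol y hy).1
  have h2 := this.2 0 this.1
  rw [zero_add] at h2
  exact h2.trans_le h.1

/-- `x` is an initial segment of the `i`-th generic branch. -/
def BrC (p : PP) (i : Ordinal.{0}) (x : Nd) : Prop := ∀ ξ < x.len, (⟨.br i, ξ, bt (ξ ∈ x.S)⟩ : At) ∈ p.c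

theorem BrC.mono {p q : PP} {i : Ordinal.{0}} {x : Nd} (h : q ≤ p) (hp : p.BrC i x) : q.BrC i x :=
  fun ξ hξ => cle h (hp ξ hξ)

theorem BrC.alive {p : PP} {i : Ordinal.{0}} {x : Nd} (h : p.BrC i x) : p.Alive x := by
  refine ⟨le_of_forall_lt fun ξ hξ => p.val.brlt _ _ _ (h ξ hξ), fun y hy hyx => ?_⟩
  have hpos := (p.val.Ol y hy).1.1
  obtain ⟨η, hη, hc⟩ := p.val.dodge y hy i ⟨0, _, h 0 (hpos.trans_le hyx.1)⟩
  have := bt_inj.1 (p.val.fn _ _ _ _ hc (h η (hη.trans_le hyx.1)))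
  rw [hyx.2 η hη] at this
  tauto

theorem BrC.zero {p : PP} {i : Ordinal.{0}} {x : Nd} (h : p.BrC i x) : (0 : Ordinal.{0}) ∉ x.S := by
  intro h0
  have h1 := h 0 (x.sub h0)
  rw [bt_t h0] at h1
  exact one_ne_zero (p.val.br0 _ _ h1)

theorem lt_two {v : Ordinal.{0}} (h : v < 2) : v = 0 ∨ v = 1 := by
  have h2 : v < 1 + 1 := by rwa [one_add_one_eq_two]
  have h1 : v ≤ 1 := Order.lt_add_one_iff.1 h2
  rcases h1.lt_or_eq with h | h
  · exact Or.inl (Order.lt_one_iff.1 h)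
  · exact Or.inr h

theorem br_get (p : PP) (i : Ordinal.{0}) {ξ : Ordinal.{0}} (hξ : ξ < Ordinal.omega 1) :
    ∃ p' ≤ p, ∃ x : Nd, x.len = ξ ∧ p'.BrC i x := by
  obtain ⟨p1, h1, h2⟩ := activate p i
  obtain ⟨p2, h3, h4, _⟩ := raise p1 (le_max_left p1.h ξ) (max_lt p1.val.hlt hξ)
  refine ⟨p2, h3.trans h1, ⟨ξ, {η | η < ξ ∧ (⟨.br i, η, 1⟩ : At) ∈ p2.c}, hξ, fun η hη => hη.1⟩, rfl, ?_⟩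
  intro η hη
  obtain ⟨v, hv⟩ := p2.val.brt i (Act.mono (cle h3) h2) η (by rw [h4]; exact lt_max_of_lt_right hη)
  have hv2 : v < 2 := (p2.val.bd _ hv).2
  rcases lt_two hv2 with rfl | rfl
  · rw [bt_f]
    · exact hv
    · rintro ⟨_, h⟩
      exact zero_ne_one (p2.val.fn _ _ _ _ hv h)
  · rw [bt_t]
    · exact hv
    · exact ⟨hη, hv⟩

end PP

namespace GM
variable {g g' : GM PP}

/-- The condition putting the node `x` into the tree. -/
def TC (x : Nd) : LowerSet PP :=
  ⟨{p | ((0 : Ordinal.{0}) ∉ x.S ∧ p.Alive x) ∨ ((0 : Ordinal.{0}) ∈ x.S ∧ p.Killed x.clr)}, fun p q hqp hp => by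
    rcases hp with ⟨h, hp⟩ | ⟨h, hp⟩
    · exact Or.inl ⟨h, hp.mono hqp⟩
    · exact Or.inr ⟨h, hp.mono hqp⟩⟩

/-- The Jech-Kunen tree. -/
noncomputable def TN : Nm PP := Nm.mk Nd ndN TC

/-- The generic branches. -/
noncomputable def brN (i : Ordinal.{0}) : Nm PP :=
  Nm.mk Nd ndN (fun x => ⟨{p | p.BrC i x}, fun p q hqp hp => PP.BrC.mono hqp hp⟩)

noncomputable def GB : Nm PP := Nm.mk Ordinal.{0} brN (fun _ => ⊤)

theorem mem_TN (h : TN ∈ g.M) {w : g.N} : g.E w (g.cl TN) ↔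
    ∃ x, g.q ∈ TC x ∧ ndN x ∈ g.M ∧ w = g.cl (ndN x) := mem_mk h

theorem mem_brN {i : Ordinal.{0}} (h : brN i ∈ g.M) {w : g.N} : g.E w (g.cl (brN i)) ↔
    ∃ x, g.q.BrC i x ∧ ndN x ∈ g.M ∧ w = g.cl (ndN x) := mem_mk h

theorem mem_GB (h : GB ∈ g.M) {w : g.N} : g.E w (g.cl GB) ↔ ∃ i, brN i ∈ g.M ∧ w = g.cl (brN i) := by
  unfold GB at *
  rw [mem_mk h]
  constructor
  · rintro ⟨i, _, h⟩; exact ⟨i, h⟩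
  · rintro ⟨i, h⟩; exact ⟨i, trivial, h⟩

theorem nd_mem_brN {i : Ordinal.{0}} (h : brN i ∈ g.M) {x : Nd} (hx : ndN x ∈ g.M) :
    g.E (g.cl (ndN x)) (g.cl (brN i)) ↔ g.q.BrC i x := by
  rw [mem_brN h]
  constructor
  · rintro ⟨y, h1, h2, h3⟩
    rwa [(nd_inj hx h2).1 h3]
  · intro h; exact ⟨x, h, hx, rfl⟩

theorem unc_Iio : Uncountable (Set.Iio (Ordinal.omega.{0} 1)) := by
  rw [← not_countable_iff]
  intro h
  exact lt_irrefl _ (lt_omega1_iff.2 (Set.countable_coe_iff.1 h))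

theorem T_equi (hT : TN ∈ g.M) (hk : oN (Ordinal.omega 1) ∈ g.M) :
    EquinumV g.E (g.cl TN) (g.cl (oN (Ordinal.omega 1))) := by
  have : Uncountable {x : Nd // (0 : Ordinal.{0}) ∉ x.S} := by
    have := unc_Iio
    refine Function.Injective.uncountable
      (f := fun ξ : Set.Iio (Ordinal.omega.{0} 1) =>
        (⟨⟨ξ.1, ∅, ξ.2, Set.empty_subset _⟩, fun h => h⟩ : {x : Nd // (0 : Ordinal.{0}) ∉ x.S})) ?_
    intro a b h
    have h1 := congrArg (fun z : {x : Nd // (0 : Ordinal.{0}) ∉ x.S} => z.1.len) h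
    exact Subtype.ext h1
  obtain ⟨α, hα, lab, hl, hr⟩ := exists_lab {x : Nd // (0 : Ordinal.{0}) ∉ x.S}
  have clr_of : ∀ {i j : Nd}, lab ⟨i.clr, i.clr_0⟩ = lab ⟨j.clr, j.clr_0⟩ → i.clr = j.clr :=
    fun h => congrArg Subtype.val (hl h)
  refine equinum_lab (a := ndN) hT hk hα (fun x => lab ⟨x.clr, x.clr_0⟩) ?_ ?_ ?_ ?_
  · intro i; have : lab ⟨i.clr, i.clr_0⟩ ∈ Set.range lab := ⟨_, rfl⟩
    rwa [hr] at this
  · intro β hβ p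
    have : β ∈ Set.range lab := by rw [hr]; exact hβ
    obtain ⟨⟨y, hy⟩, rfl⟩ := this
    obtain ⟨p1, h1, h2, _⟩ := PP.raise p (le_max_left p.h y.len) (max_lt p.val.hlt y.lt)
    refine ⟨p1, h1, ?_⟩
    by_cases hK : p1.Killed y
    · have hpos : 0 < y.len := zero_le.trans_lt hK.pos
      refine ⟨y.st hpos, ?_, Or.inr ⟨Set.mem_insert _ _, ?_⟩⟩
      · congr 1; exact Subtype.ext (Nd.clr_st hpos hy)
      · rwa [Nd.clr_st hpos hy]
    · refine ⟨y, ?_, Or.inl ⟨hy, by rw [h2]; exact le_max_right _ _, fun z hz hzy => hK ⟨z, hz, hzy⟩⟩⟩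
      congr 1; exact Subtype.ext (Nd.clr_eq hy)
  · intro p i j hi hj h
    have e := clr_of h
    rcases hi with ⟨hi, hi'⟩ | ⟨hi, hi'⟩ <;> rcases hj with ⟨hj, hj'⟩ | ⟨hj, hj'⟩
    · rw [← Nd.clr_eq hi, e, Nd.clr_eq hj]
    · rw [← Nd.clr_eq hi, e] at hi'
      obtain ⟨y, hy, hy'⟩ := hj'
      exact (hi'.2 y hy hy').elim
    · rw [← Nd.clr_eq hj, ← e] at hj'
      obtain ⟨y, hy, hy'⟩ := hi'
      exact (hj'.2 y hy hy').elim
    · have h1 : i.clr.len = j.clr.len := by rw [e]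
      have h2 : i.S \ {0} = j.S \ {0} := by
        change i.clr.S = j.clr.S
        rw [e]
      refine Nd.ext h1 ?_
      rw [← Set.insert_sdiff_self_of_mem hi, ← Set.insert_sdiff_self_of_mem hj, h2]
  · intro g' hg i j _ _ h1 h2 h3
    rw [(nd_inj h1 h2).1 h3]

theorem T_levels (hT : TN ∈ g.M) (hk : oN (Ordinal.omega 1) ∈ g.M) {ξ : Ordinal.{0}} (hξ : ξ < Ordinal.omega 1)
    (hM : oN ξ ∈ g.M) : ∃ x, g.E x (g.cl TN) ∧ HasDomV g.E x (g.cl (oN ξ)) := by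
  obtain ⟨p, hp, x, hx, hb⟩ := PP.br_get g.q 0 hξ
  obtain ⟨g1, hg, hq, hS⟩ := ext g hp (Set.countable_singleton (ndN x))
  rw [hg.tr2 (fun V E x y => ∃ z, E z x ∧ HasDomV E z y) hT hM]
  have hxM : ndN x ∈ g1.M := hS rfl
  refine ⟨g1.cl (ndN x), (mem_TN (hg.sub hT)).2 ⟨x, Or.inl ⟨hb.zero, hb.alive.mono hq⟩, hxM, rfl⟩, ?_⟩
  exact (nd_dom_iff hxM (hg.sub hM)).2 hx

theorem T_tree (hT : TN ∈ g.M) (hk : oN (Ordinal.omega 1) ∈ g.M) :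
    IsOmega1TreeV g.E (g.cl (oN (Ordinal.omega 1))) (g.cl TN) := by
  refine ⟨?_, T_equi hT hk, ?_⟩
  · intro x hx
    obtain ⟨x, _, h, rfl⟩ := (mem_TN hT).1 hx
    exact nd_node h hk
  · intro a ha _
    obtain ⟨ξ, hξ, hM, rfl⟩ := (mem_oN hk).1 ha
    exact T_levels hT hk hξ hM

theorem br_comp {i : Ordinal.{0}} {p : PP} {x y : Nd} (hx : p.BrC i x) (hy : p.BrC i y) (hl : x.len ≤ y.len) : x ≤ y :=
  ⟨hl, fun b hb => bt_inj.1 (p.val.fn _ _ _ _ (hx b hb) (hy b (hb.trans_le hl)))⟩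

theorem br_branch (hT : TN ∈ g.M) (hk : oN (Ordinal.omega 1) ∈ g.M) {i : Ordinal.{0}} (hi : brN i ∈ g.M) :
    IsBranchV g.E (g.cl TN) (g.cl (brN i)) := by
  refine ⟨?_, ?_, ?_⟩
  · intro z hz
    obtain ⟨x, h1, h2, rfl⟩ := (mem_brN hi).1 hz
    exact (mem_TN hT).2 ⟨x, Or.inl ⟨h1.zero, h1.alive⟩, h2, rfl⟩
  · intro x y hx hy
    obtain ⟨x, h1, h2, rfl⟩ := (mem_brN hi).1 hx
    obtain ⟨y, h3, h4, rfl⟩ := (mem_brN hi).1 hy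
    rw [nd_sub h2 h4, nd_sub h4 h2]
    rcases le_total x.len y.len with h | h
    · exact Or.inl (br_comp h1 h3 h)
    · exact Or.inr (br_comp h3 h1 h)
  · rintro a ⟨x, hx, ha⟩
    obtain ⟨x, h1, h2, rfl⟩ := (mem_TN hT).1 hx
    have hl := nd_len_mem h2 hk
    obtain rfl := dom_unique ha (nd_dom h2 hl)
    obtain ⟨p, hp, y, hy, hb⟩ := PP.br_get g.q i x.lt
    obtain ⟨g1, hg, hq, hS⟩ := ext g hp (Set.countable_singleton (ndN y))
    rw [hg.tr2 (fun V E x y => ∃ z, E z x ∧ HasDomV E z y) hi hl]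
    have hyM : ndN y ∈ g1.M := hS rfl
    exact ⟨g1.cl (ndN y), (mem_brN (hg.sub hi)).2 ⟨y, hb.mono hq, hyM, rfl⟩,
      (nd_dom_iff hyM (hg.sub hl)).2 hy⟩

theorem brN_inj {i j : Ordinal.{0}} (hi : brN i ∈ g.M) (hj : brN j ∈ g.M)
    (h : g.cl (brN i) = g.cl (brN j)) : i = j := by
  by_contra hne
  obtain ⟨p, hp, ξ, hξ, h1, h2⟩ := PP.br_split g.q hne
  have hξ1 : ξ + 1 < Ordinal.omega 1 := (Order.add_one_le_of_lt hξ).trans_lt p.val.hlt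
  obtain ⟨p', hp', x, hx, hb⟩ := PP.br_get p i hξ1
  obtain ⟨g1, hg, hq, hS⟩ := ext g (hp'.trans hp) (Set.countable_singleton (ndN x))
  rw [hg.tr2 (fun V E x y => x = y) hi hj] at h
  have hM : ndN x ∈ g1.M := hS rfl
  have h3 := (nd_mem_brN (hg.sub hi) hM).2 (hb.mono hq)
  rw [h, nd_mem_brN (hg.sub hj) hM] at h3
  have hlt : ξ < x.len := by rw [hx]; exact lt_add_one ξ
  have e1 := g1.q.val.fn _ _ _ _ (hb.mono hq ξ hlt) (PP.cle (hq.trans hp') h1)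
  have e2 := g1.q.val.fn _ _ _ _ (h3 ξ hlt) (PP.cle (hq.trans hp') h2)
  exact one_ne_zero (e1.symm.trans e2)


/-- Nodes of a branch: lengths. -/
theorem br_step {b : Nm PP} (hT : TN ∈ g.M) (hk : oN (Ordinal.omega 1) ∈ g.M) (hG : GB ∈ g.M) (hb : b ∈ g.M)
    (hB : IsBranchV g.E (g.cl TN) (g.cl b)) (hn : ¬ g.E (g.cl b) (g.cl GB)) (p : PP) (hp : p ≤ g.q) :
    ∃ p' ≤ p, ∃ s : Nd, (∀ g' : GM PP, g'.q ≤ p' → b ∈ g'.M → ndN s ∈ g'.M → g'.E (g'.cl (ndN s)) (g'.cl b)) ∧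
      p.h < s.len ∧ s.len ≤ p'.h ∧ ∀ i, Act p.c i → ∃ ξ < s.len, (⟨.br i, ξ, bt (ξ ∉ s.S)⟩ : At) ∈ p'.c := by
  have hcA : {i | Act p.c i}.Countable := by
    have : {i | Act p.c i} ⊆ (fun a : At => match a.k with | .br i => i | _ => 0) '' p.c := by
      rintro i ⟨ξ, v, h⟩
      exact ⟨_, h, rfl⟩
    exact (p.val.cc.image _).mono this
  obtain ⟨g1, hg1, hq1, hS1⟩ := ext g hp (hcA.image brN)
  have hB1 := (hg1.tr2 (fun V E x y => IsBranchV E x y) hT hb).1 hB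
  have hn1 := mt (hg1.tr2 (fun V E x y => E x y) hb hG).2 hn
  have hk1 := hg1.sub hk
  have hT1 := hg1.sub hT
  have hb1 := hg1.sub hb
  have key : ∀ i, Act p.c i → ∃ x : Nd, ndN x ∈ g1.M ∧ g1.E (g1.cl (ndN x)) (g1.cl b) ∧ ¬ g1.q.BrC i x := by
    intro i hi
    have hiM : brN i ∈ g1.M := hS1 ⟨i, hi, rfl⟩
    by_contra hc
    push Not at hc
    have hsub : ∀ z, g1.E z (g1.cl b) → g1.E z (g1.cl (brN i)) := by
      intro z hz
      obtain ⟨x, _, hx, rfl⟩ := (mem_TN hT1).1 (hB1.1 z hz)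
      exact (nd_mem_brN hiM hx).2 (hc x hx hz)
    apply hn1
    rw [mem_GB (hg1.sub hG)]
    refine ⟨i, hiM, E_ext fun z => ⟨hsub z, fun hz => ?_⟩⟩
    obtain ⟨y, hy1, hy2, rfl⟩ := (mem_brN hiM).1 hz
    have hl := nd_len_mem hy2 hk1
    obtain ⟨w, hw, hd⟩ := hB1.2.2 (g1.cl (oN y.len)) ⟨_, (br_branch hT1 hk1 hiM).1 _ hz, nd_dom hy2 hl⟩
    obtain ⟨x, hx1, hx2, rfl⟩ := (mem_brN hiM).1 (hsub w hw)
    have e := (nd_dom_iff hx2 hl).1 hd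
    rwa [Nd.eq_of_le (br_comp hx1 hy1 e.le) e] at hw
  choose! X hX1 hX2 hX3 using key
  obtain ⟨γ, hγ, hγ'⟩ := countable_bdd (A := insert p.h ((fun i => (X i).len) '' {i | Act p.c i}))
    ((hcA.image _).insert _) (by
      rintro a (rfl | ⟨i, _, rfl⟩)
      · exact p.val.hlt
      · exact (X i).lt)
  obtain ⟨p2, hp2, hh, _⟩ := PP.raise g1.q (le_max_left g1.q.h γ) (max_lt g1.q.val.hlt hγ)
  obtain ⟨g2, hg2, hq2, hS2⟩ := ext g1 hp2 (Set.countable_singleton (oN γ))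
  have hγM : oN γ ∈ g2.M := hS2 rfl
  have hT2 := hg2.sub hT1
  have hk2 := hg2.sub hk1
  have hb2 := hg2.sub hb1
  have hB2 := (hg2.tr2 (fun V E x y => IsBranchV E x y) hT1 hb1).1 hB1
  obtain ⟨w, hw, hd⟩ := hB2.2.2 _ (T_levels hT2 hk2 hγ hγM)
  obtain ⟨s, hs1, hs2, rfl⟩ := (mem_TN hT2).1 (hB2.1 w hw)
  have hsl := (nd_dom_iff hs2 hγM).1 hd
  refine ⟨g2.q, hg2.le.trans hq1, s, ?_, ?_, ?_, ?_⟩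
  · intro g' hq' hb' hs'
    exact (tr2 (fun V E x y => E x y) hq' hs2 hs' hb2 hb').1 hw
  · rw [hsl]; exact hγ' _ (Set.mem_insert _ _)
  · rw [hsl]; refine le_trans ?_ (PP.hle hq2)
    rw [hh]; exact le_max_right _ _
  · intro i hi
    have hiM : brN i ∈ g1.M := hS1 ⟨i, hi, rfl⟩
    have hxb := (hg2.tr2 (fun V E x y => E x y) (hX1 i hi) hb1).1 (hX2 i hi)
    have hlt : (X i).len < s.len := by rw [hsl]; exact hγ' _ (Or.inr ⟨i, hi, rfl⟩)
    have hle : X i ≤ s := by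
      rcases hB2.2.1 _ _ hxb hw with h | h
      · exact (nd_sub (hg2.sub (hX1 i hi)) hs2).1 h
      · exact absurd ((nd_sub hs2 (hg2.sub (hX1 i hi))).1 h).1 (not_le.2 hlt)
    have hno : ¬ g2.q.BrC i (X i) := by
      intro h
      apply hX3 i hi
      rw [← nd_mem_brN hiM (hX1 i hi), hg2.tr2 (fun V E x y => E x y) (hX1 i hi) hiM]
      exact (nd_mem_brN (hg2.sub hiM) (hg2.sub (hX1 i hi))).2 h
    unfold PP.BrC at hno
    push Not at hno
    obtain ⟨ξ, hξ, hξ'⟩ := hno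
    refine ⟨ξ, hξ.trans hlt, ?_⟩
    obtain ⟨v, hv⟩ := g2.q.val.brt i (PP.Act.mono (PP.cle (hg2.le.trans hq1)) hi) ξ (by
      have : γ ≤ g2.q.h := by
        refine le_trans ?_ (PP.hle hq2)
        rw [hh]; exact le_max_right _ _
      exact (hξ.trans hlt).trans_le (hsl.le.trans this))
    have hv2 : v < 2 := (g2.q.val.bd _ hv).2
    rw [hle.2 ξ hξ] at hξ'
    by_cases hs : ξ ∈ s.S
    · rw [bt_t hs] at hξ'
      rw [bt_f (not_not.2 hs)]
      rcases PP.lt_two hv2 with rfl | rfl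
      · exact hv
      · exact (hξ' hv).elim
    · rw [bt_f hs] at hξ'
      rw [bt_t hs]
      rcases PP.lt_two hv2 with rfl | rfl
      · exact (hξ' hv).elim
      · exact hv

theorem br_all {b : Nm PP} (hT : TN ∈ g.M) (hk : oN (Ordinal.omega 1) ∈ g.M) (hG : GB ∈ g.M) (hb : b ∈ g.M)
    (hB : IsBranchV g.E (g.cl TN) (g.cl b)) : g.E (g.cl b) (g.cl GB) := by
  by_contra hn
  have step := br_step hT hk hG hb hB hn
  choose! F hF1 s hs1 hs2 hs3 hs4 using step
  let P : ℕ → PP := fun n => F^[n] g.q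
  have hPs : ∀ n, P (n + 1) = F (P n) := fun n => Function.iterate_succ_apply' F n g.q
  have hPq : ∀ n, P n ≤ g.q := by
    intro n
    induction n with
    | zero => exact le_rfl
    | succ n ih => rw [hPs]; exact (hF1 _ ih).trans ih
  have hanti : Antitone P := antitone_nat_of_succ_le fun n => by rw [hPs]; exact hF1 _ (hPq n)
  let t : ℕ → Nd := fun n => s (P n)
  have ht1 : ∀ n (g' : GM PP), g'.q ≤ P (n + 1) → b ∈ g'.M → ndN (t n) ∈ g'.M → g'.E (g'.cl (ndN (t n))) (g'.cl b) := by
    intro n g' h; rw [hPs] at h; exact hs1 _ (hPq n) g' h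
  have ht2 : ∀ n, (P n).h < (t n).len := fun n => hs2 _ (hPq n)
  have ht3 : ∀ n, (t n).len ≤ (P (n + 1)).h := fun n => by rw [hPs]; exact hs3 _ (hPq n)
  have ht4 : ∀ n i, Act (P n).c i → ∃ ξ < (t n).len, (⟨.br i, ξ, bt (ξ ∉ (t n).S)⟩ : At) ∈ (P (n + 1)).c := by
    intro n; rw [hPs]; exact hs4 _ (hPq n)
  have branchT : ∀ g', Ext g g' → IsBranchV g'.E (g'.cl TN) (g'.cl b) :=
    fun g' hg => (hg.tr2 (fun V E x y => IsBranchV E x y) hT hb).1 hB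
  have hcomp : ∀ n m, (t n).len ≤ (t m).len → t n ≤ t m := by
    intro n m hl
    obtain ⟨g1, hg, hq, hS⟩ := ext g (hPq (max n m + 1)) (S := {ndN (t n), ndN (t m)}) (by simp)
    have hnM : ndN (t n) ∈ g1.M := hS (by simp)
    have hmM : ndN (t m) ∈ g1.M := hS (by simp)
    have hbn := ht1 n g1 (hq.trans (hanti (by omega))) (hg.sub hb) hnM
    have hbm := ht1 m g1 (hq.trans (hanti (by omega))) (hg.sub hb) hmM
    rcases (branchT g1 hg).2.1 _ _ hbn hbm with h | h
    · exact (nd_sub hnM hmM).1 h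
    · have h' := (nd_sub hmM hnM).1 h
      exact (Nd.eq_of_le h' (le_antisymm h'.1 hl)).ge
  let δ := PP.sup P hanti
  have hδ : δ < Ordinal.omega 1 := PP.sup_lt P hanti
  have htδ : ∀ n, (t n).len ≤ δ := fun n => (ht3 n).trans (PP.le_sup P hanti _)
  have hPδ : ∀ n, (P n).h < δ := fun n => (ht2 n).trans_le (htδ n)
  have hcof : ∀ ξ < δ, ∃ n, ξ < (t n).len := by
    intro ξ hξ
    obtain ⟨n, hn⟩ := PP.lt_sup P hanti hξ
    exact ⟨n, hn.trans (ht2 n)⟩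
  let u : Nd := ⟨δ, {ξ | ξ < δ ∧ ∃ n, ξ ∈ (t n).S}, hδ, fun ξ h => h.1⟩
  have htu : ∀ n, t n ≤ u := by
    intro n
    refine ⟨htδ n, fun ξ hξ => ⟨fun h => ⟨hξ.trans_le (htδ n), n, h⟩, ?_⟩⟩
    rintro ⟨_, m, hm⟩
    rcases le_total (t n).len (t m).len with h | h
    · exact ((hcomp n m h).2 ξ hξ).2 hm
    · exact ((hcomp m n h).2 ξ ((t m).sub hm)).1 hm
  have hlim : LimO δ := by
    refine ⟨zero_le.trans_lt (hPδ 0), fun ξ hξ => ?_⟩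
    obtain ⟨n, hn⟩ := PP.lt_sup P hanti hξ
    exact (Order.add_one_le_of_lt hn).trans_lt (hPδ n)
  have hV := (PP.lim P hanti).val
  let Q : PP := ⟨δ, insert u (PP.lim P hanti).O, (PP.lim P hanti).c, by
    refine ⟨hV.hlt, hV.Oc.insert _, ?_, hV.cc, hV.bd, hV.fn, hV.inj, hV.brlt, hV.brt, hV.br0, ?_⟩
    · rintro x (rfl | hx)
      · exact ⟨hlim, le_rfl⟩
      · exact hV.Ol x hx
    · rintro x (rfl | hx) i hi
      · obtain ⟨n, hn⟩ := PP.lim_act hi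
        obtain ⟨ξ, h1, h2⟩ := ht4 n i hn
        refine ⟨ξ, h1.trans_le (htδ n), ?_⟩
        rw [← (htu n).2 ξ h1]
        exact Set.mem_iUnion.2 ⟨_, h2⟩
      · exact hV.dodge x hx i hi⟩
  have hQ : ∀ n, Q ≤ P n := by
    intro n
    have := PP.lim_le P hanti n
    refine ⟨this.1, this.2.1, this.2.2.1.trans (Set.subset_insert _ _), ?_⟩
    rintro x (rfl | hx) hl
    · exact absurd hl (not_le.2 (hPδ n))
    · exact this.2.2.2 x hx hl
  obtain ⟨g1, hg, hq, hS⟩ := ext g (hQ 0) (S := insert (oN 1) (insert (oN δ) (Set.range fun n => ndN (t n))))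
    (((Set.countable_range _).insert _).insert _)
  have h1M : oN 1 ∈ g1.M := hS (Or.inl rfl)
  have hδM : oN δ ∈ g1.M := hS (Or.inr (Or.inl rfl))
  have htM : ∀ n, ndN (t n) ∈ g1.M := fun n => hS (Or.inr (Or.inr ⟨n, rfl⟩))
  have hB1 := branchT g1 hg
  have hT1 := hg.sub hT
  have hk1 := hg.sub hk
  obtain ⟨w, hw, hd⟩ := hB1.2.2 _ (T_levels hT1 hk1 hδ hδM)
  obtain ⟨x, hx1, hx2, rfl⟩ := (mem_TN hT1).1 (hB1.1 w hw)
  have hxl := (nd_dom_iff hx2 hδM).1 hd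
  obtain ⟨w', hw', hd'⟩ := hB1.2.2 _ (T_levels hT1 hk1 (by exact_mod_cast omega1_pos_lt (n := 1)) h1M)
  obtain ⟨r, hr1, hr2, rfl⟩ := (mem_TN hT1).1 (hB1.1 w' hw')
  have hrl := (nd_dom_iff hr2 h1M).1 hd'
  have hlex : ∀ y, ndN y ∈ g1.M → g1.E (g1.cl (ndN y)) (g1.cl b) → y.len ≤ x.len → y ≤ x := by
    intro y hyM hy hl
    rcases hB1.2.1 _ _ hy hw with h | h
    · exact (nd_sub hyM hx2).1 h
    · have h' := (nd_sub hx2 hyM).1 h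
      exact (Nd.eq_of_le h' (le_antisymm h'.1 hl)).ge
  have hux : u = x := by
    refine Nd.eq_of_le ⟨hxl.ge, fun ξ hξ => ?_⟩ hxl.symm
    obtain ⟨n, hn⟩ := hcof ξ hξ
    have h1 := hlex (t n) (htM n) (ht1 n g1 (hq.trans (hQ _)) (hg.sub hb) (htM n)) (by rw [hxl]; exact htδ n)
    rw [← (htu n).2 ξ hn, h1.2 ξ hn]
  have hr0 : (0 : Ordinal.{0}) ∉ r.S := by
    rcases hr1 with ⟨h, _⟩ | ⟨_, h⟩
    · exact h
    · exact absurd (h.pos.trans_eq hrl) (lt_irrefl _)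
  have h1δ : (1 : Ordinal.{0}) ≤ δ := by
    have := hlim.2 0 hlim.1
    rw [zero_add] at this; exact this.le
  have hrx := hlex r hr2 hw' (by rw [hrl, hxl]; exact h1δ)
  have hx0 : (0 : Ordinal.{0}) ∉ x.S := by
    rwa [← hrx.2 0 (by rw [hrl]; exact zero_lt_one)]
  rcases hx1 with ⟨_, h⟩ | ⟨h, _⟩
  · exact h.2 u (PP.Ole hq (Or.inl rfl)) hux.le
  · exact hx0 h

theorem jk (hT : TN ∈ g.M) (hk : oN (Ordinal.omega 1) ∈ g.M) (hG : GB ∈ g.M) :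
    IsJechKunenV g.E (g.cl (oN (Ordinal.omega 1))) (g.cl TN) := by
  refine ⟨T_tree hT hk, ?_⟩
  intro bs p hbs hp
  have e : bs = g.cl GB := by
    refine E_ext fun z => ?_
    rw [hbs z]
    constructor
    · intro hz
      obtain ⟨z, hzM, rfl⟩ := cl_surj z
      exact br_all hT hk hG hzM hz
    · intro hz
      obtain ⟨i, hi, rfl⟩ := (mem_GB hG).1 hz
      exact br_branch hT hk hi
  obtain ⟨p, hpM, rfl⟩ := cl_surj p
  have powT : ∀ g', Ext g g' → IsPowOf g'.E (g'.cl p) (g'.cl (oN (Ordinal.omega 1))) :=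
    fun g' hg => (hg.tr2 (fun V E x y => IsPowOf E x y) hpM hk).1 hp
  subst e
  refine ⟨fun hinj => ?_, ?_, fun heq => ?_⟩
  · obtain ⟨S, h1, h2⟩ := cover_inj (a := brN) (b := fun j : Set.Iio (Ordinal.omega.{0} 1) => oN j.1) hG hk hinj
      (fun g' hg i hM => (mem_GB (hg.sub hG)).2 ⟨i, hM, rfl⟩) (oN_cover_tgt hk)
      (fun g' hg i i' hi hi' he => brN_inj hi hi' he)
    have : Small.{0} (Set.Iio (Ordinal.omega.{0} 1)) := Ordinal.small_Iio _
    exact not_cover_ord S h1 h2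
  · let f : Nm PP := fnN Ordinal.{0} brN (fun i => cohN {i}) (fun _ => ⊤)
    obtain ⟨g1, hg, -, hS⟩ := ext g le_rfl (Set.countable_singleton f)
    rw [hg.tr2 (fun V E x y => InjInto E x y) hG hpM]
    have hf : f ∈ g1.M := hS rfl
    refine injInto_of_fn hf ?_ ?_ ?_
    · intro i j _ _ h1 h2 h3 h4
      constructor
      · intro h; rw [brN_inj h1 h3 h]
      · intro h; rw [Set.singleton_injective (coh_inj h2 h4 h)]
    · intro x
      rw [mem_GB (hg.sub hG)]
      constructor
      · rintro ⟨i, _, h1, _, h2⟩; exact ⟨i, h1, h2⟩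
      · rintro ⟨i, hi, rfl⟩
        obtain ⟨g2, hg2, -, hS2⟩ := ext g1 le_rfl (Set.countable_singleton (cohN {i}))
        have h1 : ∃ y, FunVal g1.E (g1.cl f) (g1.cl (brN i)) y := by
          rw [hg2.tr2 (fun V E x y => ∃ z, FunVal E x y z) hf hi]
          exact ⟨g2.cl (cohN {i}), (funVal_fn (hg2.sub hf)).2 ⟨i, trivial, hg2.sub hi, hS2 rfl, rfl, rfl⟩⟩
        obtain ⟨y, hy⟩ := h1
        obtain ⟨k, h2, h3, h4, h5, h6⟩ := (funVal_fn hf).1 hy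
        exact ⟨k, h2, h3, h4, h5⟩
    · intro i _ _ h
      exact (powT g1 hg _).2 (coh_sub h (hg.sub hk))
  · obtain ⟨S, h1, h2⟩ := cover_equi (a := cohN) (b := brN) hpM hG heq
      (fun g' hg i hM => (powT g' hg _).2 (coh_sub hM (hg.sub hk)))
      (fun g' hg y hy => (mem_GB (hg.sub hG)).1 hy)
      (fun g' hg i i' hi hi' he => coh_inj hi hi' he)
    exact not_cover_set S h1 h2

end GM

end JK9

section JK10
set_option linter.unusedVariables false
set_option linter.unusedSectionVars false
set_option linter.unusedSimpArgs false

namespace GM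
variable {g : GM PP}

/-- The condition forces the node outside the name. -/
def NF (s : Nd) (b : Nm PP) (p : PP) : Prop := ∀ r ≤ p, ¬ Nm.memF (ndN s) b r

theorem NF.mono {s : Nd} {b : Nm PP} {p r : PP} (h : NF s b p) (hr : r ≤ p) : NF s b r :=
  fun r' h' => h r' (h'.trans hr)

/-- Name of the `δ`-th level of `K`. -/
noncomputable def LV (K : Nm PP) (δ : Ordinal.{0}) : Nm PP := Nm.mk Nd ndN fun x =>
  ⟨{p | x.len = δ ∧ Nm.memF (ndN x) K p}, fun p q hqp hp => ⟨hp.1, Nm.memF_mono hp.2 hqp⟩⟩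

theorem mem_LV {K : Nm PP} {δ : Ordinal.{0}} (h : LV K δ ∈ g.M) {w : g.N} : g.E w (g.cl (LV K δ)) ↔
    ∃ x : Nd, (x.len = δ ∧ Nm.memF (ndN x) K g.q) ∧ ndN x ∈ g.M ∧ w = g.cl (ndN x) := mem_mk h

theorem LV_level {K : Nm PP} {δ : Ordinal.{0}} (h : LV K δ ∈ g.M) (hK : K ∈ g.M)
    (hk : oN (Ordinal.omega 1) ∈ g.M) (hD : NDS ∈ g.M) (hδ : oN δ ∈ g.M)
    (hT : IsTreeV g.E (g.cl (oN (Ordinal.omega 1))) (g.cl K)) :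
    IsLevelSetOf g.E (g.cl K) (g.cl (oN δ)) (g.cl (LV K δ)) := by
  intro w
  rw [mem_LV h]
  constructor
  · rintro ⟨x, ⟨h1, h2⟩, h3, rfl⟩
    exact ⟨(cl_mem h3 hK).2 h2, (nd_dom_iff h3 hδ).2 h1⟩
  · rintro ⟨h1, h2⟩
    obtain ⟨x, hx, rfl⟩ := nd_decide hk hD (hT w h1)
    exact ⟨x, ⟨(nd_dom_iff hx hδ).1 h2, (cl_mem hx hK).1 h1⟩, hx, rfl⟩

/-- Countable sets of nodes get no new elements. -/
theorem ground_level {L : Nm PP} (hL : L ∈ g.M) (hc : CountableV g.E (g.cl L))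
    (hS : oS Ordinal.omega0 ⊆ g.M)
    (hel : ∀ w, g.E w (g.cl L) → ∃ x, ndN x ∈ g.M ∧ w = g.cl (ndN x))
    {g2 : GM PP} (he2 : Ext g g2) {x : Nd} (hx : ndN x ∈ g2.M) (hxL : g2.E (g2.cl (ndN x)) (g2.cl L)) :
    ndN x ∈ g.M := by
  have hw : oN Ordinal.omega0 ∈ g.M := oS_mem hS le_rfl
  have hn : ∀ n : ℕ, (oN (n : Ordinal) : Nm PP) ∈ g.M :=
    fun n => oS_mem hS (Ordinal.natCast_lt_omega0 n).le
  rw [countableV_iff hw] at hc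
  obtain ⟨f, ⟨hf, hr⟩, hi⟩ := hc
  obtain ⟨f, hfM, rfl⟩ := cl_surj f
  have A1 : InjFun g2.E (g2.cl f) := (he2.tr1 (fun V E x => InjFun E x) hfM).1 hi
  have A2 : IsFuncInto g2.E (g2.cl f) (g2.cl L) (g2.cl (oN Ordinal.omega0)) :=
    (he2.tr3 (fun V E x y z => IsFuncInto E x y z) hfM hL hw).1 ⟨hf, hr⟩
  obtain ⟨y, hy⟩ := (A2.1.2.2 (g2.cl (ndN x))).2 hxL
  obtain ⟨b, hb, hbM, rfl⟩ := (mem_oN (he2.sub hw)).1 (A2.2 _ _ hy)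
  obtain ⟨n, rfl⟩ := Ordinal.lt_omega0.1 hb
  have B : ∃ x, FunVal g.E (g.cl f) x (g.cl (oN n)) :=
    (he2.tr2 (fun V E x y => ∃ z, FunVal E x z y) hfM (hn n)).2 ⟨_, hy⟩
  obtain ⟨z, hz⟩ := B
  obtain ⟨c, hcM, rfl⟩ := hel z ((hf.2.2 z).1 ⟨_, hz⟩)
  have hx2 : FunVal g2.E (g2.cl f) (g2.cl (ndN c)) (g2.cl (oN n)) :=
    (he2.tr3 (fun V E x y z => FunVal E x y z) hfM hcM (hn n)).1 hz
  rwa [(nd_inj hx (he2.sub hcM)).1 (A1 _ _ _ hy hx2)]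

/-- Membership of a node in a branch is decided by higher nodes. -/
theorem below {K b : Nm PP} (hk : oN (Ordinal.omega 1) ∈ g.M) (hD : NDS ∈ g.M)
    (hT : IsOmega1TreeV g.E (g.cl (oN (Ordinal.omega 1))) (g.cl K))
    (hB : IsBranchV g.E (g.cl K) (g.cl b)) {s d : Nd} (hs : ndN s ∈ g.M) (hd : ndN d ∈ g.M)
    (hdb : g.E (g.cl (ndN d)) (g.cl b)) (hl : s.len ≤ d.len) :
    g.E (g.cl (ndN s)) (g.cl b) ↔ s ≤ d := by
  have key : ∀ s, ndN s ∈ g.M → s.len ≤ d.len → g.E (g.cl (ndN s)) (g.cl b) → s ≤ d := by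
    intro s hs hl h
    rcases hB.2.1 _ _ h hdb with h | h
    · exact (nd_sub hs hd).1 h
    · have h' := (nd_sub hd hs).1 h
      exact (Nd.eq_of_le h' (le_antisymm h'.1 hl)).ge
  refine ⟨key s hs hl, fun h => ?_⟩
  have hlM := nd_len_mem hs hk
  obtain ⟨w, hw, hwd⟩ := hB.2.2 _ (hT.2.2 _ (oN_lt hlM hk s.lt) (oN_ord hlM))
  obtain ⟨s', hs', rfl⟩ := nd_decide hk hD (hT.1 w (hB.1 w hw))
  have e := (nd_dom_iff hs' hlM).1 hwd
  have h2 := key s' hs' (e.le.trans hl) hw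
  rwa [Nd.eq_of_le (Nd.comp_of_le h2 h e.le) e] at hw

/-- `J` decides membership of nodes in `K`. -/
def JD (J : Set Co) (K : Nm PP) : Prop :=
  ∀ p p' s, PP.Eqv J p p' → Nm.memF (ndN s) K p → ¬ NF s K p'

theorem exists_JD (K : Nm PP) : ∃ J : Set Co, Small.{0} J ∧ JD J K := by
  have h : ∀ (x : Nd) (p : PP), ∃ r ≤ p, (∃ r ≤ p, Nm.memF (ndN x) K r) → Nm.memF (ndN x) K r := by
    intro x p
    by_cases h : ∃ r ≤ p, Nm.memF (ndN x) K r
    · obtain ⟨r, h1, h2⟩ := h; exact ⟨r, h1, fun _ => h2⟩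
    · exact ⟨p, le_rfl, fun h' => (h h').elim⟩
  choose Φ h1 h2 using h
  obtain ⟨J, hJ, -, hc⟩ := PP.capture (X := Nd) Φ ∅
  refine ⟨J, hJ, fun p p' s he hp hn => ?_⟩
  have h3 := h2 s (PP.res J p) ⟨p, PP.le_res J p, hp⟩
  have h4 : Φ s (PP.res J p) ≤ PP.res J p' := by
    rw [← PP.res_congr he]; exact h1 _ _
  obtain ⟨r, hr, hr', -⟩ := PP.compat h4 (hc _ _ (PP.res_on J p))
  exact hn r hr (Nm.memF_mono h3 hr')

/-- The name of the set of nodes coded by `D`. -/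
noncomputable def dN (J : Set Co) (D : Set ({p : PP // PP.On J p} × Nd)) : Nm PP := Nm.mk Nd ndN fun x =>
  ⟨{p | ∃ e, (e, x) ∈ D ∧ p ≤ e.1}, fun p q hqp ⟨e, h, h'⟩ => ⟨e, h, hqp.trans h'⟩⟩

theorem mem_dN {J : Set Co} {D : Set ({p : PP // PP.On J p} × Nd)} (h : dN J D ∈ g.M) {w : g.N} :
    g.E w (g.cl (dN J D)) ↔
    ∃ x : Nd, (∃ e, (e, x) ∈ D ∧ g.q ≤ e.1) ∧ ndN x ∈ g.M ∧ w = g.cl (ndN x) := mem_mk h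

/-- The name of the set of all branches of `K`. -/
noncomputable def BSN (J : Set Co) (K : Nm PP) : Nm PP := Nm.mk (Set ({p : PP // PP.On J p} × Nd)) (dN J) fun D =>
  ⟨{p | ∀ g' : GM PP, g'.q ≤ p → K ∈ g'.M → dN J D ∈ g'.M → IsBranchV g'.E (g'.cl K) (g'.cl (dN J D))},
    fun p q hqp hp g' hg' => hp g' (hg'.trans hqp)⟩

def NonSplit (J : Set Co) (b : Nm PP) (r : PP) : Prop :=
  ∀ p0 ≤ r, ∀ p1 ≤ r, ∀ s, PP.Eqv J p0 p1 → Nm.memF (ndN s) b p0 → ¬ NF s b p1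

theorem nonsplit_eq {J : Set Co} {b : Nm PP} {r : PP} (hr : NonSplit J b r) :
    ∃ D : Set ({p : PP // PP.On J p} × Nd), ∀ g' : GM PP, g'.q ≤ r → b ∈ g'.M → dN J D ∈ g'.M →
      (∀ w, g'.E w (g'.cl b) → ∃ x, ndN x ∈ g'.M ∧ w = g'.cl (ndN x)) → g'.cl b = g'.cl (dN J D) := by
  refine ⟨{d | ∃ p ≤ r, Nm.memF (ndN d.2) b p ∧ PP.res J p = d.1.1}, ?_⟩
  intro g' hg hb hd hel
  refine E_ext fun w => ?_
  rw [mem_dN hd]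
  constructor
  · intro hw
    obtain ⟨x, hx, rfl⟩ := hel w hw
    exact ⟨x, ⟨⟨PP.res J g'.q, PP.res_on J _⟩, ⟨g'.q, hg, (cl_mem hx hb).1 hw, rfl⟩, PP.le_res J _⟩, hx, rfl⟩
  · rintro ⟨x, ⟨⟨e, he⟩, ⟨p, hp, hp1, hp2⟩, hq⟩, hx, rfl⟩
    rw [cl_mem hx hb]
    refine Nm.memF_reg fun p1 hp1' => ?_
    by_contra hc
    push Not at hc
    subst hp2
    have h1 : PP.res J p1 ≤ PP.res J p := by
      have := PP.res_mono (J := J) (hp1'.trans hq)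
      rwa [(PP.res_eqv J (PP.res J p)).symm.eq (PP.res_on J _) he] at this
    obtain ⟨r', h2, -, h3⟩ := PP.compat h1 (PP.res_on J p1)
    exact hr r' (h2.trans hp) p1 (hp1'.trans hg) x (h3.trans (PP.res_eqv J p1).symm) (Nm.memF_mono hp1 h2) hc

theorem multi_split {J : Set Co} {b : Nm PP} {q : PP} (hsp : ∀ r ≤ q, ¬ NonSplit J b r)
    {ι : Type} (σ : ι → PP) (hσ : ∀ i, σ i ≤ q) (he : ∀ i j, PP.Eqv J (σ i) (σ j)) (t : Finset ι) :
    ∃ τ : Bool → ι → PP, (∀ c i, τ c i ≤ σ i) ∧ (∀ c i c' i', PP.Eqv J (τ c i) (τ c' i')) ∧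
      ∀ i ∈ t, ∃ s, Nm.memF (ndN s) b (τ false i) ∧ NF s b (τ true i) := by
  classical
  induction t using Finset.induction_on with
  | empty => exact ⟨fun _ => σ, fun _ _ => le_rfl, fun _ i _ j => he i j, by simp⟩
  | insert i t hi ih =>
    obtain ⟨τ, h1, h2, h3⟩ := ih
    have := hsp (τ false i) ((h1 _ _).trans (hσ i))
    unfold NonSplit at this
    push Not at this
    obtain ⟨p0, hp0, p1, hp1, s, h01, hs0, hs1⟩ := this
    have hb : ∀ c j, ∃ r ≤ τ c j, PP.Eqv J r p0 := fun c j => PP.bisim (h2 false i c j) hp0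
    choose ρ hρ1 hρ2 using hb
    refine ⟨fun c j => if j = i then (if c then p1 else p0) else ρ c j, ?_, ?_, ?_⟩
    · intro c j
      by_cases hj : j = i
      · subst hj
        cases c
        · simpa using hp0.trans (h1 _ _)
        · simpa using hp1.trans (h1 _ _)
      · simpa [hj] using (hρ1 c j).trans (h1 _ _)
    · have : ∀ c j, PP.Eqv J (if j = i then (if c then p1 else p0) else ρ c j : PP) p0 := by
        intro c j
        by_cases hj : j = i
        · cases c
          · simpa [hj] using PP.Eqv.refl J p0
          · simpa [hj] using h01.symm
        · simpa [hj] using hρ2 c j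
      exact fun c j c' j' => (this c j).trans (this c' j').symm
    · intro j hj
      by_cases hji : j = i
      · exact ⟨s, by simpa [hji] using hs0, by simpa [hji] using hs1⟩
      · obtain ⟨s', h4, h5⟩ := h3 j ((Finset.mem_insert.1 hj).resolve_left hji)
        exact ⟨s', by simpa [hji] using Nm.memF_mono h4 (hρ1 _ _), by simpa [hji] using h5.mono (hρ1 _ _)⟩

/-- initial segments, reversed -/
def seg (f : ℕ → Bool) : ℕ → List Bool
  | 0 => []
  | n + 1 => f n :: seg f n

theorem seg_len (f : ℕ → Bool) (n : ℕ) : (seg f n).length = n := by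
  induction n with
  | zero => rfl
  | succ n ih => simp [seg, ih]

theorem seg_congr {f f' : ℕ → Bool} (n : ℕ) (h : ∀ m < n, f m = f' m) : seg f n = seg f' n := by
  induction n with
  | zero => rfl
  | succ n ih => rw [seg, seg, ih fun m hm => h m (hm.trans (Nat.lt_succ_self n)), h n (Nat.lt_succ_self n)]

/-- A perfect system of conditions. -/
theorem perfect {J : Set Co} {b : Nm PP} {q : PP} (hsp : ∀ r ≤ q, ¬ NonSplit J b r) :
    ∃ (p : (ℕ → Bool) → PP) (s : List Bool → Nd), (∀ f, p f ≤ q) ∧ (∀ f f', PP.Eqv J (p f) (p f')) ∧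
      ∀ f n, (f n = false → Nm.memF (ndN (s (seg f n))) b (p f)) ∧ (f n = true → NF (s (seg f n)) b (p f)) := by
  classical
  let St := {σ : List Bool → PP // (∀ i, σ i ≤ q) ∧ ∀ i j, PP.Eqv J (σ i) (σ j)}
  have step : ∀ (n : ℕ) (σ : St), ∃ σ' : St, (∀ c l, σ'.1 (c :: l) ≤ σ.1 l) ∧
      ∀ l : List Bool, l.length = n → ∃ s, Nm.memF (ndN s) b (σ'.1 (false :: l)) ∧ NF s b (σ'.1 (true :: l)) := by
    intro n σ
    have hfin : {l : List Bool | l.length = n}.Finite := List.finite_length_eq Bool n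
    obtain ⟨τ, h1, h2, h3⟩ := multi_split hsp σ.1 σ.2.1 σ.2.2 hfin.toFinset
    refine ⟨⟨fun l => match l with | [] => τ false [] | c :: l => τ c l, ?_, ?_⟩, ?_, ?_⟩
    · rintro (_ | ⟨c, l⟩)
      · exact (h1 _ _).trans (σ.2.1 _)
      · exact (h1 _ _).trans (σ.2.1 _)
    · rintro (_ | ⟨c, l⟩) (_ | ⟨c', l'⟩) <;> exact h2 _ _ _ _
    · intro c l; exact h1 c l
    · intro l hl; exact h3 l (by simpa using hl)
  choose F hF1 hF2 using step
  let σ : ℕ → St := fun n => Nat.rec ⟨fun _ => q, fun _ => le_rfl, fun _ _ => PP.Eqv.refl _ _⟩ (fun n s => F n s) n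
  have hσ : ∀ n, σ (n + 1) = F n (σ n) := fun n => rfl
  have hanti : ∀ f, Antitone fun n => (σ n).1 (seg f n) := by
    intro f
    refine antitone_nat_of_succ_le fun n => ?_
    change (σ (n + 1)).1 (seg f (n + 1)) ≤ _
    rw [hσ]; exact hF1 n (σ n) (f n) (seg f n)
  have hs : ∀ l : List Bool, ∃ s, Nm.memF (ndN s) b ((σ (l.length + 1)).1 (false :: l)) ∧
      NF s b ((σ (l.length + 1)).1 (true :: l)) := fun l => by
    rw [hσ]; exact hF2 _ _ l rfl
  choose s hs1 hs2 using hs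
  refine ⟨fun f => PP.lim _ (hanti f), s, ?_, ?_, ?_⟩
  · intro f; exact (PP.lim_le _ (hanti f) 0).trans ((σ 0).2.1 _)
  · intro f f'
    exact PP.lim_eqv (hanti f) (hanti f') fun n => (σ n).2.2 _ _
  · intro f n
    have h := PP.lim_le _ (hanti f) (n + 1)
    constructor
    · intro hf
      have := hs1 (seg f n)
      rw [seg_len, ← hf] at this
      exact Nm.memF_mono this h
    · intro hf
      have := hs2 (seg f n)
      rw [seg_len, ← hf] at this
      exact this.mono h

theorem exists_nonsplit {J : Set Co} {K b : Nm PP} (hJ : JD J K) (hK : K ∈ g.M) (hb : b ∈ g.M)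
    (hk : oN (Ordinal.omega 1) ∈ g.M) (hD : NDS ∈ g.M)
    (hKu : IsKurepaV g.E (g.cl (oN (Ordinal.omega 1))) (g.cl K))
    (hB : IsBranchV g.E (g.cl K) (g.cl b)) : ∃ r ≤ g.q, NonSplit J b r := by
  by_contra hsp
  push Not at hsp
  obtain ⟨p, s, hpq, hpe, hps⟩ := perfect hsp
  obtain ⟨δ, hδ, hδ'⟩ := countable_bdd (A := Set.range fun l => (s l).len) (Set.countable_range _)
    (by rintro a ⟨l, rfl⟩; exact (s l).lt)
  have KuT : ∀ g', Ext g g' → IsKurepaV g'.E (g'.cl (oN (Ordinal.omega 1))) (g'.cl K) :=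
    fun g' hg => (hg.tr2 (fun V E x y => IsKurepaV E x y) hk hK).1 hKu
  have BrT : ∀ g', Ext g g' → IsBranchV g'.E (g'.cl K) (g'.cl b) :=
    fun g' hg => (hg.tr2 (fun V E x y => IsBranchV E x y) hK hb).1 hB
  obtain ⟨g1, hg1, hq1, hS1⟩ := ext g (hpq fun _ => false)
    (S := oS Ordinal.omega0 ∪ {oN δ, LV K δ}) ((oS_countable omega0_lt_omega1).union (by simp))
  have hδM : oN δ ∈ g1.M := hS1 (Or.inr (by simp))
  have hLM : LV K δ ∈ g1.M := hS1 (Or.inr (by simp))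
  have hKu1 := KuT g1 hg1
  have hlev := LV_level hLM (hg1.sub hK) (hg1.sub hk) (hg1.sub hD) hδM hKu1.1.1
  have hcount := hKu1.2.1 _ _ (oN_lt hδM (hg1.sub hk) hδ) hlev
  have hC : {x : Nd | ndN x ∈ g1.M}.Countable := by
    refine Set.MapsTo.countable_of_injOn (f := ndN (P := PP)) (t := g1.M) (fun b hb => hb) ?_ g1.M_countable
    intro x hx y hy hxy
    exact (nd_inj hx hy).1 (by rw [hxy])
  have key : ∀ f, ∃ (gf : GM PP) (d : Nd), Ext g gf ∧ gf.q ≤ p f ∧ ndN d ∈ gf.M ∧ d.len = δ ∧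
      gf.E (gf.cl (ndN d)) (gf.cl b) ∧ ndN d ∈ g1.M := by
    intro f
    obtain ⟨r, hr, hre⟩ := PP.bisim (hpe (fun _ => false) f) hq1
    obtain ⟨gf, hgf, hqf, hSf⟩ := ext g (hr.trans (hpq f)) (Set.countable_singleton (oN δ))
    have hδf : oN δ ∈ gf.M := hSf rfl
    have hTf := (KuT gf hgf).1
    have hBf := BrT gf hgf
    have hkf := hgf.sub hk
    obtain ⟨w, hw, hwd⟩ := hBf.2.2 _ (hTf.2.2 _ (oN_lt hδf hkf hδ) (oN_ord hδf))
    obtain ⟨d, hd, rfl⟩ := nd_decide hkf (hgf.sub hD) (hTf.1 w (hBf.1 w hw))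
    have hdl := (nd_dom_iff hd hδf).1 hwd
    refine ⟨gf, d, hgf, hqf.trans hr, hd, hdl, hw, ?_⟩
    have hmem : Nm.memF (ndN d) K gf.q := (cl_mem hd (hgf.sub hK)).1 (hBf.1 _ hw)
    obtain ⟨p2, hp2, hp2e⟩ := PP.bisim hre hqf
    have hn := hJ gf.q p2 d hp2e.symm hmem
    unfold NF at hn
    push Not at hn
    obtain ⟨r2, hr2, hm2⟩ := hn
    obtain ⟨g2, hg2, hq2, hS2⟩ := ext g1 (hr2.trans hp2) (Set.countable_singleton (ndN d))
    have hd2 : ndN d ∈ g2.M := hS2 rfl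
    refine ground_level hLM hcount (fun x hx => hS1 (Or.inl hx)) ?_ hg2 hd2 ?_
    · intro w hw
      obtain ⟨x, _, hx, rfl⟩ := (mem_LV hLM).1 hw
      exact ⟨x, hx, rfl⟩
    · exact (mem_LV (hg2.sub hLM)).2 ⟨d, ⟨hdl, Nm.memF_mono hm2 hq2⟩, hd2, rfl⟩
  choose gf d h1 h2 h3 h4 h5 h6 using key
  have main : ∀ f f' n, (∀ m < n, f m = f' m) → f n = false → f' n = true → d f = d f' → False := by
    intro f f' n hm hf hf' hdd
    have hlt : ∀ f, (s (seg f n)).len ≤ (d f).len := fun f => by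
      rw [h4]; exact (hδ' _ ⟨_, rfl⟩).le
    have dec : ∀ f, ∃ g' : GM PP, Ext (gf f) g' ∧ ndN (s (seg f n)) ∈ g'.M ∧
        (g'.E (g'.cl (ndN (s (seg f n)))) (g'.cl b) ↔ s (seg f n) ≤ d f) := by
      intro f
      obtain ⟨g', hg', -, hS⟩ := ext (gf f) le_rfl (Set.countable_singleton (ndN (s (seg f n))))
      have hgg := (h1 f).trans hg'
      refine ⟨g', hg', hS rfl, below (hgg.sub hk) (hgg.sub hD) (KuT g' hgg).1 (BrT g' hgg) (hS rfl)
        (hg'.sub (h3 f)) ?_ (hlt f)⟩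
      exact (hg'.tr2 (fun V E x y => E x y) (h3 f) ((h1 f).sub hb)).1 (h5 f)
    obtain ⟨ga, ha1, ha2, ha3⟩ := dec f
    obtain ⟨gb, hb1, hb2, hb3⟩ := dec f'
    have e1 := ha3.1 ((cl_mem ha2 (ha1.sub ((h1 f).sub hb))).2
      (Nm.memF_mono ((hps f n).1 hf) (ha1.le.trans (h2 f))))
    rw [hdd, seg_congr n hm] at e1
    have e2 := (cl_mem hb2 (hb1.sub ((h1 f').sub hb))).1 (hb3.2 e1)
    exact (hps f' n).2 hf' _ (hb1.le.trans (h2 f')) e2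
  have hinj : Function.Injective d := by
    intro f f' hdd
    by_contra hne
    have hex : ∃ n, f n ≠ f' n := Function.ne_iff.1 hne
    have hmin : ∀ m < Nat.find hex, f m = f' m := fun m hm => not_not.1 (Nat.find_min hex hm)
    have hfn := Nat.find_spec hex
    rcases hb1 : f (Nat.find hex) with _ | _
    · refine main f f' _ hmin hb1 ?_ hdd
      rw [hb1] at hfn
      rcases hb2 : f' (Nat.find hex) with _ | _
      · exact (hfn hb2.symm).elim
      · rfl
    · refine main f' f _ (fun m hm => (hmin m hm).symm) ?_ hb1 hdd.symm
      rw [hb1] at hfn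
      rcases hb2 : f' (Nat.find hex) with _ | _
      · rfl
      · exact (hfn hb2.symm).elim
  have hct : Countable (ℕ → Bool) := by
    have := hC.to_subtype
    exact Function.Injective.countable (f := fun f => (⟨d f, h6 f⟩ : {x : Nd | ndN x ∈ g1.M}))
      fun f f' h => hinj (Subtype.mk.inj h)
  obtain ⟨e, he⟩ := exists_surjective_nat (ℕ → Bool)
  obtain ⟨n, hn⟩ := he fun n => !(e n n)
  have := congrFun hn n
  simp at this

theorem no_kurepa (hk : oN (Ordinal.omega 1) ∈ g.M) (hD : NDS ∈ g.M) (t : g.N) :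
    ¬ IsKurepaV g.E (g.cl (oN (Ordinal.omega 1))) t := by
  intro hKu
  obtain ⟨K, hK, rfl⟩ := cl_surj t
  obtain ⟨J, hJs, hJ⟩ := exists_JD K
  obtain ⟨g1, hg1, -, hS1⟩ := ext g le_rfl (Set.countable_singleton (BSN J K))
  rw [hg1.tr2 (fun V E x y => IsKurepaV E x y) hk hK] at hKu
  have hBM : BSN J K ∈ g1.M := hS1 rfl
  have hk1 := hg1.sub hk
  have hD1 := hg1.sub hD
  have hK1 := hg1.sub hK
  have hbs : IsBranchSetOf g1.E (g1.cl K) (g1.cl (BSN J K)) := by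
    intro z
    constructor
    · intro hz
      obtain ⟨D, h1, h2, rfl⟩ := (mem_mk hBM).1 hz
      exact h1 g1 le_rfl hK1 h2
    · intro hz
      obtain ⟨b, hb, rfl⟩ := cl_surj z
      obtain ⟨r, hr, hns⟩ := exists_nonsplit hJ hK1 hb hk1 hD1 hKu hz
      obtain ⟨D, hDe⟩ := nonsplit_eq hns
      obtain ⟨g2, hg2, hq2, hS2⟩ := ext g1 hr (Set.countable_singleton (dN J D))
      have hdM : dN J D ∈ g2.M := hS2 rfl
      have hB2 := (hg2.tr2 (fun V E x y => IsBranchV E x y) hK1 hb).1 hz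
      have hKu2 := (hg2.tr2 (fun V E x y => IsKurepaV E x y) hk1 hK1).1 hKu
      rw [hg2.tr2 (fun V E x y => E x y) hb hBM]
      have e := hDe g2 hq2 (hg2.sub hb) hdM fun w hw =>
        nd_decide (hg2.sub hk1) (hg2.sub hD1) (hKu2.1.1 w (hB2.1 w hw))
      rw [e] at hB2 ⊢
      refine mk_mem (hg2.sub hBM) D ?_ hdM
      intro g' hg' hK' hd'
      exact (tr2 (fun V E x y => IsBranchV E x y) hg' (hg2.sub hK1) hK' hdM hd').1 hB2
  have := PP.small_on J
  have : Small.{0} (BSN J K).idx := inferInstanceAs (Small.{0} (Set ({p : PP // PP.On J p} × Nd)))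
  exact hKu.2.2 _ hbs (inj_small hBM hk1)

end GM

end JK10

/-- **Theorem 8.** Assume the existence of a strongly inaccessible cardinal is
consistent with ZFC. Then it is consistent with ZFC + CH + `2^{ω₁} > ω₂` that there
exists a Jech–Kunen tree and there are no Kurepa trees. Consistency is expressed
semantically: from a model of ZFC with a strongly inaccessible cardinal we obtain a
model of ZFC satisfying CH, `2^{ω₁} > ω₂`, in which some ω₁-tree is Jech–Kunen and
no ω₁-tree is Kurepa. -/
theorem consistency_jech_kunen_no_kurepa
    (hCon : ∃ (V : Type) (str : memLang.Structure V),
      ZFCTheory.Model V ∧ ∃ κ : V, IsInaccessibleV (memE V str) κ) :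
    ∃ (V : Type) (str : memLang.Structure V),
      ZFCTheory.Model V ∧
      CHV (memE V str) ∧
      PowOmega1AboveOmega2V (memE V str) ∧
      ∀ k₁ : V, IsOmega1V (memE V str) k₁ →
        (∃ t : V, IsJechKunenV (memE V str) k₁ t) ∧
        (∀ t : V, ¬ IsKurepaV (memE V str) k₁ t) := by
  obtain ⟨g, -, hS⟩ := GM.exi PP.top (S := {GM.oN Ordinal.omega0, GM.oN (Ordinal.omega 1), GM.kN, GM.PWN,
    GM.NDS, GM.TN, GM.GB}) (by simp)
  have hw : GM.oN Ordinal.omega0 ∈ g.M := hS (by simp)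
  have hk : GM.oN (Ordinal.omega 1) ∈ g.M := hS (by simp)
  have hK : GM.kN ∈ g.M := hS (by simp)
  have hP : GM.PWN ∈ g.M := hS (by simp)
  have hD : GM.NDS ∈ g.M := hS (by simp)
  have hT : GM.TN ∈ g.M := hS (by simp)
  have hG : GM.GB ∈ g.M := hS (by simp)
  refine ⟨g.N, strOf g.E, GM.zfc_model g, ?_, ?_, ?_⟩
  · exact GM.chv hw hP hk
  · exact GM.pow_above hK hk
  · intro k₁ h
    have e : k₁ = g.cl (GM.oN (Ordinal.omega 1)) := GM.omega1_unique h (GM.oN_omega1 hk)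
    subst e
    exact ⟨⟨_, GM.jk hT hk hG⟩, fun t => GM.no_kurepa hk hD t⟩
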